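/- arXiv:1905.07426 — 2 statements merged into one kernel-verified Lean document; each statement's English description precedes it below -/
import Mathlib

section
/- Let α ∈ (0,1) and let r satisfy 1 ≤ r ≤ (3−α)/α. Let the temporal mesh be quasi-graded with parameter r and constants c_0 ≤ C_0, and satisfy the Alikhanov mesh condition. Then there exists a constant C > 0, depending only on α, γ, r, T, c_0, C_0, such that: for every γ ∈ ℝ and every real sequence V^0,...,V^M with V^0 = 0 and |δ_t^{α,*} V^j| ≤ (τ/t_j)^{γ+1} for all j = 1,...,M, one has |V^j| ≤ C 𝒱^j for all j = 1,...,M. -/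
open Real MeasureTheory Set

/-- The L1 discrete fractional-derivative operator associated with the mesh `t`,
applied to the sequence `V`, at time level `m`. -/
noncomputable def deltaL1 (α : ℝ) (t : ℕ → ℝ) (V : ℕ → ℝ) (m : ℕ) : ℝ :=
  (1 / Real.Gamma (1 - α)) *
    ∑ j ∈ Finset.Icc 1 m,
      ((V j - V (j - 1)) / (t j - t (j - 1))) *
        ∫ s in (t (j - 1))..(t j), (t m - s) ^ (-α)

/-- `t 0 = 0 < t 1 < ... < t M = T` with `M ≥ 2`. -/
def IsMesh (T : ℝ) (M : ℕ) (t : ℕ → ℝ) : Prop :=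
  2 ≤ M ∧ t 0 = 0 ∧ (∀ j, j < M → t j < t (j + 1)) ∧ t M = T

/-- Quasi-graded mesh with parameter `r` and constants `c0 ≤ C0`. -/
def QuasiGraded (r c0 C0 : ℝ) (M : ℕ) (t : ℕ → ℝ) : Prop :=
  (c0 * (M : ℝ) ^ (-r) ≤ t 1 ∧ t 1 ≤ C0 * (M : ℝ) ^ (-r)) ∧
  (∀ j : ℕ, 1 ≤ j → j ≤ M →
    c0 * (t 1 * (j : ℝ) ^ r) ≤ t j ∧ t j ≤ C0 * (t 1 * (j : ℝ) ^ r)) ∧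
  (∀ j : ℕ, 1 ≤ j → j ≤ M →
    c0 * ((t 1) ^ (1 / r) * (t j) ^ (1 - 1 / r)) ≤ t j - t (j - 1) ∧
    t j - t (j - 1) ≤ C0 * ((t 1) ^ (1 / r) * (t j) ^ (1 - 1 / r)))

/-- The stability majorant `𝒱^j`. -/
noncomputable def Vcal (α γ τ tj : ℝ) : ℝ :=
  if 0 < γ then τ * tj ^ (α - 1)
  else if γ = 0 then τ * tj ^ (α - 1) * (1 + Real.log (tj / τ))
  else τ * tj ^ (α - 1) * (τ / tj) ^ γ

/-- Linear Lagrange interpolant with data `(a, ya)`, `(b, yb)`. -/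
noncomputable def lagLin (a b ya yb s : ℝ) : ℝ := ya + (yb - ya) / (b - a) * (s - a)

/-- Quadratic Lagrange interpolant with data `(x0, y0)`, `(x1, y1)`, `(x2, y2)`. -/
noncomputable def lagQuad (x0 x1 x2 y0 y1 y2 s : ℝ) : ℝ :=
  y0 * ((s - x1) * (s - x2)) / ((x0 - x1) * (x0 - x2)) +
  y1 * ((s - x0) * (s - x2)) / ((x1 - x0) * (x1 - x2)) +
  y2 * ((s - x0) * (s - x1)) / ((x2 - x0) * (x2 - x1))

/-- The Alikhanov collocation point `t_m^* = t_m - (α/2) τ_m`. -/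
noncomputable def tStar (α : ℝ) (t : ℕ → ℝ) (m : ℕ) : ℝ :=
  t m - (α / 2) * (t m - t (m - 1))

/-- The Alikhanov discrete fractional-derivative operator `δ_t^{α,*}`:
`(1/Γ(1-α)) ∫_0^{t_m^*} (t_m^* - s)^{-α} (Π^m U)'(s) ds`, where `Π^m U` is the
quadratic Lagrange interpolant of `(t_{j-1},U^{j-1}), (t_j,U^j), (t_{j+1},U^{j+1})`
on `(t_{j-1},t_j)` for `j < m`, and the linear interpolant of
`(t_{m-1},U^{m-1}), (t_m,U^m)` on `(t_{m-1}, t_m^*)`. -/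
noncomputable def deltaAlik (α : ℝ) (t : ℕ → ℝ) (U : ℕ → ℝ) (m : ℕ) : ℝ :=
  (1 / Real.Gamma (1 - α)) *
    ((∑ j ∈ Finset.Icc 1 (m - 1),
        ∫ s in (t (j - 1))..(t j),
          (tStar α t m - s) ^ (-α) *
            deriv (fun x =>
              lagQuad (t (j - 1)) (t j) (t (j + 1)) (U (j - 1)) (U j) (U (j + 1)) x) s) +
      ∫ s in (t (m - 1))..(tStar α t m),
        (tStar α t m - s) ^ (-α) * ((U m - U (m - 1)) / (t m - t (m - 1))))

/-- The Alikhanov mesh condition ensuring the discrete maximum principle: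
with `ρ_j = τ_{j+1}/τ_j`, either `0.4656 ≤ ρ_j ≤ ρ_{j-1}` for all `2 ≤ j ≤ M-1`,
or `ρ_j ≥ 4/7` for all `2 ≤ j ≤ M-1`. -/
def AlikhanovCond (M : ℕ) (t : ℕ → ℝ) : Prop :=
  (∀ j : ℕ, 2 ≤ j → j ≤ M - 1 →
      (0.4656 : ℝ) ≤ (t (j + 1) - t j) / (t j - t (j - 1)) ∧
      (t (j + 1) - t j) / (t j - t (j - 1)) ≤
        (t j - t (j - 1)) / (t (j - 1) - t (j - 2))) ∨
  (∀ j : ℕ, 2 ≤ j → j ≤ M - 1 →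
      (4 / 7 : ℝ) ≤ (t (j + 1) - t j) / (t j - t (j - 1)))

namespace Alikhanov

/-- The singular kernel `(b - s)^(-α)`. -/
noncomputable def ker (α b s : ℝ) : ℝ := (b - s) ^ (-α)

/-- The derivative `α (b - s)^(-α-1)` of the singular kernel. -/
noncomputable def ker' (α b s : ℝ) : ℝ := α * (b - s) ^ (-α - 1)

lemma hasDerivAt_ker {α b s : ℝ} (h : s < b) : HasDerivAt (ker α b) (ker' α b s) s := by
  have h1 : HasDerivAt (fun x : ℝ => b - x) (-1) s := by
    simpa using (hasDerivAt_id s).const_sub b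
  have h2 := h1.rpow_const (p := -α) (Or.inl (by linarith : b - s ≠ 0))
  unfold ker' ker
  convert h2 using 1
  ring

lemma ker_pos {α b s : ℝ} (h : s < b) : 0 < ker α b s := rpow_pos_of_pos (by linarith) _

lemma ker'_pos {α b s : ℝ} (hα : 0 < α) (h : s < b) : 0 < ker' α b s :=
  mul_pos hα (rpow_pos_of_pos (by linarith) _)

lemma ker'_mono {α b s s' : ℝ} (hα : 0 < α) (h : s ≤ s') (h' : s' < b) :
    ker' α b s ≤ ker' α b s' :=
  mul_le_mul_of_nonneg_left
    (rpow_le_rpow_of_nonpos (by linarith) (by linarith) (by linarith)) hα.le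

lemma ker_mono {α b s s' : ℝ} (hα : 0 < α) (h : s ≤ s') (h' : s' < b) :
    ker α b s ≤ ker α b s' :=
  rpow_le_rpow_of_nonpos (by linarith) (by linarith) (by linarith)

lemma continuousOn_ker {α b x y : ℝ} (h : y < b) : ContinuousOn (ker α b) (Icc x y) :=
  fun _ hs => (hasDerivAt_ker (lt_of_le_of_lt hs.2 h)).continuousAt.continuousWithinAt

lemma intervalIntegrable_ker_mul {α b x y : ℝ} (hxy : x ≤ y) (h : y < b) {f : ℝ → ℝ}
    (hf : ContinuousOn f (Icc x y)) :
    IntervalIntegrable (fun s => ker α b s * f s) volume x y := by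
  apply ContinuousOn.intervalIntegrable
  rw [uIcc_of_le hxy]
  exact (continuousOn_ker h).mul hf

lemma ker_sub_ge {α b a s s' : ℝ} (hα : 0 < α) (ha : a ≤ s) (h : s ≤ s') (h' : s' < b) :
    ker' α b a * (s' - s) ≤ ker α b s' - ker α b s := by
  refine (convex_Icc s s').mul_sub_le_image_sub_of_le_deriv (continuousOn_ker h')
    (fun x hx => ?_) (fun x hx => ?_) s ⟨le_rfl, h⟩ s' ⟨h, le_rfl⟩ h
  · rw [interior_Icc] at hx
    exact (hasDerivAt_ker (hx.2.trans h')).differentiableAt.differentiableWithinAt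
  · rw [interior_Icc] at hx
    rw [(hasDerivAt_ker (hx.2.trans h')).deriv]
    exact ker'_mono hα (ha.trans hx.1.le) (hx.2.trans h')

lemma ker_sub_le {α b c s s' : ℝ} (hα : 0 < α) (h : s ≤ s') (hc : s' ≤ c) (h' : c < b) :
    ker α b s' - ker α b s ≤ ker' α b c * (s' - s) := by
  refine (convex_Icc s s').image_sub_le_mul_sub_of_deriv_le (continuousOn_ker (hc.trans_lt h'))
    (fun x hx => ?_) (fun x hx => ?_) s ⟨le_rfl, h⟩ s' ⟨h, le_rfl⟩ h
  · rw [interior_Icc] at hx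
    exact (hasDerivAt_ker (by linarith [hx.2])).differentiableAt.differentiableWithinAt
  · rw [interior_Icc] at hx
    rw [(hasDerivAt_ker (by linarith [hx.2])).deriv]
    exact ker'_mono hα (by linarith [hx.2]) h'

/-- The zeroth moment of the kernel over a cell. -/
noncomputable def mom0 (α b x y : ℝ) : ℝ := ∫ s in x..y, ker α b s

/-- The centred first moment (times two) of the kernel over a cell. -/
noncomputable def mom1 (α b x y : ℝ) : ℝ := ∫ s in x..y, ker α b s * (2 * s - x - y)

lemma mom0_le {α b x y : ℝ} (hα : 0 < α) (hxy : x < y) (h : y < b) :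
    mom0 α b x y ≤ (y - x) * ker α b y - ker' α b x * (y - x) ^ 2 / 2 := by
  have h1 : mom0 α b x y ≤ ∫ s in x..y, (ker α b y - ker' α b x * (y - s)) := by
    refine intervalIntegral.integral_mono_on hxy.le ?_ ?_ ?_
    · simpa using intervalIntegrable_ker_mul (α := α) hxy.le h (f := fun _ => 1) continuousOn_const
    · apply Continuous.intervalIntegrable; fun_prop
    · intro s hs
      linarith [ker_sub_ge (a := x) hα hs.1 hs.2 h]
  refine h1.trans (le_of_eq ?_)
  have e : (fun s : ℝ => ker α b y - ker' α b x * (y - s))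
    = fun s => (ker α b y - ker' α b x * y) + ker' α b x * s := by ext; ring
  rw [e, intervalIntegral.integral_add (by simp) (by apply Continuous.intervalIntegrable; fun_prop),
    intervalIntegral.integral_const, intervalIntegral.integral_const_mul, integral_id, smul_eq_mul]
  ring

lemma integral_mul_centred (c x y : ℝ) :
    ∫ s in x..y, (c * s) * (2 * s - x - y) = c * (y - x) ^ 3 / 6 := by
  have e : (fun s : ℝ => (c * s) * (2 * s - x - y))
    = fun s => (2 * c) * s ^ 2 + (-c * (x + y)) * s := by ext; ring
  rw [e, intervalIntegral.integral_add (by apply Continuous.intervalIntegrable; fun_prop)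
    (by apply Continuous.intervalIntegrable; fun_prop), intervalIntegral.integral_const_mul,
    intervalIntegral.integral_const_mul, integral_pow, integral_id]
  push_cast
  ring

lemma integral_centred (c x y : ℝ) :
    ∫ s in x..y, c * (2 * s - x - y) = 0 := by
  have e : (fun s : ℝ => c * (2 * s - x - y))
    = fun s => (2 * c) * s + (-c * (x + y)) := by ext; ring
  rw [e, intervalIntegral.integral_add (by apply Continuous.intervalIntegrable; fun_prop)
    (by simp), intervalIntegral.integral_const_mul,
    intervalIntegral.integral_const, integral_id, smul_eq_mul]
  ring

lemma mom1_ge {α b x y : ℝ} (hα : 0 < α) (hxy : x < y) (h : y < b) :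
    ker' α b x * (y - x) ^ 3 / 6 ≤ mom1 α b x y := by
  set k := ker α b ((x + y) / 2) - ker' α b x * ((x + y) / 2)
  have e : ∫ s in x..y, ((ker' α b x * s) * (2 * s - x - y) + k * (2 * s - x - y))
      = ker' α b x * (y - x) ^ 3 / 6 := by
    rw [intervalIntegral.integral_add (by apply Continuous.intervalIntegrable; fun_prop)
      (by apply Continuous.intervalIntegrable; fun_prop), integral_mul_centred, integral_centred]
    ring
  rw [← e]
  refine intervalIntegral.integral_mono_on hxy.le ?_ ?_ ?_
  · apply Continuous.intervalIntegrable; fun_prop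
  · exact intervalIntegrable_ker_mul hxy.le h (by fun_prop)
  · intro s hs
    rw [← add_mul]
    rcases le_total s ((x + y) / 2) with hm | hm
    · exact mul_le_mul_of_nonpos_right (by
        have := ker_sub_ge (b := b) (a := x) hα hs.1 hm (by linarith); simp only [k]; linarith)
        (by linarith)
    · exact mul_le_mul_of_nonneg_right (by
        have := ker_sub_ge (b := b) (a := x) (s := (x + y) / 2) (s' := s) hα (by linarith) hm
          (by linarith [hs.2])
        simp only [k]; linarith)
        (by linarith)

lemma mom1_le {α b x y : ℝ} (hα : 0 < α) (hxy : x < y) (h : y < b) :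
    mom1 α b x y ≤ ker' α b y * (y - x) ^ 3 / 6 := by
  set k := ker α b ((x + y) / 2) - ker' α b y * ((x + y) / 2)
  have e : ∫ s in x..y, ((ker' α b y * s) * (2 * s - x - y) + k * (2 * s - x - y))
      = ker' α b y * (y - x) ^ 3 / 6 := by
    rw [intervalIntegral.integral_add (by apply Continuous.intervalIntegrable; fun_prop)
      (by apply Continuous.intervalIntegrable; fun_prop), integral_mul_centred, integral_centred]
    ring
  rw [← e]
  refine intervalIntegral.integral_mono_on hxy.le ?_ ?_ ?_
  · exact intervalIntegrable_ker_mul hxy.le h (by fun_prop)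
  · apply Continuous.intervalIntegrable; fun_prop
  · intro s hs
    rw [← add_mul]
    rcases le_total s ((x + y) / 2) with hm | hm
    · exact mul_le_mul_of_nonpos_right (by
        have := ker_sub_le (c := y) hα hm (by linarith) h; simp only [k]; linarith)
        (by linarith)
    · exact mul_le_mul_of_nonneg_right (by
        have := ker_sub_le (c := y) hα hm hs.2 h
        simp only [k]; linarith)
        (by linarith)

lemma mom1_le_mom0 {α b x y : ℝ} (hxy : x < y) (h : y < b) :
    mom1 α b x y ≤ (y - x) * mom0 α b x y := by
  unfold mom1 mom0
  rw [← intervalIntegral.integral_const_mul]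
  refine intervalIntegral.integral_mono_on hxy.le ?_ ?_ ?_
  · exact intervalIntegrable_ker_mul hxy.le h (by fun_prop)
  · simp_rw [mul_comm (y - x)]
    exact intervalIntegrable_ker_mul hxy.le h (by fun_prop)
  · intro s hs
    rw [mul_comm]
    exact mul_le_mul_of_nonneg_right (by linarith [hs.2]) (ker_pos (lt_of_le_of_lt hs.2 h)).le

lemma mom_combination_ge {α b x y h : ℝ} (hα : 0 < α) (hxy : x < y) (hy : y < b)
    (hh : y - x ≤ h) :
    (y - x) * h * ker α b x ≤ h * mom0 α b x y - mom1 α b x y := by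
  have i0 : IntervalIntegrable (ker α b) volume x y := by
    simpa using intervalIntegrable_ker_mul (α := α) hxy.le hy (f := fun _ => 1) continuousOn_const
  have i1 : IntervalIntegrable (fun s => ker α b s * (2 * s - x - y)) volume x y :=
    intervalIntegrable_ker_mul hxy.le hy (by fun_prop)
  unfold mom0 mom1
  rw [← intervalIntegral.integral_const_mul, ← intervalIntegral.integral_sub (i0.const_mul h) i1]
  have e : ∫ s in x..y, (h * ker α b x - ker α b x * (2 * s - x - y)) = (y - x) * h * ker α b x := by
    rw [intervalIntegral.integral_sub (by simp)
      (by apply Continuous.intervalIntegrable; fun_prop), integral_centred,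
      intervalIntegral.integral_const, smul_eq_mul]
    ring
  rw [← e]
  refine intervalIntegral.integral_mono_on hxy.le ?_ ((i0.const_mul h).sub i1) ?_
  · apply Continuous.intervalIntegrable; fun_prop
  · intro s hs
    have := mul_le_mul_of_nonneg_right (ker_mono hα hs.1 (by linarith [hs.2]) : ker α b x ≤ _)
      (by linarith [hs.2] : 0 ≤ h - (2 * s - x - y))
    linarith

lemma intervalIntegrable_ker {α : ℝ} (hα1 : α < 1) (b x y : ℝ) :
    IntervalIntegrable (ker α b) volume x y := by
  have h := (intervalIntegral.intervalIntegrable_rpow' (r := -α) (by linarith)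
    (a := b - x) (b := b - y)).comp_sub_left b
  simp only [sub_sub_cancel] at h
  exact h

lemma mom0_last {α b x : ℝ} (hα1 : α < 1) :
    mom0 α b x b = (b - x) ^ (1 - α) / (1 - α) := by
  unfold mom0 ker
  rw [intervalIntegral.integral_comp_sub_left (fun u => u ^ (-α)) b,
    integral_rpow (Or.inl (by linarith)), sub_self, zero_rpow (by linarith), sub_zero]
  congr 1 <;> ring_nf

/-- At the Alikhanov point the linear moment centred at the cell midpoint vanishes. -/
lemma integral_ker_centred_eq_zero {α b x y : ℝ} (hα0 : 0 < α) (hα1 : α < 1) (hxy : x < y)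
    (hb : b = y - α / 2 * (y - x)) :
    ∫ s in x..b, ker α b s * (2 * s - x - y) = 0 := by
  have hxb : x < b := by rw [hb]; nlinarith
  set w := b - x with hw
  have hw0 : 0 < w := by linarith
  have e : ∫ s in x..b, ker α b s * (2 * s - x - y)
      = ∫ u in (0:ℝ)..w, ((2 * b - x - y) * u ^ (-α) - 2 * u ^ (1 - α)) := by
    have := intervalIntegral.integral_comp_sub_left (a := x) (b := b)
      (fun u => (2 * b - x - y) * u ^ (-α) - 2 * u ^ (1 - α)) b
    rw [sub_self] at this
    rw [← this]
    apply intervalIntegral.integral_congr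
    intro s hs
    rw [uIcc_of_le hxb.le] at hs
    unfold ker
    rcases eq_or_lt_of_le hs.2 with h | h
    · subst h
      simp only [sub_self]
      rw [zero_rpow (by linarith), zero_rpow (by linarith)]; ring
    · have : (b - s) ^ (1 - α) = (b - s) ^ (-α) * (b - s) := by
        rw [show (1 - α : ℝ) = -α + 1 by ring, rpow_add_one (by linarith)]
      simp only [this]; ring
  rw [e, intervalIntegral.integral_sub, intervalIntegral.integral_const_mul,
    intervalIntegral.integral_const_mul, integral_rpow (Or.inl (by linarith)),
    integral_rpow (Or.inl (by linarith)), zero_rpow (by linarith), zero_rpow (by linarith)]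
  · have : w ^ (1 - α + 1) = w ^ (-α + 1) * w := by
      rw [← rpow_add_one hw0.ne']; congr 1; ring
    rw [this]
    have h1 : (-α + 1) ≠ 0 := by linarith
    have h2 : (1 - α + 1) ≠ 0 := by linarith
    have hwv : w = (1 - α / 2) * (y - x) := by rw [hw, hb]; ring
    have h3 : 2 * b - x - y = (1 - α) * (y - x) := by rw [hb]; ring
    rw [h3, hwv]
    field_simp
    ring
  · exact (intervalIntegral.intervalIntegrable_rpow' (by linarith)).const_mul _
  · exact (intervalIntegral.intervalIntegrable_rpow' (by linarith)).const_mul _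

lemma hasDerivAt_lagQuad {x0 x1 x2 : ℝ} (h01 : x0 < x1) (h12 : x1 < x2) (y0 y1 y2 s : ℝ) :
    HasDerivAt (lagQuad x0 x1 x2 y0 y1 y2)
      ((y1 - y0) / (x1 - x0) + ((y2 - y1) / (x2 - x1) - (y1 - y0) / (x1 - x0)) / (x2 - x0)
        * (2 * s - x0 - x1)) s := by
  have d : ∀ u v : ℝ, HasDerivAt (fun x : ℝ => (x - u) * (x - v)) (2 * s - u - v) s := by
    intro u v
    have := ((hasDerivAt_id s).sub_const u).mul ((hasDerivAt_id s).sub_const v)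
    refine this.congr_deriv ?_
    simp only [id]; ring
  have := ((((d x1 x2).const_mul y0).div_const ((x0 - x1) * (x0 - x2))).add
    (((d x0 x2).const_mul y1).div_const ((x1 - x0) * (x1 - x2)))).add
    (((d x0 x1).const_mul y2).div_const ((x2 - x0) * (x2 - x1)))
  refine this.congr_deriv ?_
  have a1 : x1 - x0 ≠ 0 := by linarith
  have a2 : x2 - x1 ≠ 0 := by linarith
  have a3 : x2 - x0 ≠ 0 := by linarith
  have a4 : x0 - x1 ≠ 0 := by linarith
  have a5 : x1 - x2 ≠ 0 := by linarith
  have a6 : x0 - x2 ≠ 0 := by linarith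
  rw [show x0 - x1 = -(x1 - x0) by ring, show x1 - x2 = -(x2 - x1) by ring,
    show x0 - x2 = -(x2 - x0) by ring]
  field_simp
  ring

/-- Weight of the backward difference of an interior cell in its own cell integral. -/
noncomputable def wOwn (α b : ℝ) (t : ℕ → ℝ) (i : ℕ) : ℝ :=
  mom0 α b (t i) (t (i + 1)) / (t (i + 1) - t i)
    - mom1 α b (t i) (t (i + 1)) / ((t (i + 1) - t i) * (t (i + 2) - t i))

/-- Weight of the backward difference of the next cell in the integral over an interior cell. -/
noncomputable def wNext (α b : ℝ) (t : ℕ → ℝ) (i : ℕ) : ℝ :=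
  mom1 α b (t i) (t (i + 1)) / ((t (i + 2) - t (i + 1)) * (t (i + 2) - t i))

/-- Coefficient of `U (k + 1) - U k` in the Alikhanov operator at level `n + 1`. -/
noncomputable def coef (α b : ℝ) (t : ℕ → ℝ) (n k : ℕ) : ℝ :=
  (if k = n then mom0 α b (t n) b / (t (n + 1) - t n) else wOwn α b t k)
    + (if k = 0 then 0 else wNext α b t (k - 1))

lemma integral_ker_mul_linear {α b x0 x1 : ℝ} (h01 : x0 < x1) (hb : x1 < b) (d e : ℝ) :
    ∫ s in x0..x1, ker α b s * (d + e * (2 * s - x0 - x1))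
      = d * mom0 α b x0 x1 + e * mom1 α b x0 x1 := by
  unfold mom0 mom1
  have i0 : IntervalIntegrable (ker α b) volume x0 x1 := by
    simpa using intervalIntegrable_ker_mul (α := α) h01.le hb (f := fun _ => 1) continuousOn_const
  have i1 : IntervalIntegrable (fun s => ker α b s * (2 * s - x0 - x1)) volume x0 x1 :=
    intervalIntegrable_ker_mul h01.le hb (by fun_prop)
  rw [← intervalIntegral.integral_const_mul, ← intervalIntegral.integral_const_mul,
    ← intervalIntegral.integral_add (i0.const_mul d) (i1.const_mul e)]
  congr 1
  ext s
  ring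

lemma sum_mul_sub_eq (A U : ℕ → ℝ) (n : ℕ) :
    ∑ k ∈ Finset.range (n + 1), A k * (U (k + 1) - U k)
      = A n * U (n + 1) - A 0 * U 0
        - ∑ k ∈ Finset.range n, (A (k + 1) - A k) * U (k + 1) := by
  induction n with
  | zero => simp; ring
  | succ n ih =>
    rw [Finset.sum_range_succ, ih, Finset.sum_range_succ _ n]
    ring

lemma sum_Icc_one_pred (f : ℕ → ℝ) (n : ℕ) :
    ∑ j ∈ Finset.Icc 1 n, f j = ∑ i ∈ Finset.range n, f (i + 1) := by
  have : Finset.Icc 1 n = Finset.Ico 1 (n + 1) := by ext; simp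
  rw [this, Finset.sum_Ico_eq_sum_range]
  simp [add_comm]

lemma gamma_mul_deltaAlik {α : ℝ} (hα1 : α < 1) (t U : ℕ → ℝ) (n : ℕ) :
    Real.Gamma (1 - α) * deltaAlik α t U (n + 1)
      = ∑ i ∈ Finset.range n,
          (∫ s in (t i)..(t (i + 1)), ker α (tStar α t (n + 1)) s *
            deriv (lagQuad (t i) (t (i + 1)) (t (i + 2)) (U i) (U (i + 1)) (U (i + 2))) s)
        + mom0 α (tStar α t (n + 1)) (t n) (tStar α t (n + 1))
          * ((U (n + 1) - U n) / (t (n + 1) - t n)) := by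
  have hΓ : Real.Gamma (1 - α) ≠ 0 := (Real.Gamma_pos_of_pos (by linarith)).ne'
  unfold deltaAlik
  rw [← mul_assoc, mul_one_div_cancel hΓ, one_mul, Nat.add_sub_cancel, sum_Icc_one_pred,
    intervalIntegral.integral_mul_const]
  rfl

lemma sum_own_next_eq (α b : ℝ) (t D : ℕ → ℝ) (n : ℕ) :
    ∑ i ∈ Finset.range n, (wOwn α b t i * D i + wNext α b t i * D (i + 1))
      + mom0 α b (t n) b / (t (n + 1) - t n) * D n
      = ∑ k ∈ Finset.range (n + 1), coef α b t n k * D k := by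
  unfold coef
  simp_rw [add_mul]
  rw [Finset.sum_add_distrib, Finset.sum_add_distrib, Finset.sum_range_succ (fun x =>
    (if x = n then mom0 α b (t n) b / (t (n + 1) - t n) else wOwn α b t x) * D x),
    Finset.sum_range_succ' (fun x => (if x = 0 then 0 else wNext α b t (x - 1)) * D x)]
  have : ∑ x ∈ Finset.range n,
      (if x = n then mom0 α b (t n) b / (t (n + 1) - t n) else wOwn α b t x) * D x
      = ∑ x ∈ Finset.range n, wOwn α b t x * D x := by
    refine Finset.sum_congr rfl fun x hx => ?_
    rw [if_neg (Finset.mem_range.1 hx).ne]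
  rw [this]
  simp
  ring

lemma tStar_succ (α : ℝ) (t : ℕ → ℝ) (n : ℕ) :
    tStar α t (n + 1) = t (n + 1) - α / 2 * (t (n + 1) - t n) := rfl

lemma lt_of_step {t : ℕ → ℝ} {n : ℕ} (ht : ∀ i ≤ n, t i < t (i + 1)) {i j : ℕ} (hij : i < j)
    (hj : j ≤ n + 1) : t i < t j := by
  induction j, hij using Nat.le_induction with
  | base => exact ht i (by omega)
  | succ j hij ih => exact (ih (by omega)).trans (ht j (by omega))

lemma le_of_step {t : ℕ → ℝ} {n : ℕ} (ht : ∀ i ≤ n, t i < t (i + 1)) {i j : ℕ} (hij : i ≤ j)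
    (hj : j ≤ n + 1) : t i ≤ t j := by
  rcases hij.eq_or_lt with h | h
  · rw [h]
  · exact (lt_of_step ht h hj).le

lemma lt_tStar {α : ℝ} (hα1 : α < 1) {t : ℕ → ℝ} {n : ℕ} (ht : ∀ i ≤ n, t i < t (i + 1)) :
    t n < tStar α t (n + 1) := by
  rw [tStar_succ]; nlinarith [ht n le_rfl]

lemma gamma_mul_deltaAlik_eq_sum {α : ℝ} (hα1 : α < 1) {t : ℕ → ℝ} (U : ℕ → ℝ) {n : ℕ}
    (ht : ∀ i ≤ n, t i < t (i + 1)) :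
    Real.Gamma (1 - α) * deltaAlik α t U (n + 1)
      = ∑ k ∈ Finset.range (n + 1), coef α (tStar α t (n + 1)) t n k * (U (k + 1) - U k) := by
  rw [gamma_mul_deltaAlik hα1, ← sum_own_next_eq _ _ t (fun k => U (k + 1) - U k)]
  congr 1
  · refine Finset.sum_congr rfl fun i hi => ?_
    have hi := Finset.mem_range.1 hi
    have h1 := ht i (by omega)
    have h2 : t (i + 1) < t (i + 2) := ht (i + 1) (by omega)
    have h3 : t (i + 1) < tStar α t (n + 1) :=
      (le_of_step ht (by omega) (by omega)).trans_lt (lt_tStar hα1 ht)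
    simp_rw [fun s => (hasDerivAt_lagQuad h1 h2 (U i) (U (i + 1)) (U (i + 2)) s).deriv]
    rw [integral_ker_mul_linear h1 h3]
    unfold wOwn wNext
    have a1 : t (i + 1) - t i ≠ 0 := by linarith
    have a2 : t (i + 2) - t (i + 1) ≠ 0 := by linarith
    have a3 : t (i + 2) - t i ≠ 0 := by linarith
    field_simp
    ring
  · ring

section Coefficients

variable {α : ℝ} {t : ℕ → ℝ} {n : ℕ}

lemma wOwn_ge (hα : 0 < α) {b : ℝ} {i : ℕ} (h1 : t i < t (i + 1)) (h2 : t (i + 1) < t (i + 2))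
    (hb : t (i + 1) < b) : ker α b (t i) ≤ wOwn α b t i := by
  have := mom_combination_ge hα h1 hb (by linarith : t (i + 1) - t i ≤ t (i + 2) - t i)
  have a1 : 0 < t (i + 1) - t i := by linarith
  have a3 : 0 < t (i + 2) - t i := by linarith
  have e : wOwn α b t i = ((t (i + 2) - t i) * mom0 α b (t i) (t (i + 1))
      - mom1 α b (t i) (t (i + 1))) / ((t (i + 1) - t i) * (t (i + 2) - t i)) := by
    unfold wOwn; field_simp
  rw [e, le_div_iff₀ (by positivity)]
  linarith

lemma mom1_nonneg (hα : 0 < α) {b x y : ℝ} (hxy : x < y) (h : y < b) : 0 ≤ mom1 α b x y := by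
  refine le_trans ?_ (mom1_ge hα hxy h)
  have := ker'_pos hα (hxy.trans h)
  have : 0 < y - x := by linarith
  positivity

lemma wNext_nonneg (hα : 0 < α) {b : ℝ} {i : ℕ} (h1 : t i < t (i + 1))
    (h2 : t (i + 1) < t (i + 2)) (hb : t (i + 1) < b) : 0 ≤ wNext α b t i :=
  div_nonneg (mom1_nonneg hα h1 hb) (mul_nonneg (by linarith) (by linarith))

lemma wNext_le (hα : 0 < α) {b : ℝ} {i : ℕ} (h1 : t i < t (i + 1))
    (h2 : t (i + 1) < t (i + 2)) (hb : t (i + 1) < b) :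
    wNext α b t i ≤ ker' α b (t (i + 1)) * (t (i + 1) - t i) ^ 3
      / (6 * ((t (i + 2) - t (i + 1)) * (t (i + 2) - t i))) := by
  have := mom1_le hα h1 hb
  have a1 : 0 < t (i + 2) - t (i + 1) := by linarith
  have a3 : 0 < t (i + 2) - t i := by linarith
  rw [← div_div]
  exact div_le_div_of_nonneg_right this (by positivity)

lemma coef_last_ge (hα0 : 0 < α) (hα1 : α < 1) (ht : t n < t (n + 1)) :
    ker α (tStar α t (n + 1)) (t n) ≤
      mom0 α (tStar α t (n + 1)) (t n) (tStar α t (n + 1)) / (t (n + 1) - t n) := by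
  have a1 : 0 < t (n + 1) - t n := by linarith
  rw [mom0_last hα1, ker]
  have e : tStar α t (n + 1) - t n = (1 - α / 2) * (t (n + 1) - t n) := by
    rw [tStar_succ]; ring
  have hw : 0 < tStar α t (n + 1) - t n := by
    rw [e]; exact mul_pos (by linarith) a1
  rw [show (1 - α : ℝ) = -α + 1 by ring, rpow_add_one hw.ne', le_div_iff₀ a1,
    le_div_iff₀ (by linarith : 0 < -α + 1), mul_assoc]
  refine mul_le_mul_of_nonneg_left ?_ (rpow_nonneg hw.le _)
  rw [e]
  nlinarith

lemma coef_ge (hα0 : 0 < α) (hα1 : α < 1) (ht : ∀ i ≤ n, t i < t (i + 1)) {k : ℕ} (hk : k ≤ n) :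
    ker α (tStar α t (n + 1)) (t k) ≤ coef α (tStar α t (n + 1)) t n k := by
  have hb := lt_tStar hα1 ht
  have hq : 0 ≤ (if k = 0 then 0 else wNext α (tStar α t (n + 1)) t (k - 1)) := by
    split_ifs with h
    · rfl
    · obtain ⟨k, rfl⟩ := Nat.exists_eq_succ_of_ne_zero h
      exact wNext_nonneg hα0 (ht k (by omega)) (ht (k + 1) (by omega))
        ((le_of_step ht hk (by omega)).trans_lt hb)
  unfold coef
  refine le_add_of_le_of_nonneg ?_ hq
  split_ifs with h
  · subst h
    exact coef_last_ge hα0 hα1 (ht _ le_rfl)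
  · exact wOwn_ge hα0 (ht k hk) (ht (k + 1) (by omega))
      ((le_of_step ht (by omega) (by omega)).trans_lt hb)

lemma coef_succ_sub_ge (hα0 : 0 < α) (hα1 : α < 1) (ht : ∀ i ≤ n, t i < t (i + 1)) {k : ℕ}
    (hk : k < n) :
    ker' α (tStar α t (n + 1)) (t k) * ((t (k + 1) - t k) / 2
        + (t (k + 1) - t k) ^ 2 / (6 * (t (k + 2) - t (k + 1))))
      - (if k = 0 then 0 else wNext α (tStar α t (n + 1)) t (k - 1))
      ≤ coef α (tStar α t (n + 1)) t n (k + 1) - coef α (tStar α t (n + 1)) t n k := by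
  have hb := lt_tStar hα1 ht
  set b := tStar α t (n + 1) with hbdef
  have h1 := ht k hk.le
  have h2 : t (k + 1) < t (k + 2) := ht (k + 1) (by omega)
  have hkb : t (k + 1) < b := (le_of_step ht (by omega) (by omega)).trans_lt hb
  have hA : ker α b (t (k + 1)) + wNext α b t k ≤ coef α b t n (k + 1) := by
    unfold coef
    rw [if_neg (Nat.succ_ne_zero k), Nat.add_sub_cancel]
    refine add_le_add_left ?_ _
    split_ifs with h
    · subst h
      exact coef_last_ge hα0 hα1 (ht _ le_rfl)
    · exact wOwn_ge hα0 h2 (ht (k + 2) (by omega))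
        ((le_of_step ht (by omega) (by omega)).trans_lt hb)
  have hB : coef α b t n k = wOwn α b t k + (if k = 0 then 0 else wNext α b t (k - 1)) := by
    unfold coef; rw [if_neg hk.ne]
  have a1 : 0 < t (k + 1) - t k := by linarith
  have a2 : 0 < t (k + 2) - t (k + 1) := by linarith
  have a3 : 0 < t (k + 2) - t k := by linarith
  have h0 := mom0_le hα0 h1 hkb
  have hm := mom1_ge hα0 h1 hkb
  have e : wNext α b t k - wOwn α b t k
      = mom1 α b (t k) (t (k + 1)) / ((t (k + 1) - t k) * (t (k + 2) - t (k + 1)))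
        - mom0 α b (t k) (t (k + 1)) / (t (k + 1) - t k) := by
    unfold wNext wOwn
    field_simp
    ring
  have f1 : ker' α b (t k) * ((t (k + 1) - t k) ^ 2 / (6 * (t (k + 2) - t (k + 1))))
      ≤ mom1 α b (t k) (t (k + 1)) / ((t (k + 1) - t k) * (t (k + 2) - t (k + 1))) := by
    rw [le_div_iff₀ (by positivity)]
    refine le_trans (le_of_eq ?_) hm
    field_simp
  have f2 : mom0 α b (t k) (t (k + 1)) / (t (k + 1) - t k)
      ≤ ker α b (t (k + 1)) - ker' α b (t k) * ((t (k + 1) - t k) / 2) := by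
    rw [div_le_iff₀ a1]
    refine h0.trans (le_of_eq ?_)
    ring
  rw [hB]
  linarith

end Coefficients

lemma cubic_le_of_ratio_ge {x y : ℝ} (hx : 0 < x) (h : 4 / 7 * x ≤ y) :
    x ^ 3 / (6 * (y * (x + y))) ≤ y / 2 := by
  have hy : 0 < y := by linarith
  rw [div_le_iff₀ (by positivity)]
  have h2 : (4 / 7 * x) ^ 2 ≤ y ^ 2 := pow_le_pow_left₀ (by positivity) h 2
  have h3 : (4 / 7 * x) ^ 2 * (x + 4 / 7 * x) ≤ y ^ 2 * (x + y) := by gcongr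
  have : 0 < x ^ 3 := by positivity
  nlinarith

lemma cubic_le_of_ratio_antitone {x y z : ℝ} (hx : 0 < x) (hz : 0 < z)
    (h : 0.4656 * x ≤ y) (hzy : z * x ≤ y ^ 2) :
    x ^ 3 / (6 * (y * (x + y))) ≤ y / 2 + y ^ 2 / (6 * z) := by
  have hy : 0 < y := by linarith
  have h1 : x / 6 ≤ y ^ 2 / (6 * z) := by
    rw [le_div_iff₀ (by positivity)]; linarith
  refine le_trans ?_ (add_le_add_right h1 _)
  rw [div_le_iff₀ (by positivity)]
  have h3 : (3 * (0.4656 * x) + x) * ((0.4656 * x) * (x + 0.4656 * x))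
      ≤ (3 * y + x) * (y * (x + y)) := by gcongr
  have : 0 < x ^ 3 := by positivity
  nlinarith

section Signs

variable {α : ℝ} {t : ℕ → ℝ} {n : ℕ}

lemma ratio_cubic_le {M : ℕ} (hM : AlikhanovCond M t) (hnM : n + 1 ≤ M)
    (ht : ∀ i ≤ n, t i < t (i + 1)) {k : ℕ} (hk : k + 2 < n) :
    (t (k + 2) - t (k + 1)) ^ 3 / (6 * ((t (k + 3) - t (k + 2)) * (t (k + 3) - t (k + 1))))
      ≤ (t (k + 3) - t (k + 2)) / 2
        + (t (k + 3) - t (k + 2)) ^ 2 / (6 * (t (k + 4) - t (k + 3))) := by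
  have a1 : 0 < t (k + 2) - t (k + 1) := by linarith [ht (k + 1) (by omega)]
  have a2 : 0 < t (k + 3) - t (k + 2) := by linarith [ht (k + 2) (by omega)]
  have a3 : 0 < t (k + 4) - t (k + 3) := by linarith [ht (k + 3) (by omega)]
  rw [show t (k + 3) - t (k + 1) = (t (k + 2) - t (k + 1)) + (t (k + 3) - t (k + 2)) by ring]
  rcases hM with h | h
  · obtain ⟨h1, h2⟩ := h (k + 3) (by omega) (by omega)
    simp only [show k + 3 - 1 = k + 2 by omega, show k + 3 - 2 = k + 1 by omega,
      show k + 3 + 1 = k + 4 by omega] at h1 h2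
    have h3 := h1.trans h2
    rw [le_div_iff₀ a1] at h3
    rw [div_le_div_iff₀ a2 a1] at h2
    exact cubic_le_of_ratio_antitone a1 a3 h3 (by linarith)
  · have h1 := h (k + 2) (by omega) (by omega)
    simp only [show k + 2 - 1 = k + 1 by omega, show k + 2 + 1 = k + 3 by omega] at h1
    rw [le_div_iff₀ a1] at h1
    have := cubic_le_of_ratio_ge a1 h1
    have : 0 ≤ (t (k + 3) - t (k + 2)) ^ 2 / (6 * (t (k + 4) - t (k + 3))) := by positivity
    linarith

/-- Under the Alikhanov mesh condition the coefficients are monotone, except possibly for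
one early column. -/
lemma coef_le_coef_succ (hα0 : 0 < α) (hα1 : α < 1) {M : ℕ} (hM : AlikhanovCond M t)
    (hnM : n + 1 ≤ M) (ht : ∀ i ≤ n, t i < t (i + 1)) {k : ℕ} (hk : k < n) :
    -(if k = 1 then wNext α (tStar α t (n + 1)) t 0 else 0)
      ≤ coef α (tStar α t (n + 1)) t n (k + 1) - coef α (tStar α t (n + 1)) t n k := by
  have hstep := coef_succ_sub_ge hα0 hα1 ht hk
  have hb := lt_tStar hα1 ht
  set b := tStar α t (n + 1) with hbdef
  have hD := ker'_pos hα0 ((le_of_step ht (by omega : k ≤ n) (by omega)).trans_lt hb)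
  have a1 : 0 < t (k + 1) - t k := by linarith [ht k hk.le]
  have a2 : 0 < t (k + 2) - t (k + 1) := by linarith [ht (k + 1) (by omega)]
  have hpos : 0 ≤ ker' α b (t k) * ((t (k + 1) - t k) / 2
        + (t (k + 1) - t k) ^ 2 / (6 * (t (k + 2) - t (k + 1)))) := by positivity
  rcases Nat.lt_or_ge k 2 with h | h
  · interval_cases k
    · simp at hstep ⊢; linarith
    · simp at hstep ⊢; linarith
  · obtain ⟨k, rfl⟩ := Nat.exists_eq_add_of_le' h
    rw [if_neg (by omega)]
    rw [if_neg (by omega)] at hstep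
    have h1 := wNext_le hα0 (i := k + 1) (ht (k + 1) (by omega)) (ht (k + 2) (by omega))
      ((le_of_step ht (by omega) (by omega)).trans_lt hb)
    have h2 := mul_le_mul_of_nonneg_left (ratio_cubic_le hM hnM ht hk) hD.le
    rw [← mul_div_assoc] at h2
    simp only [show k + 2 - 1 = k + 1 by omega] at hstep
    have h4 := h1.trans h2
    simp only [show k + 2 + 1 = k + 3 by omega, show k + 2 + 2 = k + 4 by omega] at hstep
    linarith

lemma wOwn_le (hα : 0 < α) {b : ℝ} {i : ℕ} (h1 : t i < t (i + 1)) (h2 : t (i + 1) < t (i + 2))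
    (hb : t (i + 1) < b) : wOwn α b t i ≤ ker α b (t (i + 1)) := by
  have a1 : 0 < t (i + 1) - t i := by linarith
  have a3 : 0 < t (i + 2) - t i := by linarith
  have h0 := mom0_le hα h1 hb
  have hD := ker'_pos hα (h1.trans hb)
  have hm : 0 ≤ mom1 α b (t i) (t (i + 1)) / ((t (i + 1) - t i) * (t (i + 2) - t i)) :=
    div_nonneg (mom1_nonneg hα h1 hb) (by positivity)
  have : mom0 α b (t i) (t (i + 1)) / (t (i + 1) - t i) ≤ ker α b (t (i + 1)) := by
    rw [div_le_iff₀ a1]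
    have : 0 ≤ ker' α b (t i) * (t (i + 1) - t i) ^ 2 / 2 := by positivity
    linarith
  unfold wOwn
  linarith

lemma wNext_le_ker (hα : 0 < α) {b R : ℝ} {i : ℕ} (h1 : t i < t (i + 1))
    (h2 : t (i + 1) < t (i + 2)) (hb : t (i + 1) < b)
    (hR : t (i + 1) - t i ≤ R * (t (i + 2) - t (i + 1))) :
    wNext α b t i ≤ R * ker α b (t (i + 1)) := by
  have a1 : 0 < t (i + 1) - t i := by linarith
  have a2 : 0 < t (i + 2) - t (i + 1) := by linarith
  have a3 : 0 < t (i + 2) - t i := by linarith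
  have h0 := mom0_le hα h1 hb
  have hD := ker'_pos hα (h1.trans hb)
  have hk := ker_pos (α := α) hb
  have hm := mom1_le_mom0 (α := α) h1 hb
  have h3 : mom0 α b (t i) (t (i + 1)) ≤ (t (i + 1) - t i) * ker α b (t (i + 1)) := by
    have : 0 ≤ ker' α b (t i) * (t (i + 1) - t i) ^ 2 / 2 := by positivity
    linarith
  unfold wNext
  rw [div_le_iff₀ (by positivity)]
  calc mom1 α b (t i) (t (i + 1))
      ≤ (t (i + 1) - t i) * ((t (i + 1) - t i) * ker α b (t (i + 1))) :=
        hm.trans (mul_le_mul_of_nonneg_left h3 a1.le)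
    _ ≤ (R * (t (i + 2) - t (i + 1))) * ((t (i + 2) - t i) * ker α b (t (i + 1))) := by
        apply mul_le_mul hR _ (by positivity) (by linarith)
        exact mul_le_mul_of_nonneg_right (by linarith) hk.le
    _ = _ := by ring

lemma coef_le (hα0 : 0 < α) (hα1 : α < 1) {R : ℝ} (hR0 : 0 ≤ R) (ht : ∀ i ≤ n, t i < t (i + 1))
    (hR : ∀ i < n, t (i + 1) - t i ≤ R * (t (i + 2) - t (i + 1))) {k : ℕ} (hk : k < n) :
    coef α (tStar α t (n + 1)) t n k ≤ (1 + R) * ker α (tStar α t (n + 1)) (t n) := by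
  have hb := lt_tStar hα1 ht
  set b := tStar α t (n + 1) with hbdef
  have hkn : t (k + 1) ≤ t n := le_of_step ht (by omega) (by omega)
  have h1 := wOwn_le hα0 (ht k hk.le) (ht (k + 1) (by omega)) (hkn.trans_lt hb)
  have h2 : (if k = 0 then 0 else wNext α b t (k - 1)) ≤ R * ker α b (t n) := by
    split_ifs with h
    · exact mul_nonneg hR0 (ker_pos hb).le
    · obtain ⟨k, rfl⟩ := Nat.exists_eq_succ_of_ne_zero h
      have hkn' : t (k + 1) ≤ t n := le_of_step ht (by omega) (by omega)
      exact (wNext_le_ker hα0 (ht k (by omega)) (ht (k + 1) (by omega)) (hkn'.trans_lt hb)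
        (hR k (by omega))).trans (mul_le_mul_of_nonneg_left (ker_mono hα0 hkn' hb) hR0)
  have h3 := ker_mono hα0 hkn hb
  unfold coef
  rw [if_neg hk.ne]
  linarith

/-- One-step bound without any sign information on the coefficients. -/
lemma abs_succ_le (hα0 : 0 < α) (hα1 : α < 1) {R : ℝ} (hR0 : 0 ≤ R)
    (ht : ∀ i ≤ n, t i < t (i + 1)) (ht0 : 0 ≤ t n)
    (hR : ∀ i < n, t (i + 1) - t i ≤ R * (t (i + 2) - t (i + 1))) {U : ℕ → ℝ} (hU : U 0 = 0) :
    |U (n + 1)| ≤ t (n + 1) ^ α * (Real.Gamma (1 - α) * |deltaAlik α t U (n + 1)|)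
      + (1 + R) * ∑ k ∈ Finset.range n, |U (k + 1)| := by
  have hb := lt_tStar hα1 ht
  have hΓ := Real.Gamma_pos_of_pos (by linarith : 0 < 1 - α)
  have hsum := gamma_mul_deltaAlik_eq_sum hα1 U ht
  rw [sum_mul_sub_eq, hU, mul_zero, sub_zero] at hsum
  have hbn : tStar α t (n + 1) ≤ t (n + 1) := by
    rw [tStar_succ]; nlinarith [ht n le_rfl]
  set b := tStar α t (n + 1) with hbdef
  set A := coef α b t n with hA
  have hAn : ker α b (t n) ≤ A n := coef_ge hα0 hα1 ht le_rfl
  have hkn := ker_pos (α := α) hb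
  have hAn0 : 0 < A n := hkn.trans_le hAn
  have hdiff : ∀ k ∈ Finset.range n, |(A (k + 1) - A k) * U (k + 1)|
      ≤ ((1 + R) * A n) * |U (k + 1)| := by
    intro k hk
    have hk := Finset.mem_range.1 hk
    rw [abs_mul]
    refine mul_le_mul_of_nonneg_right ?_ (abs_nonneg _)
    have hup : ∀ j ≤ n, A j ≤ (1 + R) * A n := by
      intro j hj
      rcases hj.eq_or_lt with h | h
      · rw [h]; nlinarith
      · exact (coef_le hα0 hα1 hR0 ht hR h).trans (mul_le_mul_of_nonneg_left hAn (by linarith))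
    have hlo : ∀ j ≤ n, 0 ≤ A j := fun j hj =>
      (ker_pos ((le_of_step ht hj (by omega)).trans_lt hb)).le.trans (coef_ge hα0 hα1 ht hj)
    rw [abs_le]
    constructor <;> linarith [hup k hk.le, hup (k + 1) hk, hlo k hk.le, hlo (k + 1) hk]
  have h1 : A n * |U (n + 1)| ≤ Real.Gamma (1 - α) * |deltaAlik α t U (n + 1)|
      + ((1 + R) * A n) * ∑ k ∈ Finset.range n, |U (k + 1)| := by
    have e : A n * U (n + 1) = Real.Gamma (1 - α) * deltaAlik α t U (n + 1)
      + ∑ k ∈ Finset.range n, (A (k + 1) - A k) * U (k + 1) := by linarith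
    rw [← abs_of_pos hAn0, ← abs_mul, abs_of_pos hAn0, e, Finset.mul_sum]
    refine (abs_add_le _ _).trans (add_le_add ?_ ((Finset.abs_sum_le_sum_abs _ _).trans
      (Finset.sum_le_sum hdiff)))
    rw [abs_mul, abs_of_pos hΓ]
  have h2 : 1 ≤ t (n + 1) ^ α * A n := by
    have h3 : ker α b (t n) = ((b - t n) ^ α)⁻¹ := by
      rw [ker, rpow_neg (by linarith)]
    have h4 : (b - t n) ^ α ≤ t (n + 1) ^ α :=
      rpow_le_rpow (by linarith) (by linarith) hα0.le
    have h5 : 0 < (b - t n) ^ α := rpow_pos_of_pos (by linarith) _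
    calc 1 = (b - t n) ^ α * ker α b (t n) := by rw [h3, mul_inv_cancel₀ h5.ne']
      _ ≤ _ := mul_le_mul h4 hAn hkn.le (h5.le.trans h4)
  have h6 : |U (n + 1)| ≤ (Real.Gamma (1 - α) * |deltaAlik α t U (n + 1)|) / A n
      + (1 + R) * ∑ k ∈ Finset.range n, |U (k + 1)| := by
    rw [← sub_le_iff_le_add, le_div_iff₀ hAn0]
    linarith
  refine h6.trans (add_le_add_left ?_ _)
  rw [div_le_iff₀ hAn0]
  have : 0 ≤ Real.Gamma (1 - α) * |deltaAlik α t U (n + 1)| := by positivity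
  nlinarith

end Signs

/-- Derivative of the quadratic Lagrange interpolant, in terms of divided differences. -/
noncomputable def quadD (x0 x1 x2 y0 y1 y2 s : ℝ) : ℝ :=
  (y1 - y0) / (x1 - x0) + ((y2 - y1) / (x2 - x1) - (y1 - y0) / (x1 - x0)) / (x2 - x0)
    * (2 * s - x0 - x1)

lemma continuous_quadD (x0 x1 x2 y0 y1 y2 : ℝ) : Continuous (quadD x0 x1 x2 y0 y1 y2) := by
  unfold quadD; fun_prop

lemma lagQuad_nodes {x0 x1 x2 : ℝ} (h01 : x0 < x1) (h12 : x1 < x2) (y0 y1 y2 : ℝ) :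
    lagQuad x0 x1 x2 y0 y1 y2 x0 = y0 ∧ lagQuad x0 x1 x2 y0 y1 y2 x1 = y1 ∧
      lagQuad x0 x1 x2 y0 y1 y2 x2 = y2 := by
  have a1 : x1 - x0 ≠ 0 := by linarith
  have a2 : x2 - x1 ≠ 0 := by linarith
  have a3 : x2 - x0 ≠ 0 := by linarith
  have a4 : x0 - x1 ≠ 0 := by linarith
  have a5 : x1 - x2 ≠ 0 := by linarith
  have a6 : x0 - x2 ≠ 0 := by linarith
  unfold lagQuad
  refine ⟨?_, ?_, ?_⟩ <;> field_simp <;> ring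

/-- Derivative error of quadratic interpolation. -/
lemma abs_quadD_sub_le {f f1 f2 f3 : ℝ → ℝ} {x0 x1 x2 Q : ℝ} (h01 : x0 < x1) (h12 : x1 < x2)
    (hf : ∀ s ∈ Icc x0 x2, HasDerivAt f (f1 s) s)
    (hf1 : ∀ s ∈ Icc x0 x2, HasDerivAt f1 (f2 s) s)
    (hf2 : ∀ s ∈ Icc x0 x2, HasDerivAt f2 (f3 s) s)
    (hQ : ∀ s ∈ Icc x0 x2, |f3 s| ≤ Q) {s : ℝ} (hs : s ∈ Icc x0 x2) :
    |quadD x0 x1 x2 (f x0) (f x1) (f x2) s - f1 s| ≤ Q * (x2 - x0) ^ 2 := by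
  set q := lagQuad x0 x1 x2 (f x0) (f x1) (f x2) with hq
  set q1 := quadD x0 x1 x2 (f x0) (f x1) (f x2) with hq1
  obtain ⟨n0, n1, n2⟩ := lagQuad_nodes h01 h12 (f x0) (f x1) (f x2)
  have hQ0 : 0 ≤ Q := (abs_nonneg _).trans (hQ s hs)
  have de : ∀ x ∈ Icc x0 x2, HasDerivAt (fun x => q x - f x) (q1 x - f1 x) x := fun x hx =>
    (hasDerivAt_lagQuad h01 h12 _ _ _ x).sub (hf x hx)
  set c := ((f x2 - f x1) / (x2 - x1) - (f x1 - f x0) / (x1 - x0)) / (x2 - x0) with hc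
  have dq1 : ∀ x, HasDerivAt q1 (c * 2) x := by
    intro x
    have := (((((hasDerivAt_id x).const_mul 2).sub_const x0).sub_const x1).const_mul c).const_add
      ((f x1 - f x0) / (x1 - x0))
    refine this.congr_deriv ?_
    ring
  have de1 : ∀ x ∈ Icc x0 x2, HasDerivAt (fun x => q1 x - f1 x) (c * 2 - f2 x) x := fun x hx =>
    (dq1 x).sub (hf1 x hx)
  have de2 : ∀ x ∈ Icc x0 x2, HasDerivAt (fun x => c * 2 - f2 x) (-f3 x) x := fun x hx =>
    (hf2 x hx).const_sub _
  have sub1 : ∀ x ∈ Icc x0 x1, x ∈ Icc x0 x2 := fun x hx => ⟨hx.1, hx.2.trans h12.le⟩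
  have sub2 : ∀ x ∈ Icc x1 x2, x ∈ Icc x0 x2 := fun x hx => ⟨h01.le.trans hx.1, hx.2⟩
  obtain ⟨ξ1, hξ1, e1⟩ := exists_hasDerivAt_eq_zero (f := fun x => q x - f x)
    (f' := fun x => q1 x - f1 x) h01
    (fun x hx => (de x (sub1 x hx)).continuousAt.continuousWithinAt)
    (by simp only [hq, n0, n1, sub_self]) (fun x hx => de x (sub1 x ⟨hx.1.le, hx.2.le⟩))
  obtain ⟨ξ2, hξ2, e2⟩ := exists_hasDerivAt_eq_zero (f := fun x => q x - f x)
    (f' := fun x => q1 x - f1 x) h12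
    (fun x hx => (de x (sub2 x hx)).continuousAt.continuousWithinAt)
    (by simp only [hq, n2, n1, sub_self]) (fun x hx => de x (sub2 x ⟨hx.1.le, hx.2.le⟩))
  have sub3 : ∀ x ∈ Icc ξ1 ξ2, x ∈ Icc x0 x2 := fun x hx =>
    ⟨hξ1.1.le.trans hx.1, hx.2.trans hξ2.2.le⟩
  obtain ⟨η, hη, e3⟩ := exists_hasDerivAt_eq_zero (f := fun x => q1 x - f1 x)
    (f' := fun x => c * 2 - f2 x) (hξ1.2.trans hξ2.1)
    (fun x hx => (de1 x (sub3 x hx)).continuousAt.continuousWithinAt)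
    (by rw [e1, e2]) (fun x hx => de1 x (sub3 x ⟨hx.1.le, hx.2.le⟩))
  have dist : ∀ x ∈ Icc x0 x2, ∀ y ∈ Icc x0 x2, ‖x - y‖ ≤ x2 - x0 := by
    intro x hx y hy
    rw [Real.norm_eq_abs, abs_le]; constructor <;> linarith [hx.1, hx.2, hy.1, hy.2]
  have b2 : ∀ x ∈ Icc x0 x2, ‖c * 2 - f2 x‖ ≤ Q * (x2 - x0) := by
    intro x hx
    have hηm := sub3 η ⟨hη.1.le, hη.2.le⟩
    have := (convex_Icc x0 x2).norm_image_sub_le_of_norm_hasDerivWithin_le (C := Q)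
      (fun y hy => (de2 y hy).hasDerivWithinAt)
      (fun y hy => by rw [norm_neg]; exact hQ y hy) hηm hx
    rw [e3, sub_zero] at this
    exact this.trans (mul_le_mul_of_nonneg_left (dist _ hx _ hηm) hQ0)
  have hξm := sub1 ξ1 ⟨hξ1.1.le, hξ1.2.le⟩
  have := (convex_Icc x0 x2).norm_image_sub_le_of_norm_hasDerivWithin_le (C := Q * (x2 - x0))
      (fun y hy => (de1 y hy).hasDerivWithinAt) b2 hξm hs
  rw [e1, sub_zero] at this
  refine this.trans ?_
  rw [pow_two, ← mul_assoc]
  exact mul_le_mul_of_nonneg_left (dist _ hs _ hξm) (mul_nonneg hQ0 (by linarith))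

/-- Derivatives of the shifted power `(s + P)^β`. -/
lemma hasDerivAt_shift_rpow {P s : ℝ} (β : ℝ) (h : 0 < s + P) :
    HasDerivAt (fun x => (x + P) ^ β) (β * (s + P) ^ (β - 1)) s := by
  have := ((hasDerivAt_id s).add_const P).rpow_const (p := β) (Or.inl h.ne')
  refine this.congr_deriv ?_
  simp only [id]; ring

/-- A shifted power solving the fractional differential inequality. -/
noncomputable def bar (α P s : ℝ) : ℝ := (s + P) ^ (α - 1)

lemma abs_quadD_bar_sub_le {α P x0 x1 x2 : ℝ} (hα0 : 0 < α) (hα1 : α < 1) (hx : 0 < x0 + P)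
    (h01 : x0 < x1) (h12 : x1 < x2) {s : ℝ} (hs : s ∈ Icc x0 x2) :
    |quadD x0 x1 x2 (bar α P x0) (bar α P x1) (bar α P x2) s - (α - 1) * (s + P) ^ (α - 2)|
      ≤ 6 * (x0 + P) ^ (α - 4) * (x2 - x0) ^ 2 := by
  have hp : ∀ s ∈ Icc x0 x2, 0 < s + P := fun s hs => by linarith [hs.1]
  refine abs_quadD_sub_le (f := bar α P) (f1 := fun s => (α - 1) * (s + P) ^ (α - 2))
    (f2 := fun s => (α - 1) * ((α - 2) * (s + P) ^ (α - 3)))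
    (f3 := fun s => (α - 1) * ((α - 2) * ((α - 3) * (s + P) ^ (α - 4)))) h01 h12
    (fun s hs => ?_) (fun s hs => ?_) (fun s hs => ?_) (fun s hs => ?_) hs
  · have := hasDerivAt_shift_rpow (α - 1) (hp s hs)
    rwa [show α - 1 - 1 = α - 2 by ring] at this
  · have := (hasDerivAt_shift_rpow (α - 2) (hp s hs)).const_mul (α - 1)
    rwa [show α - 2 - 1 = α - 3 by ring] at this
  · have := ((hasDerivAt_shift_rpow (α - 3) (hp s hs)).const_mul (α - 2)).const_mul (α - 1)
    rwa [show α - 3 - 1 = α - 4 by ring] at this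
  · have h1 : (s + P) ^ (α - 4) ≤ (x0 + P) ^ (α - 4) :=
      rpow_le_rpow_of_nonpos hx (by linarith [hs.1]) (by linarith)
    have h2 : 0 < (s + P) ^ (α - 4) := rpow_pos_of_pos (hp s hs) _
    rw [show (α - 1) * ((α - 2) * ((α - 3) * (s + P) ^ (α - 4)))
      = -(((1 - α) * (2 - α) * (3 - α)) * (s + P) ^ (α - 4)) by ring, abs_neg,
      abs_of_nonneg (mul_nonneg (mul_nonneg (mul_nonneg (by linarith) (by linarith))
        (by linarith)) h2.le)]
    refine mul_le_mul ?_ h1 h2.le (by norm_num)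
    calc (1 - α) * (2 - α) * (3 - α) ≤ 1 * 2 * 3 := by
          apply mul_le_mul (mul_le_mul _ _ _ _) <;> nlinarith
      _ = 6 := by norm_num

/-- A zero-mean perturbation tested against the kernel. -/
lemma abs_integral_ker_mul_le {α b x y η : ℝ} (hα : 0 < α) (hxy : x < y) (hy : y < b) {e : ℝ → ℝ}
    (he : ContinuousOn e (Icc x y)) (hη : ∀ s ∈ Icc x y, |e s| ≤ η) (h0 : ∫ s in x..y, e s = 0) :
    |∫ s in x..y, ker α b s * e s| ≤ (ker α b y - ker α b x) * η * (y - x) := by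
  have ie : IntervalIntegrable e volume x y := by
    apply ContinuousOn.intervalIntegrable; rwa [uIcc_of_le hxy.le]
  have e1 : ∫ s in x..y, ker α b s * e s = ∫ s in x..y, (ker α b s - ker α b x) * e s := by
    simp_rw [sub_mul]
    rw [intervalIntegral.integral_sub (intervalIntegrable_ker_mul hxy.le hy he)
      (ie.const_mul _), intervalIntegral.integral_const_mul, h0, mul_zero, sub_zero]
  rw [e1, ← Real.norm_eq_abs]
  refine (intervalIntegral.norm_integral_le_of_norm_le_const (C := (ker α b y - ker α b x) * η)
    ?_).trans_eq ?_
  · intro s hs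
    rw [uIoc_of_le hxy.le] at hs
    have m1 := ker_mono hα hs.1.le (hs.2.trans_lt hy)
    have m2 := ker_mono hα hs.2 hy
    rw [norm_mul, Real.norm_eq_abs, Real.norm_eq_abs, abs_of_nonneg (by linarith)]
    exact mul_le_mul (by linarith) (hη s ⟨hs.1.le, hs.2⟩) (abs_nonneg _) (by linarith)
  · rw [abs_of_nonneg (by linarith)]

/-- Primitive of the kernel times the derivative of the barrier. -/
noncomputable def prim (α b P s : ℝ) : ℝ := (b - s) ^ (1 - α) * (s + P) ^ (α - 1) / (b + P)

lemma hasDerivAt_prim {α b P s : ℝ} (hs : s < b) (hP : 0 < s + P) :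
    HasDerivAt (prim α b P) (ker α b s * ((α - 1) * (s + P) ^ (α - 2))) s := by
  have h1 : HasDerivAt (fun x : ℝ => b - x) (-1) s := by
    simpa using (hasDerivAt_id s).const_sub b
  have h2 := h1.rpow_const (p := 1 - α) (Or.inl (by linarith : b - s ≠ 0))
  have h3 := (h2.mul (hasDerivAt_shift_rpow (α - 1) hP)).div_const (b + P)
  refine h3.congr_deriv ?_
  have e1 : (b - s) ^ (1 - α) = (b - s) ^ (-α) * (b - s) := by
    rw [← rpow_add_one (by linarith)]; congr 1; ring
  have e2 : (s + P) ^ (α - 1) = (s + P) ^ (α - 2) * (s + P) := by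
    rw [← rpow_add_one hP.ne']; congr 1; ring
  have e3 : b + P ≠ 0 := by linarith
  rw [show 1 - α - 1 = -α by ring, show α - 1 - 1 = α - 2 by ring, e1, e2, ker]
  field_simp
  ring

lemma integral_ker_mul_bar' {α b P x y : ℝ} (hα1 : α < 1) (hxy : x ≤ y) (hyb : y ≤ b)
    (hP : 0 < x + P) :
    IntervalIntegrable (fun s => ker α b s * ((α - 1) * (s + P) ^ (α - 2))) volume x y ∧
    ∫ s in x..y, ker α b s * ((α - 1) * (s + P) ^ (α - 2)) = prim α b P y - prim α b P x := by
  have hp : ∀ s ∈ Icc x y, s + P ≠ 0 := fun s hs => by linarith [hs.1]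
  have hc : ContinuousOn (fun s : ℝ => (α - 1) * (s + P) ^ (α - 2)) (Icc x y) :=
    continuousOn_const.mul ((continuousOn_id.add continuousOn_const).rpow_const
      fun s hs => Or.inl (hp s hs))
  have hi : IntervalIntegrable (fun s => ker α b s * ((α - 1) * (s + P) ^ (α - 2))) volume x y :=
    (intervalIntegrable_ker hα1 b x y).mul_continuousOn (by rwa [uIcc_of_le hxy])
  refine ⟨hi, intervalIntegral.integral_eq_sub_of_hasDerivAt_of_le hxy ?_ (fun s hs => ?_) hi⟩
  · unfold prim
    refine ContinuousOn.div_const (ContinuousOn.mul ?_ ?_) _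
    · exact (continuousOn_const.sub continuousOn_id).rpow_const fun s hs => Or.inr (by linarith)
    · exact (continuousOn_id.add continuousOn_const).rpow_const fun s hs => Or.inl (hp s hs)
  · exact hasDerivAt_prim (hs.2.trans_le hyb) (by linarith [hs.1])

lemma integral_quadD_sub_bar' {α P x0 x1 x2 : ℝ} (hx : 0 < x0 + P)
    (h01 : x0 < x1) (h12 : x1 < x2) :
    ∫ s in x0..x1, (quadD x0 x1 x2 (bar α P x0) (bar α P x1) (bar α P x2) s
      - (α - 1) * (s + P) ^ (α - 2)) = 0 := by
  have hp : ∀ s ∈ Icc x0 x1, s + P ≠ 0 := fun s hs => by linarith [hs.1]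
  have hc : ContinuousOn (fun s : ℝ => (α - 1) * (s + P) ^ (α - 2)) (Icc x0 x1) :=
    continuousOn_const.mul ((continuousOn_id.add continuousOn_const).rpow_const
      fun s hs => Or.inl (hp s hs))
  obtain ⟨n0, n1, _⟩ := lagQuad_nodes h01 h12 (bar α P x0) (bar α P x1) (bar α P x2)
  rw [intervalIntegral.integral_eq_sub_of_hasDerivAt (f := fun s =>
    lagQuad x0 x1 x2 (bar α P x0) (bar α P x1) (bar α P x2) s - bar α P s)]
  · simp only [n0, n1, sub_self]
  · intro s hs
    rw [uIcc_of_le h01.le] at hs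
    have := hasDerivAt_shift_rpow (α - 1) (by linarith [hs.1] : 0 < s + P)
    rw [show α - 1 - 1 = α - 2 by ring] at this
    exact (hasDerivAt_lagQuad h01 h12 _ _ _ s).sub this
  · apply ContinuousOn.intervalIntegrable
    rw [uIcc_of_le h01.le]
    exact (continuous_quadD _ _ _ _ _ _).continuousOn.sub hc

/-- Lower bound for the contribution of an interior cell. -/
lemma interior_cell_ge {α b P x0 x1 x2 : ℝ} (hα0 : 0 < α) (hα1 : α < 1) (hx : 0 < x0 + P)
    (h01 : x0 < x1) (h12 : x1 < x2) (hb : x1 < b) :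
    prim α b P x1 - prim α b P x0
      - (ker α b x1 - ker α b x0) * (6 * (x0 + P) ^ (α - 4) * (x2 - x0) ^ 2) * (x1 - x0)
    ≤ ∫ s in x0..x1, ker α b s *
        deriv (lagQuad x0 x1 x2 (bar α P x0) (bar α P x1) (bar α P x2)) s := by
  have hp : ∀ s ∈ Icc x0 x1, s + P ≠ 0 := fun s hs => by linarith [hs.1]
  have hc : ContinuousOn (fun s : ℝ => (α - 1) * (s + P) ^ (α - 2)) (Icc x0 x1) :=
    continuousOn_const.mul ((continuousOn_id.add continuousOn_const).rpow_const
      fun s hs => Or.inl (hp s hs))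
  have hc' : ContinuousOn (fun s => quadD x0 x1 x2 (bar α P x0) (bar α P x1) (bar α P x2) s
      - (α - 1) * (s + P) ^ (α - 2)) (Icc x0 x1) :=
    (continuous_quadD _ _ _ _ _ _).continuousOn.sub hc
  have h1 := abs_integral_ker_mul_le hα0 h01 hb hc'
    (fun s hs => abs_quadD_bar_sub_le hα0 hα1 hx h01 h12 ⟨hs.1, hs.2.trans h12.le⟩)
    (integral_quadD_sub_bar' hx h01 h12)
  obtain ⟨hi, h2⟩ := integral_ker_mul_bar' (P := P) hα1 h01.le hb.le hx
  have h3 : ∫ s in x0..x1, ker α b s *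
        deriv (lagQuad x0 x1 x2 (bar α P x0) (bar α P x1) (bar α P x2)) s
      = (∫ s in x0..x1, ker α b s * ((α - 1) * (s + P) ^ (α - 2)))
        + ∫ s in x0..x1, ker α b s * (quadD x0 x1 x2 (bar α P x0) (bar α P x1) (bar α P x2) s
          - (α - 1) * (s + P) ^ (α - 2)) := by
    rw [← intervalIntegral.integral_add hi (intervalIntegrable_ker_mul h01.le hb hc')]
    congr 1
    ext s
    rw [(hasDerivAt_lagQuad h01 h12 _ _ _ s).deriv]
    unfold quadD
    ring
  rw [h3, h2]
  have := (abs_le.1 h1).1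
  linarith

/-- Lower bound for the contribution of the last cell. -/
lemma last_cell_ge {α b P x y : ℝ} (hα0 : 0 < α) (hα1 : α < 1) (hx : 0 < x + P)
    (hxy : x < y) (hb : b = y - α / 2 * (y - x)) :
    prim α b P b - prim α b P x - mom0 α b x b * (6 * (x + P) ^ (α - 4) * (y - x) ^ 2)
    ≤ mom0 α b x b * ((bar α P y - bar α P x) / (y - x)) := by
  have hxb : x < b := by rw [hb]; nlinarith
  have hby : b ≤ y := by rw [hb]; nlinarith
  set m := (x + y) / 2 with hm
  have h1 : x < m := by linarith
  have h2 : m < y := by linarith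
  set D := (bar α P y - bar α P x) / (y - x) with hD
  set κ := ((bar α P y - bar α P m) / (y - m) - (bar α P m - bar α P x) / (m - x)) / (y - x)
    with hκ
  have hq : ∀ s, quadD x m y (bar α P x) (bar α P m) (bar α P y) s
      = D + κ * (2 * s - x - y) := by
    intro s
    have a1 : y - x ≠ 0 := by linarith
    have e1 : m - x = (y - x) / 2 := by rw [hm]; ring
    have e2 : y - m = (y - x) / 2 := by rw [hm]; ring
    rw [hκ, hD]
    unfold quadD
    rw [e1, e2, show 2 * s - x - m = (2 * s - x - y) + (y - x) / 2 by rw [hm]; ring]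
    field_simp
    ring
  have i0 := intervalIntegrable_ker hα1 b x b
  have i1 : IntervalIntegrable (fun s => ker α b s * (2 * s - x - y)) volume x b :=
    i0.mul_continuousOn (by fun_prop)
  obtain ⟨hi, h3⟩ := integral_ker_mul_bar' (P := P) hα1 hxb.le le_rfl hx
  have h4 : mom0 α b x b * D
      = ∫ s in x..b, ker α b s * quadD x m y (bar α P x) (bar α P m) (bar α P y) s := by
    have e : (fun s => ker α b s * quadD x m y (bar α P x) (bar α P m) (bar α P y) s)
        = fun s => ker α b s * D + κ * (ker α b s * (2 * s - x - y)) := by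
      ext s; rw [hq]; ring
    rw [e, intervalIntegral.integral_add (i0.mul_const D) (i1.const_mul κ),
      intervalIntegral.integral_const_mul, integral_ker_centred_eq_zero hα0 hα1 hxy hb,
      intervalIntegral.integral_mul_const, mul_zero, add_zero, mom0]
  rw [h4, ← h3, mom0, ← intervalIntegral.integral_mul_const,
    ← intervalIntegral.integral_sub hi (i0.mul_const _)]
  refine intervalIntegral.integral_mono_on hxb.le (hi.sub (i0.mul_const _))
    (i0.mul_continuousOn (continuous_quadD _ _ _ _ _ _).continuousOn) fun s hs => ?_
  rw [← mul_sub]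
  refine mul_le_mul_of_nonneg_left ?_ (rpow_nonneg (by linarith [hs.2]) _)
  have := (abs_le.1 (abs_quadD_bar_sub_le hα0 hα1 hx h1 h2 (s := s)
    ⟨hs.1, hs.2.trans hby⟩)).1
  linarith

/-- Cell-wise consequences of the quasi-graded mesh property up to level `n + 1`. -/
structure Graded (r c C R : ℝ) (t : ℕ → ℝ) (n : ℕ) : Prop where
  zero : t 0 = 0
  step : ∀ i ≤ n, t i < t (i + 1)
  lower : ∀ i ≤ n, c * (t 1 ^ (1 / r) * t (i + 1) ^ (1 - 1 / r)) ≤ t (i + 1) - t i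
  upper : ∀ i ≤ n, t (i + 1) - t i ≤ C * (t 1 ^ (1 / r) * t (i + 1) ^ (1 - 1 / r))
  ratio : ∀ i < n, t (i + 2) ≤ R * t (i + 1)
  size : ∀ i < n, t (i + 1) - t i ≤ R * (t (i + 2) - t (i + 1))

lemma Graded.pos {r c C R : ℝ} {t : ℕ → ℝ} {n : ℕ} (h : Graded r c C R t n) {i : ℕ} (hi : i ≤ n) :
    0 < t (i + 1) := by
  have := lt_of_step h.step (i := 0) (j := i + 1) (by omega) (by omega)
  rwa [h.zero] at this

lemma Graded.nonneg {r c C R : ℝ} {t : ℕ → ℝ} {n : ℕ} (h : Graded r c C R t n) {i : ℕ}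
    (hi : i ≤ n + 1) : 0 ≤ t i := by
  rcases i with _ | i
  · exact h.zero.ge
  · exact (h.pos (by omega)).le

/-- The consistency error weight on one cell. -/
lemma cell_error_le {α r R C τ x y w h : ℝ} (hα0 : 0 < α) (hα1 : α < 1) (hr1 : 1 ≤ r)
    (hr2 : r ≤ (3 - α) / α) (hR : 1 ≤ R) (hτ : 0 < τ) (hτy : τ ≤ y)
    (hyx : y ≤ 2 * R * x) (hw0 : 0 ≤ w) (hh0 : 0 ≤ h)
    (hw : w ≤ C * (τ ^ (1 / r) * y ^ (1 - 1 / r))) (hh : h ≤ C * (τ ^ (1 / r) * y ^ (1 - 1 / r))) :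
    6 * x ^ (α - 4) * w ^ 2 * h
      ≤ 6 * (2 * R) ^ (4 - α) * C ^ 3 * τ ^ (α + α / r) * y ^ (-1 - α / r) := by
  have hy : 0 < y := hτ.trans_le hτy
  have hr : 0 < r := by linarith
  set W := C * (τ ^ (1 / r) * y ^ (1 - 1 / r)) with hW
  have h1 : w ^ 2 * h ≤ W ^ 2 * W := mul_le_mul (pow_le_pow_left₀ hw0 hw 2) hh hh0 (sq_nonneg _)
  have h2 : x ^ (α - 4) ≤ (2 * R) ^ (4 - α) * y ^ (α - 4) := by
    have : x ^ (α - 4) ≤ (y / (2 * R)) ^ (α - 4) :=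
      rpow_le_rpow_of_nonpos (by positivity) (by rw [div_le_iff₀ (by positivity)]; linarith)
        (by linarith)
    rwa [div_rpow hy.le (by positivity), div_eq_mul_inv, ← rpow_neg (by positivity),
      neg_sub, mul_comm] at this
  have h3 : W ^ 2 * W = C ^ 3 * (τ ^ (3 / r) * y ^ (3 - 3 / r)) := by
    rw [hW, show (3 : ℝ) / r = 1 / r * 3 by ring, show (3 : ℝ) - 1 / r * 3 = (1 - 1 / r) * 3 by ring,
      rpow_mul hτ.le, rpow_mul hy.le]
    norm_cast
    ring
  have hC : 0 ≤ C := by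
    have : 0 < τ ^ (1 / r) * y ^ (1 - 1 / r) := by positivity
    by_contra hneg
    have := mul_neg_of_neg_of_pos (not_le.1 hneg) this
    linarith
  have hexp : α + α / r ≤ 3 / r := by
    rw [le_div_iff₀ hα0] at hr2
    rw [← sub_nonneg, show 3 / r - (α + α / r) = (3 - (r * α + α)) / r by field_simp]
    exact div_nonneg (by linarith) hr.le
  have h4 : y ^ (α - 4) * (τ ^ (3 / r) * y ^ (3 - 3 / r)) ≤ τ ^ (α + α / r) * y ^ (-1 - α / r) := by
    have e1 : y ^ (α - 4) * (τ ^ (3 / r) * y ^ (3 - 3 / r)) = y ^ (α - 1) * (τ / y) ^ (3 / r) := by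
      rw [div_rpow hτ.le hy.le, div_eq_mul_inv (τ ^ (3 / r)), ← rpow_neg hy.le,
        show y ^ (α - 4) * (τ ^ (3 / r) * y ^ (3 - 3 / r))
          = τ ^ (3 / r) * (y ^ (α - 4) * y ^ (3 - 3 / r)) by ring, ← rpow_add hy,
        show y ^ (α - 1) * (τ ^ (3 / r) * y ^ (-(3 / r)))
          = τ ^ (3 / r) * (y ^ (α - 1) * y ^ (-(3 / r))) by ring, ← rpow_add hy]
      congr 2; ring
    have e2 : τ ^ (α + α / r) * y ^ (-1 - α / r) = y ^ (α - 1) * (τ / y) ^ (α + α / r) := by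
      rw [div_rpow hτ.le hy.le, div_eq_mul_inv (τ ^ (α + α / r)), ← rpow_neg hy.le,
        show y ^ (α - 1) * (τ ^ (α + α / r) * y ^ (-(α + α / r)))
          = τ ^ (α + α / r) * (y ^ (α - 1) * y ^ (-(α + α / r))) by ring, ← rpow_add hy]
      congr 2; ring
    rw [e1, e2]
    exact mul_le_mul_of_nonneg_left (rpow_le_rpow_of_exponent_ge (by positivity)
      (by rwa [div_le_one hy]) hexp) (by positivity)
  calc 6 * x ^ (α - 4) * w ^ 2 * h = 6 * (x ^ (α - 4) * (w ^ 2 * h)) := by ring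
    _ ≤ 6 * (((2 * R) ^ (4 - α) * y ^ (α - 4)) * (C ^ 3 * (τ ^ (3 / r) * y ^ (3 - 3 / r)))) := by
        rw [← h3]
        exact mul_le_mul_of_nonneg_left (mul_le_mul h2 h1 (by positivity) (by positivity))
          (by norm_num)
    _ = 6 * (2 * R) ^ (4 - α) * C ^ 3 * (y ^ (α - 4) * (τ ^ (3 / r) * y ^ (3 - 3 / r))) := by ring
    _ ≤ 6 * (2 * R) ^ (4 - α) * C ^ 3 * (τ ^ (α + α / r) * y ^ (-1 - α / r)) :=
        mul_le_mul_of_nonneg_left h4 (by positivity)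
    _ = _ := by ring

/-- Majorant used to telescope the weighted kernel increments. -/
noncomputable def tele (α η b P s : ℝ) : ℝ :=
  2 ^ (1 + η) * (b + P) ^ (-1 - η) * ker α b s
    - 2 ^ (1 + α) * α / η * (b + P) ^ (-1 - α) * (s + P) ^ (-η)

lemma ker_sub_mul_le {α η b P x y : ℝ} (hα : 0 < α) (hη : 0 < η) (hP : 0 < P) (hx : 0 ≤ x)
    (hxy : x ≤ y) (hy : y < b) :
    (ker α b y - ker α b x) * (y + P) ^ (-1 - η) ≤ tele α η b P y - tele α η b P x := by
  have hY : 0 < b + P := by linarith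
  have hd : ∀ s ∈ Icc x y, HasDerivAt
      (fun s => tele α η b P s - (y + P) ^ (-1 - η) * ker α b s)
      ((2 ^ (1 + η) * (b + P) ^ (-1 - η) * ker' α b s
        + 2 ^ (1 + α) * α * (b + P) ^ (-1 - α) * (s + P) ^ (-1 - η))
        - (y + P) ^ (-1 - η) * ker' α b s) s := by
    intro s hs
    have hk := hasDerivAt_ker (α := α) (hs.2.trans_lt hy)
    have hp := hasDerivAt_shift_rpow (P := P) (s := s) (-η) (by linarith [hs.1])
    refine (((hk.const_mul _).sub (hp.const_mul _)).sub (hk.const_mul _)).congr_deriv ?_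
    rw [show -η - 1 = -1 - η by ring]
    field_simp
    ring
  have hmono : MonotoneOn (fun s => tele α η b P s - (y + P) ^ (-1 - η) * ker α b s) (Icc x y) := by
    refine monotoneOn_of_hasDerivWithinAt_nonneg (convex_Icc x y)
      (fun s hs => (hd s hs).continuousAt.continuousWithinAt)
      (fun s hs => (hd s (interior_subset hs)).hasDerivWithinAt) (fun s hs => ?_)
    have hs := interior_subset hs
    have hsb := hs.2.trans_lt hy
    have hk := ker'_pos hα hsb
    have hsP : 0 < s + P := by linarith [hs.1]
    have m1 : (y + P) ^ (-1 - η) ≤ (s + P) ^ (-1 - η) :=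
      rpow_le_rpow_of_nonpos hsP (by linarith [hs.2]) (by linarith)
    have p1 : 0 < (s + P) ^ (-1 - η) := rpow_pos_of_pos hsP _
    rcases le_total ((b + P) / 2) (s + P) with hc | hc
    · have m2 : (y + P) ^ (-1 - η) ≤ ((b + P) / 2) ^ (-1 - η) :=
        rpow_le_rpow_of_nonpos (by positivity) (by linarith [hs.2]) (by linarith)
      have e : ((b + P) / 2) ^ (-1 - η) = 2 ^ (1 + η) * (b + P) ^ (-1 - η) := by
        rw [div_rpow hY.le (by norm_num), div_eq_mul_inv, ← rpow_neg (by norm_num), mul_comm]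
        congr 2; ring
      rw [e] at m2
      have := mul_le_mul_of_nonneg_right m2 hk.le
      have : 0 ≤ 2 ^ (1 + α) * α * (b + P) ^ (-1 - α) * (s + P) ^ (-1 - η) := by positivity
      linarith
    · have m2 : (b - s) ^ (-α - 1) ≤ ((b + P) / 2) ^ (-α - 1) :=
        rpow_le_rpow_of_nonpos (by positivity) (by linarith) (by linarith)
      have e : ((b + P) / 2) ^ (-α - 1) = 2 ^ (1 + α) * (b + P) ^ (-1 - α) := by
        rw [div_rpow hY.le (by norm_num), div_eq_mul_inv, ← rpow_neg (by norm_num), mul_comm,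
          show -α - 1 = -1 - α by ring]
        congr 2; ring
      rw [e] at m2
      have m3 : ker' α b s ≤ 2 ^ (1 + α) * α * (b + P) ^ (-1 - α) := by
        have := mul_le_mul_of_nonneg_left m2 hα.le
        unfold ker'
        linarith
      have := mul_le_mul m1 m3 hk.le p1.le
      have : 0 ≤ 2 ^ (1 + η) * (b + P) ^ (-1 - η) * ker' α b s := by positivity
      linarith
  have := hmono ⟨le_rfl, hxy⟩ ⟨hxy, le_rfl⟩ hxy
  simp only at this
  linarith

/-- Constant bounding the total consistency error of the barrier. -/
noncomputable def errConst (α r c C R : ℝ) : ℝ :=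
  6 * (2 * R) ^ (4 - α) * (2 * C * R) ^ 3 *
    ((2 ^ (1 + α / r) + 1 / (1 - α)) * (c / 2) ^ (-α) + 2 ^ (1 + α) * α / (α / r))

section Row

variable {α r c C R P : ℝ} {t : ℕ → ℝ} {n : ℕ}

lemma Graded.C_nonneg (h : Graded r c C R t n) : 0 ≤ C := by
  have h1 := h.upper 0 (by omega)
  have h2 := h.step 0 (by omega)
  have h3 := h.pos (i := 0) (by omega)
  rw [zero_add] at h3
  have : 0 < t 1 ^ (1 / r) * t (0 + 1) ^ (1 - 1 / r) := by positivity
  by_contra hneg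
  have := mul_neg_of_neg_of_pos (not_le.1 hneg) this
  linarith

lemma Graded.width_le (h : Graded r c C R t n) (hr1 : 1 ≤ r) (hR : 1 ≤ R) (hP : 0 ≤ P) {i : ℕ}
    (hi : i ≤ n) :
    t (i + 1) - t i ≤ C * R * (t 1 ^ (1 / r) * (t (i + 1) + P) ^ (1 - 1 / r)) := by
  have hC := h.C_nonneg
  have h1 := h.pos (i := 0) (by omega)
  rw [zero_add] at h1
  have h2 := h.pos hi
  refine (h.upper i hi).trans ?_
  have he : 0 ≤ 1 - 1 / r := by
    rw [sub_nonneg, div_le_one (by linarith)]; exact hr1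
  have : t (i + 1) ^ (1 - 1 / r) ≤ (t (i + 1) + P) ^ (1 - 1 / r) :=
    rpow_le_rpow h2.le (by linarith) he
  calc C * (t 1 ^ (1 / r) * t (i + 1) ^ (1 - 1 / r))
      ≤ C * (t 1 ^ (1 / r) * (t (i + 1) + P) ^ (1 - 1 / r)) := by gcongr
    _ ≤ _ := mul_le_mul_of_nonneg_right (le_mul_of_one_le_right hC hR) (by positivity)

lemma Graded.width_two_le (h : Graded r c C R t n) (hr1 : 1 ≤ r) (hR : 1 ≤ R) (hP : 0 ≤ P) {i : ℕ}
    (hi : i < n) :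
    t (i + 2) - t i ≤ 2 * C * R * (t 1 ^ (1 / r) * (t (i + 1) + P) ^ (1 - 1 / r)) := by
  have hC := h.C_nonneg
  have h1 := h.pos (i := 0) (by omega)
  rw [zero_add] at h1
  have h2 := h.pos hi.le
  have h3 := h.width_le hr1 hR hP hi.le
  have h4 := h.upper (i + 1) (by omega)
  have he : 0 ≤ 1 - 1 / r := by
    rw [sub_nonneg, div_le_one (by linarith)]; exact hr1
  have he' : 1 - 1 / r ≤ 1 := by
    have : 0 ≤ 1 / r := by positivity
    linarith
  have h5 : t (i + 2) ^ (1 - 1 / r) ≤ R * (t (i + 1) + P) ^ (1 - 1 / r) := by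
    calc t (i + 2) ^ (1 - 1 / r) ≤ (R * (t (i + 1) + P)) ^ (1 - 1 / r) :=
          rpow_le_rpow (h.pos (i := i + 1) (by omega)).le
            ((h.ratio i hi).trans (by gcongr; linarith)) he
      _ = R ^ (1 - 1 / r) * (t (i + 1) + P) ^ (1 - 1 / r) :=
          mul_rpow (by linarith) (by linarith)
      _ ≤ R * (t (i + 1) + P) ^ (1 - 1 / r) := by
          gcongr
          exact (rpow_le_rpow_of_exponent_le hR he').trans_eq (rpow_one R)
  have h6 : C * (t 1 ^ (1 / r) * t (i + 2) ^ (1 - 1 / r))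
      ≤ C * (t 1 ^ (1 / r) * (R * (t (i + 1) + P) ^ (1 - 1 / r))) := by gcongr
  have h7 : t (i + 1 + 1) - t (i + 1) ≤ C * (t 1 ^ (1 / r) * t (i + 2) ^ (1 - 1 / r)) := h4
  have h8 : t (i + 1 + 1) = t (i + 2) := rfl
  linarith

lemma Graded.shift_le (h : Graded r c C R t n) (hR : 1 ≤ R) (hP : t 1 ≤ P) {i : ℕ}
    (hi : i ≤ n) : t (i + 1) + P ≤ 2 * R * (t i + P) := by
  have hP0 : 0 ≤ P := (h.nonneg (i := 1) (by omega)).trans hP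
  have h0 := h.nonneg (i := i) (by omega)
  have hle : P ≤ R * P := le_mul_of_one_le_left hP0 hR
  have hle' : t i ≤ R * t i := le_mul_of_one_le_left h0 hR
  rcases i with _ | i
  · rw [h.zero, zero_add]; linarith
  · have := h.ratio i (by omega)
    have h8 : t (i + 1 + 1) = t (i + 2) := rfl
    linarith

/-- Consistency error weight on the cells entering the operator at level `n + 1`. -/
noncomputable def errWeight (α r C R τ : ℝ) : ℝ :=
  6 * (2 * R) ^ (4 - α) * (2 * C * R) ^ 3 * τ ^ (α + α / r)

lemma Graded.interior_error_le (h : Graded r c C R t n) (hα0 : 0 < α) (hα1 : α < 1) (hr1 : 1 ≤ r)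
    (hr2 : r ≤ (3 - α) / α) (hR : 1 ≤ R) (hP : t 1 ≤ P) {i : ℕ} (hi : i < n) :
    6 * (t i + P) ^ (α - 4) * (t (i + 2) - t i) ^ 2 * (t (i + 1) - t i)
      ≤ errWeight α r C R (t 1) * (t (i + 1) + P) ^ (-1 - α / r) := by
  have h1 : 0 < t 1 := h.pos (i := 0) (by omega)
  have h0 := h.nonneg (i := i) (by omega)
  have hC := h.C_nonneg
  have s1 := h.step i (by omega)
  have s2 : t (i + 1) < t (i + 2) := h.step (i + 1) (by omega)
  have hw := h.width_two_le hr1 hR (h1.le.trans hP) hi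
  exact cell_error_le hα0 hα1 hr1 hr2 hR h1 (by linarith)
    (h.shift_le hR hP hi.le) (by linarith) (by linarith) hw (by linarith)

lemma Graded.last_error_le (h : Graded r c C R t n) (hα0 : 0 < α) (hα1 : α < 1) (hr1 : 1 ≤ r)
    (hr2 : r ≤ (3 - α) / α) (hR : 1 ≤ R) (hP : t 1 ≤ P) :
    mom0 α (tStar α t (n + 1)) (t n) (tStar α t (n + 1))
        * (6 * (t n + P) ^ (α - 4) * (t (n + 1) - t n) ^ 2)
      ≤ 1 / (1 - α) * ker α (tStar α t (n + 1)) (t n)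
        * (errWeight α r C R (t 1) * (tStar α t (n + 1) + P) ^ (-1 - α / r)) := by
  have h1 : 0 < t 1 := h.pos (i := 0) (by omega)
  have h0 := h.nonneg (i := n) (by omega)
  have hC := h.C_nonneg
  have s1 := h.step n le_rfl
  have hb := lt_tStar hα1 h.step
  have hb2 := tStar_succ α t n
  set b := tStar α t (n + 1) with hbdef
  have hby : b ≤ t (n + 1) := by rw [hb2]; nlinarith
  have hbh : b - t n ≤ t (n + 1) - t n := by linarith
  have hw := h.width_le hr1 hR (h1.le.trans hP) le_rfl
  have hw2 : t (n + 1) - t n ≤ 2 * C * R * (t 1 ^ (1 / r) * (t (n + 1) + P) ^ (1 - 1 / r)) := by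
    linarith
  have key := cell_error_le hα0 hα1 hr1 hr2 hR h1 (y := t (n + 1) + P) (by linarith)
    (h.shift_le hR hP le_rfl) (by linarith) (by linarith) hw2 hw2
  have hmono : (t (n + 1) + P) ^ (-1 - α / r) ≤ (b + P) ^ (-1 - α / r) := by
    have : 0 < α / r := by positivity
    exact rpow_le_rpow_of_nonpos (by linarith) (by linarith) (by linarith)
  have hk := ker_pos (α := α) hb
  have hm : mom0 α b (t n) b ≤ 1 / (1 - α) * ker α b (t n) * (t (n + 1) - t n) := by
    rw [mom0_last hα1, show 1 - α = -α + 1 by ring, rpow_add_one (by linarith), ← ker,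
      div_eq_mul_one_div, mul_comm _ (1 / _), mul_assoc (1 / _)]
    exact mul_le_mul_of_nonneg_left (mul_le_mul_of_nonneg_left hbh hk.le)
      (one_div_nonneg.2 (by linarith))
  have hpos : 0 ≤ 6 * (t n + P) ^ (α - 4) * (t (n + 1) - t n) ^ 2 :=
    mul_nonneg (mul_nonneg (by norm_num) (rpow_nonneg (by linarith) _)) (sq_nonneg _)
  have hE : 0 ≤ errWeight α r C R (t 1) := by unfold errWeight; positivity
  calc _ ≤ 1 / (1 - α) * ker α b (t n) * (t (n + 1) - t n)
        * (6 * (t n + P) ^ (α - 4) * (t (n + 1) - t n) ^ 2) :=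
        mul_le_mul_of_nonneg_right hm hpos
    _ = 1 / (1 - α) * ker α b (t n)
        * (6 * (t n + P) ^ (α - 4) * (t (n + 1) - t n) ^ 2 * (t (n + 1) - t n)) := by ring
    _ ≤ 1 / (1 - α) * ker α b (t n) * (errWeight α r C R (t 1)
          * (t (n + 1) + P) ^ (-1 - α / r)) :=
        mul_le_mul_of_nonneg_left key (mul_nonneg (one_div_nonneg.2 (by linarith)) hk.le)
    _ ≤ _ := mul_le_mul_of_nonneg_left (mul_le_mul_of_nonneg_left hmono hE)
        (mul_nonneg (one_div_nonneg.2 (by linarith)) hk.le)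

lemma Graded.ker_last_le (h : Graded r c C R t n) (hα0 : 0 < α) (hα1 : α < 1) (hr1 : 1 ≤ r)
    (hc : 0 < c) :
    ker α (tStar α t (n + 1)) (t n)
      ≤ (c / 2) ^ (-α) * t 1 ^ (-(α / r)) * tStar α t (n + 1) ^ (α / r - α) := by
  have h1 : 0 < t 1 := h.pos (i := 0) (by omega)
  have h0 := h.nonneg (i := n) (by omega)
  have s1 := h.step n le_rfl
  have hb := lt_tStar hα1 h.step
  have hb2 := tStar_succ α t n
  set b := tStar α t (n + 1) with hbdef
  have hb0 : 0 < b := h0.trans_lt hb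
  have hby : b ≤ t (n + 1) := by rw [hb2]; nlinarith
  have he : 0 ≤ 1 - 1 / r := by
    rw [sub_nonneg, div_le_one (by linarith)]; exact hr1
  have h2 : c / 2 * (t 1 ^ (1 / r) * b ^ (1 - 1 / r)) ≤ b - t n := by
    have e1 : b - t n = (1 - α / 2) * (t (n + 1) - t n) := by rw [hb2]; ring
    have e2 : 1 / 2 * (t (n + 1) - t n) ≤ b - t n := by
      rw [e1]; exact mul_le_mul_of_nonneg_right (by linarith) (by linarith)
    have e3 := h.lower n le_rfl
    have e4 : c * (t 1 ^ (1 / r) * b ^ (1 - 1 / r)) ≤ c * (t 1 ^ (1 / r) * t (n + 1) ^ (1 - 1 / r)) := by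
      gcongr
    linarith
  calc ker α b (t n) ≤ (c / 2 * (t 1 ^ (1 / r) * b ^ (1 - 1 / r))) ^ (-α) :=
        rpow_le_rpow_of_nonpos (by positivity) h2 (by linarith)
    _ = _ := by
        rw [mul_rpow (by positivity) (by positivity), mul_rpow (by positivity) (by positivity),
          ← rpow_mul h1.le, ← rpow_mul hb0.le, mul_assoc,
          show 1 / r * -α = -(α / r) by ring, show (1 - 1 / r) * -α = α / r - α by ring]

lemma Graded.total_error_le (h : Graded r c C R t n) (hα0 : 0 < α) (hα1 : α < 1) (hr1 : 1 ≤ r)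
    (hc : 0 < c) (hR : 1 ≤ R) (hP : t 1 ≤ P) :
    errWeight α r C R (t 1) * (tele α (α / r) (tStar α t (n + 1)) P (t n)
        - tele α (α / r) (tStar α t (n + 1)) P (t 0))
      + 1 / (1 - α) * ker α (tStar α t (n + 1)) (t n)
        * (errWeight α r C R (t 1) * (tStar α t (n + 1) + P) ^ (-1 - α / r))
      ≤ errConst α r c C R * t 1 ^ α
          * (tStar α t (n + 1) ^ (-α) / (tStar α t (n + 1) + P)) := by
  have h1 : 0 < t 1 := h.pos (i := 0) (by omega)
  have h0 := h.nonneg (i := n) (by omega)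
  have hC := h.C_nonneg
  have hk := h.ker_last_le hα0 hα1 hr1 hc
  have hb := lt_tStar hα1 h.step
  have hb00 : t 0 < tStar α t (n + 1) := by rw [h.zero]; exact h0.trans_lt hb
  set b := tStar α t (n + 1) with hbdef
  have hb0 : 0 < b := h0.trans_lt hb
  have hP0 : 0 < P := h1.trans_le hP
  have hY : 0 < b + P := by linarith
  set η := α / r with hη
  have hη0 : 0 < η := by rw [hη]; positivity
  have hkn := ker_pos (α := α) hb
  have hk0 := ker_pos (α := α) hb00
  -- the telescoped part
  have ht1 : tele α η b P (t n) - tele α η b P (t 0)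
      ≤ 2 ^ (1 + η) * (b + P) ^ (-1 - η) * ker α b (t n)
        + 2 ^ (1 + α) * α / η * (b + P) ^ (-1 - α) * P ^ (-η) := by
    unfold tele
    rw [h.zero, zero_add]
    have p1 : 0 ≤ 2 ^ (1 + η) * (b + P) ^ (-1 - η) * ker α b 0 := by
      rw [h.zero] at hk0; positivity
    have p2 : 0 ≤ 2 ^ (1 + α) * α / η * (b + P) ^ (-1 - α) * (t n + P) ^ (-η) := by positivity
    linarith
  have ha : t 1 ^ (α + η) * ((b + P) ^ (-1 - η) * ker α b (t n))
      ≤ (c / 2) ^ (-α) * (t 1 ^ α * (b ^ (-α) / (b + P))) := by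
    have e1 : t 1 ^ (α + η) * ((b + P) ^ (-1 - η) * ((c / 2) ^ (-α) * t 1 ^ (-η) * b ^ (η - α)))
        = (c / 2) ^ (-α) * (t 1 ^ α * ((b / (b + P)) ^ η * (b ^ (-α) / (b + P)))) := by
      rw [rpow_add h1, rpow_neg h1.le, show η - α = η + -α by ring, rpow_add hb0,
        show -1 - η = -η + -1 by ring, rpow_add hY, rpow_neg hY.le, rpow_neg_one,
        div_rpow hb0.le hY.le]
      have : t 1 ^ η ≠ 0 := (rpow_pos_of_pos h1 _).ne'
      field_simp
    have e2 : (b / (b + P)) ^ η ≤ 1 :=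
      rpow_le_one (by positivity) (by rw [div_le_one hY]; linarith) hη0.le
    calc t 1 ^ (α + η) * ((b + P) ^ (-1 - η) * ker α b (t n))
        ≤ t 1 ^ (α + η) * ((b + P) ^ (-1 - η) * ((c / 2) ^ (-α) * t 1 ^ (-η) * b ^ (η - α))) := by
          gcongr
      _ = _ := e1
      _ ≤ (c / 2) ^ (-α) * (t 1 ^ α * (1 * (b ^ (-α) / (b + P)))) := by gcongr
      _ = _ := by rw [one_mul]
  have hbb : t 1 ^ (α + η) * ((b + P) ^ (-1 - α) * P ^ (-η)) ≤ t 1 ^ α * (b ^ (-α) / (b + P)) := by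
    have e1 : t 1 ^ (α + η) * ((b + P) ^ (-1 - α) * P ^ (-η))
        = t 1 ^ α * ((t 1 / P) ^ η * ((b + P) ^ (-α) / (b + P))) := by
      rw [rpow_add h1, rpow_neg hP0.le, show -1 - α = -α + -1 by ring, rpow_add hY, rpow_neg_one,
        div_rpow h1.le hP0.le]
      field_simp
    have e2 : (t 1 / P) ^ η ≤ 1 :=
      rpow_le_one (by positivity) (by rw [div_le_one hP0]; exact hP) hη0.le
    have e3 : (b + P) ^ (-α) ≤ b ^ (-α) := rpow_le_rpow_of_nonpos hb0 (by linarith) (by linarith)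
    rw [e1]
    calc _ ≤ t 1 ^ α * (1 * (b ^ (-α) / (b + P))) := by gcongr
      _ = _ := by rw [one_mul]
  have h1α : 0 ≤ 1 / (1 - α) := one_div_nonneg.2 (by linarith)
  set W := 6 * (2 * R) ^ (4 - α) * (2 * C * R) ^ 3 with hW
  have hW0 : 0 ≤ W := by positivity
  have hew : errWeight α r C R (t 1) = W * t 1 ^ (α + η) := rfl
  have hec : errConst α r c C R = W * ((2 ^ (1 + η) + 1 / (1 - α)) * (c / 2) ^ (-α)
    + 2 ^ (1 + α) * α / η) := rfl
  have hx : 0 ≤ W * (2 ^ (1 + η) + 1 / (1 - α)) := by positivity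
  have hz : 0 ≤ W * (2 ^ (1 + α) * α / η) := by positivity
  have q1 := mul_le_mul_of_nonneg_left ht1 (by positivity : 0 ≤ W * t 1 ^ (α + η))
  have q2 := mul_le_mul_of_nonneg_left ha hx
  have q3 := mul_le_mul_of_nonneg_left hbb hz
  rw [hew, hec]
  linarith

/-- Lower bound for the Alikhanov operator, at level `n + 1`, of a shifted power with zero value
imposed at the initial node. -/
lemma Graded.barrier_ge (h : Graded r c C R t n) (hα0 : 0 < α) (hα1 : α < 1) (hr1 : 1 ≤ r)
    (hr2 : r ≤ (3 - α) / α) (hc : 0 < c) (hR : 1 ≤ R) (hP : t 1 ≤ P)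
    (hPK : 2 * errConst α r c C R * t 1 ^ α ≤ P ^ α) :
    1 / 2 * (P ^ α * tStar α t (n + 1) ^ (-α) / (tStar α t (n + 1) + P))
      ≤ coef α (tStar α t (n + 1)) t n 0 * bar α P (t 0)
        + Real.Gamma (1 - α) * deltaAlik α t (fun k => bar α P (t k)) (n + 1) := by
  have h1 : 0 < t 1 := h.pos (i := 0) (by omega)
  have hP0 : 0 < P := h1.trans_le hP
  have h0 := h.nonneg (i := n) (by omega)
  have hb := lt_tStar hα1 h.step
  have herr := h.total_error_le hα0 hα1 hr1 hc hR hP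
  have hlast := h.last_error_le hα0 hα1 hr1 hr2 hR hP
  have hcell := last_cell_ge hα0 hα1 (P := P) (by linarith) (h.step n le_rfl) (tStar_succ α t n)
  have hcoef := coef_ge hα0 hα1 h.step (k := 0) (by omega)
  rw [gamma_mul_deltaAlik hα1]
  set b := tStar α t (n + 1) with hbdef
  have hb0 : 0 < b := h0.trans_lt hb
  have hY : 0 < b + P := by linarith
  set E := errWeight α r C R (t 1) with hE
  have hsum : ∀ i ∈ Finset.range n,
      (prim α b P (t (i + 1)) - E * tele α (α / r) b P (t (i + 1)))
        - (prim α b P (t i) - E * tele α (α / r) b P (t i))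
      ≤ ∫ s in (t i)..(t (i + 1)), ker α b s *
          deriv (lagQuad (t i) (t (i + 1)) (t (i + 2)) (bar α P (t i)) (bar α P (t (i + 1)))
            (bar α P (t (i + 2)))) s := by
    intro i hi
    have hi := Finset.mem_range.1 hi
    have hti := h.nonneg (i := i) (by omega)
    have hib : t (i + 1) < b := (le_of_step h.step (by omega) (by omega)).trans_lt hb
    have s1 := h.step i hi.le
    have c1 := interior_cell_ge hα0 hα1 (P := P) (by linarith) s1 (h.step (i + 1) (by omega)) hib
    have c2 := h.interior_error_le hα0 hα1 hr1 hr2 hR hP hi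
    have c3 := ker_sub_mul_le hα0 (by positivity : 0 < α / r) hP0 hti s1.le hib
    have hE0 : 0 ≤ E := by
      have := h.C_nonneg
      rw [hE]; unfold errWeight; positivity
    have hkm := ker_mono hα0 s1.le hib
    have c4 := mul_le_mul_of_nonneg_left c2 (sub_nonneg.2 hkm)
    have c5 := mul_le_mul_of_nonneg_left c3 hE0
    have e : t (i + 1 + 1) = t (i + 2) := rfl
    rw [e] at c1
    linarith
  have hsum := Finset.sum_le_sum hsum
  rw [Finset.sum_range_sub (fun i => prim α b P (t i) - E * tele α (α / r) b P (t i))] at hsum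
  have p0 : prim α b P b = 0 := by
    unfold prim; rw [sub_self, zero_rpow (by linarith)]; ring
  have p1 : prim α b P (t 0) = b ^ (1 - α) * P ^ (α - 1) / (b + P) := by
    unfold prim; rw [h.zero, sub_zero, zero_add]
  have hB : bar α P (t 0) = P ^ (α - 1) := by unfold bar; rw [h.zero, zero_add]
  have hk0 : ker α b (t 0) = b ^ (-α) := by unfold ker; rw [h.zero, sub_zero]
  have hmul : b ^ (-α) * P ^ (α - 1) ≤ coef α b t n 0 * P ^ (α - 1) := by
    rw [hk0] at hcoef
    exact mul_le_mul_of_nonneg_right hcoef (by positivity)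
  have hmain : b ^ (-α) * P ^ (α - 1) - b ^ (1 - α) * P ^ (α - 1) / (b + P)
      = P ^ α * b ^ (-α) / (b + P) := by
    rw [show (1 : ℝ) - α = -α + 1 by ring, rpow_add_one hb0.ne',
      show P ^ α = P ^ (α - 1) * P by rw [← rpow_add_one hP0.ne']; congr 1; ring]
    field_simp
    ring
  have hK := mul_le_mul_of_nonneg_right hPK (by positivity : 0 ≤ b ^ (-α) / (b + P))
  rw [p0] at hcell
  rw [p1] at hsum
  rw [hB]
  have e9 : P ^ α * (b ^ (-α) / (b + P)) = P ^ α * b ^ (-α) / (b + P) := by ring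
  linarith

/-- Bound for the only coefficient increment that can be negative. -/
lemma Graded.wNext_zero_mul_bar_le (h : Graded r c C R t n) (hα0 : 0 < α) (hα1 : α < 1)
    (hR : 1 ≤ R) (hn : 2 ≤ n) (hP : 11 * R * t 1 ≤ P) (hb : 11 * R * t 1 ≤ tStar α t (n + 1)) :
    2 * wNext α (tStar α t (n + 1)) t 0 * bar α P (t 2)
      ≤ 1 / 4 * (P ^ α * tStar α t (n + 1) ^ (-α) / (tStar α t (n + 1) + P)) := by
  have h1 : 0 < t 1 := h.pos (i := 0) (by omega)
  have s1 : t 1 < t 2 := h.step 1 (by omega)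
  have hRτ : t 1 ≤ R * t 1 := le_mul_of_one_le_left h1.le hR
  set b := tStar α t (n + 1) with hbdef
  have hb1 : t 1 < b := by linarith
  have hb0 : 0 < b := by linarith
  have hP0 : 0 < P := by linarith
  have hw := wNext_le hα0 (h.step 0 (by omega)) s1 hb1
  have hq := wNext_nonneg hα0 (h.step 0 (by omega)) s1 hb1
  have hs := h.size 0 (by omega)
  simp only [zero_add, h.zero, sub_zero] at hw hs
  have hD := ker'_pos hα0 hb1
  have hD2 : ker' α b (t 1) ≤ 4 * (b ^ (-α) / b) := by
    have e1 : (b - t 1) ^ (-α - 1) ≤ (b / 2) ^ (-α - 1) :=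
      rpow_le_rpow_of_nonpos (by positivity) (by linarith) (by linarith)
    have e2 : (b / 2) ^ (-α - 1) = 2 ^ (1 + α) * (b ^ (-α) / b) := by
      rw [div_rpow hb0.le (by norm_num), div_eq_mul_inv, ← rpow_neg (by norm_num),
        rpow_sub_one hb0.ne', mul_comm]
      congr 2; ring
    have e3 : (2 : ℝ) ^ (1 + α) ≤ 4 := by
      calc (2 : ℝ) ^ (1 + α) ≤ 2 ^ (2 : ℝ) :=
            rpow_le_rpow_of_exponent_le (by norm_num) (by linarith)
        _ = 4 := by norm_num
    calc ker' α b (t 1) ≤ 1 * (2 ^ (1 + α) * (b ^ (-α) / b)) := by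
          unfold ker'
          rw [← e2]
          exact mul_le_mul hα1.le e1 (rpow_nonneg (by linarith) _) (by norm_num)
      _ ≤ _ := by rw [one_mul]; gcongr
  have hw2 : wNext α b t 0 ≤ ker' α b (t 1) * (R * t 1 / 6) := by
    refine hw.trans ?_
    rw [mul_div_assoc]
    refine mul_le_mul_of_nonneg_left ?_ hD.le
    have a2 : 0 < t 2 - t 1 := by linarith
    have a3 : 0 < t 2 := by linarith
    rw [div_le_div_iff₀ (by positivity) (by norm_num)]
    have : t 1 * t 1 ≤ R * (t 2 - t 1) * t 2 := by
      exact mul_le_mul hs s1.le h1.le (by positivity)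
    have := mul_le_mul_of_nonneg_left this h1.le
    linarith
  have hB : bar α P (t 2) ≤ P ^ (α - 1) :=
    rpow_le_rpow_of_nonpos hP0 (by linarith) (by linarith)
  have hB0 : 0 ≤ bar α P (t 2) := rpow_nonneg (by linarith) _
  have step : 2 * wNext α b t 0 * bar α P (t 2)
      ≤ 2 * (4 * (b ^ (-α) / b) * (R * t 1 / 6)) * P ^ (α - 1) := by
    have := hw2.trans (mul_le_mul_of_nonneg_right hD2 (by positivity : 0 ≤ R * t 1 / 6))
    gcongr
  refine step.trans ?_
  have e1 : 2 * (4 * (b ^ (-α) / b) * (R * t 1 / 6)) * P ^ (α - 1)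
      = P ^ α * b ^ (-α) * (4 * R * t 1 / (3 * (b * P))) := by
    rw [show P ^ α = P ^ (α - 1) * P by rw [← rpow_add_one hP0.ne']; congr 1; ring]
    field_simp
    ring
  have e2 : 1 / 4 * (P ^ α * b ^ (-α) / (b + P)) = P ^ α * b ^ (-α) * (1 / (4 * (b + P))) := by
    field_simp
  rw [e1, e2]
  refine mul_le_mul_of_nonneg_left ?_ (by positivity)
  rw [div_le_div_iff₀ (by positivity) (by positivity)]
  have f1 := mul_le_mul_of_nonneg_right hP hb0.le
  have f2 := mul_le_mul_of_nonneg_right hb hP0.le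
  nlinarith [mul_pos (mul_pos (by linarith : 0 < R) h1) hb0,
    mul_pos (mul_pos (by linarith : 0 < R) h1) hP0]

end Row

section Assembly

variable {α r γ c C R : ℝ} {t V : ℕ → ℝ} {M : ℕ}

lemma quasiGraded_graded {T : ℝ} (hr1 : 1 ≤ r) (hc : 0 < c) (hcC : c ≤ C) (hm : IsMesh T M t)
    (hq : QuasiGraded r c C M t) {n : ℕ} (hn : n + 1 ≤ M) :
    Graded r c C (C / c * 2 ^ r) t n := by
  obtain ⟨-, h0, hstep, -⟩ := hm
  obtain ⟨-, hsize, hwidth⟩ := hq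
  have hst : ∀ i ≤ n, t i < t (i + 1) := fun i hi => hstep i (by omega)
  have hpos : ∀ i ≤ n, 0 < t (i + 1) := fun i hi => by
    have := lt_of_step hst (i := 0) (j := i + 1) (by omega) (by omega)
    rwa [h0] at this
  have h1 : 0 < t 1 := hpos 0 (by omega)
  have hC : 0 < C := hc.trans_le hcC
  have h2r : (1 : ℝ) ≤ 2 ^ r := one_le_rpow (by norm_num) (by linarith)
  have he : 0 ≤ 1 - 1 / r := by
    rw [sub_nonneg, div_le_one (by linarith)]; exact hr1
  refine ⟨h0, hst, fun i hi => ?_, fun i hi => ?_, fun i hi => ?_, fun i hi => ?_⟩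
  · simpa using (hwidth (i + 1) (by omega) (by omega)).1
  · simpa using (hwidth (i + 1) (by omega) (by omega)).2
  · have u := (hsize (i + 2) (by omega) (by omega)).2
    have l := (hsize (i + 1) (by omega) (by omega)).1
    have hp : ((i + 2 : ℕ) : ℝ) ^ r ≤ 2 ^ r * ((i + 1 : ℕ) : ℝ) ^ r := by
      rw [← mul_rpow (by norm_num) (by positivity)]
      refine rpow_le_rpow (by positivity) ?_ (by linarith)
      push_cast
      linarith [(Nat.cast_nonneg i : (0 : ℝ) ≤ i)]
    calc t (i + 2) ≤ C * (t 1 * (2 ^ r * ((i + 1 : ℕ) : ℝ) ^ r)) := u.trans (by gcongr)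
      _ = C / c * 2 ^ r * (c * (t 1 * ((i + 1 : ℕ) : ℝ) ^ r)) := by field_simp
      _ ≤ C / c * 2 ^ r * t (i + 1) := by gcongr
  · have u := (hwidth (i + 1) (by omega) (by omega)).2
    have l := (hwidth (i + 2) (by omega) (by omega)).1
    simp only [add_tsub_cancel_right] at u
    rw [show i + 2 - 1 = i + 1 by omega] at l
    have hlt : t (i + 1) < t (i + 2) := hst (i + 1) (by omega)
    have hp := hpos i (by omega)
    calc t (i + 1) - t i ≤ C * (t 1 ^ (1 / r) * t (i + 2) ^ (1 - 1 / r)) := u.trans (by gcongr)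
      _ = C / c * (c * (t 1 ^ (1 / r) * t (i + 2) ^ (1 - 1 / r))) := by field_simp
      _ ≤ C / c * (t (i + 2) - t (i + 1)) := by gcongr
      _ ≤ C / c * 2 ^ r * (t (i + 2) - t (i + 1)) := by
          have : 0 ≤ C / c := by positivity
          exact mul_le_mul_of_nonneg_right (le_mul_of_one_le_right this h2r) (by linarith)

/-- One row of the discrete comparison principle. -/
lemma abs_succ_le_of_supersolution (hα0 : 0 < α) (hα1 : α < 1) (hM : AlikhanovCond M t) {n : ℕ}
    (hn : 2 ≤ n) (hnM : n + 1 ≤ M) (ht : ∀ i ≤ n, t i < t (i + 1)) (hV : V 0 = 0) {W : ℕ → ℝ}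
    (hVW : ∀ k < n, |V (k + 1)| ≤ W (k + 1))
    (hW : Real.Gamma (1 - α) * |deltaAlik α t V (n + 1)|
      ≤ coef α (tStar α t (n + 1)) t n 0 * W 0 + Real.Gamma (1 - α) * deltaAlik α t W (n + 1)
        - 2 * wNext α (tStar α t (n + 1)) t 0 * W 2) :
    |V (n + 1)| ≤ W (n + 1) := by
  have hb := lt_tStar hα1 ht
  have hΓ := Real.Gamma_pos_of_pos (by linarith : 0 < 1 - α)
  have eV := gamma_mul_deltaAlik_eq_sum hα1 V ht
  have eW := gamma_mul_deltaAlik_eq_sum hα1 W ht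
  rw [sum_mul_sub_eq] at eV eW
  have hA : 0 < coef α (tStar α t (n + 1)) t n n :=
    (ker_pos hb).trans_le (coef_ge hα0 hα1 ht le_rfl)
  have hmono := fun k (hk : k < n) => coef_le_coef_succ hα0 hα1 hM hnM ht hk
  have hq := wNext_nonneg hα0 (ht 0 (by omega)) (ht 1 (by omega))
    ((le_of_step ht (by omega : 1 ≤ n) (by omega)).trans_lt hb)
  set A := coef α (tStar α t (n + 1)) t n with hAdef
  set q := wNext α (tStar α t (n + 1)) t 0 with hqdef
  have hterm : ∀ k ∈ Finset.range n, |(A (k + 1) - A k) * V (k + 1)|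
      ≤ (A (k + 1) - A k) * W (k + 1) + if k = 1 then 2 * q * W 2 else 0 := by
    intro k hk
    have hk := Finset.mem_range.1 hk
    have h1 := hmono k hk
    have h2 := hVW k hk
    have h3 := (abs_nonneg _).trans h2
    rw [abs_mul]
    have h4 : |A (k + 1) - A k| ≤ A (k + 1) - A k + 2 * (if k = 1 then q else 0) := by
      have : 0 ≤ (if k = 1 then q else 0) := by split_ifs <;> [exact hq; exact le_rfl]
      rw [abs_le]; constructor <;> linarith
    refine (mul_le_mul h4 h2 (abs_nonneg _) ((abs_nonneg _).trans h4)).trans_eq ?_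
    split_ifs with hk1
    · subst hk1; ring
    · ring
  have hsum := (Finset.abs_sum_le_sum_abs _ _).trans (Finset.sum_le_sum hterm)
  rw [Finset.sum_add_distrib, Finset.sum_ite_eq' (Finset.range n) 1,
    if_pos (Finset.mem_range.2 (by omega))] at hsum
  have e1 : A n * V (n + 1) = Real.Gamma (1 - α) * deltaAlik α t V (n + 1)
      + ∑ k ∈ Finset.range n, (A (k + 1) - A k) * V (k + 1) := by
    rw [eV, hV]; ring
  have e2 : A n * |V (n + 1)| ≤ Real.Gamma (1 - α) * |deltaAlik α t V (n + 1)|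
      + |∑ k ∈ Finset.range n, (A (k + 1) - A k) * V (k + 1)| := by
    rw [show A n * |V (n + 1)| = |A n * V (n + 1)| by rw [abs_mul, abs_of_pos hA], e1]
    refine (abs_add_le _ _).trans_eq ?_
    rw [abs_mul, abs_of_pos hΓ]
  refine le_of_mul_le_mul_left ?_ hA
  linarith

/-- Linearity of the supersolution functional. -/
lemma supersolution_sum (hα1 : α < 1) {n : ℕ} (ht : ∀ i ≤ n, t i < t (i + 1)) (a q : ℝ)
    (s : Finset ℕ) (w : ℕ → ℝ) (B : ℕ → ℕ → ℝ) :
    a * (∑ k ∈ s, w k * B k 0)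
        + Real.Gamma (1 - α) * deltaAlik α t (fun j => ∑ k ∈ s, w k * B k j) (n + 1)
        - q * ∑ k ∈ s, w k * B k 2
      = ∑ k ∈ s, w k * (a * B k 0 + Real.Gamma (1 - α) * deltaAlik α t (B k) (n + 1)
          - q * B k 2) := by
  have h : Real.Gamma (1 - α) * deltaAlik α t (fun j => ∑ k ∈ s, w k * B k j) (n + 1)
      = ∑ k ∈ s, w k * (Real.Gamma (1 - α) * deltaAlik α t (B k) (n + 1)) := by
    simp_rw [gamma_mul_deltaAlik_eq_sum hα1 _ ht, ← Finset.sum_sub_distrib, Finset.mul_sum]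
    rw [Finset.sum_comm]
    exact Finset.sum_congr rfl fun k _ => Finset.sum_congr rfl fun j _ => by ring
  rw [h, Finset.mul_sum, Finset.mul_sum, ← Finset.sum_add_distrib, ← Finset.sum_sub_distrib]
  exact Finset.sum_congr rfl fun k _ => by ring

lemma rpow_le_of_mem_Icc {x L β : ℝ} (h1 : 1 ≤ x) (h2 : x ≤ L) : x ^ β ≤ L ^ |β| :=
  (rpow_le_rpow_of_exponent_le h1 (le_abs_self β)).trans
    (rpow_le_rpow (by linarith) h2 (abs_nonneg β))

/-- Bound on the first few values, with a constant depending on their number. -/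
lemma exists_initial_bound (hα0 : 0 < α) (hα1 : α < 1) (γ : ℝ) (hC : 0 ≤ C) (hR : 1 ≤ R) (J : ℕ) :
    ∃ D : ℝ, 0 < D ∧ ∀ (M : ℕ) (t V : ℕ → ℝ),
      (∀ n, n + 1 ≤ M → Graded r c C R t n) →
      (∀ j : ℕ, 1 ≤ j → j ≤ M → t j ≤ C * (t 1 * (j : ℝ) ^ r)) → V 0 = 0 →
      (∀ j : ℕ, 1 ≤ j → j ≤ M → |deltaAlik α t V j| ≤ (t 1 / t j) ^ (γ + 1)) →
      ∀ j : ℕ, 1 ≤ j → j ≤ J → j ≤ M → |V j| ≤ D * t 1 ^ α := by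
  induction J with
  | zero => exact ⟨1, one_pos, fun _ _ _ _ _ _ _ j h1 h2 => by omega⟩
  | succ J ih =>
    obtain ⟨D, hD, ih⟩ := ih
    have hΓ := Real.Gamma_pos_of_pos (by linarith : 0 < 1 - α)
    set L := C * ((J + 1 : ℕ) : ℝ) ^ r with hL
    have hL0 : 0 ≤ L := by positivity
    refine ⟨D + (L ^ α * (Real.Gamma (1 - α) * L ^ |-(γ + 1)|) + (1 + R) * (J * D)),
      by positivity, fun M t V hG hup hV hf j hj1 hjJ hjM => ?_⟩
    have hG0 := hG 0 (by omega)
    have h1 : 0 < t 1 := hG0.pos (i := 0) le_rfl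
    rcases Nat.lt_or_ge J j with hj | hj
    · obtain rfl : j = J + 1 := by omega
      have G := hG J hjM
      have hprev : ∑ k ∈ Finset.range J, |V (k + 1)| ≤ J * (D * t 1 ^ α) := by
        refine (Finset.sum_le_card_nsmul _ _ (D * t 1 ^ α) fun k hk => ?_).trans_eq ?_
        · have := Finset.mem_range.1 hk
          exact ih M t V hG hup hV hf (k + 1) (by omega) (by omega) (by omega)
        · rw [Finset.card_range, nsmul_eq_mul]
      have hmain := abs_succ_le hα0 hα1 (by linarith : 0 ≤ R) G.step (G.nonneg (by omega)) G.size hV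
      have htj := G.pos (i := J) le_rfl
      have hle : t 1 ≤ t (J + 1) := le_of_step G.step (by omega) le_rfl
      have hx2 : t (J + 1) / t 1 ≤ L := by
        rw [div_le_iff₀ h1, hL]
        linarith [hup (J + 1) hj1 hjM]
      have hfx : (t 1 / t (J + 1)) ^ (γ + 1) ≤ L ^ |-(γ + 1)| := by
        rw [← inv_div, inv_rpow (by positivity), ← rpow_neg (by positivity)]
        exact rpow_le_of_mem_Icc (by rwa [one_le_div h1]) hx2
      have htα : t (J + 1) ^ α ≤ L ^ α * t 1 ^ α := by
        rw [← mul_rpow hL0 h1.le]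
        exact rpow_le_rpow htj.le (by rwa [div_le_iff₀ h1] at hx2) hα0.le
      have hfin := (hf (J + 1) hj1 hjM).trans hfx
      calc |V (J + 1)| ≤ _ := hmain
        _ ≤ (L ^ α * t 1 ^ α) * (Real.Gamma (1 - α) * L ^ |-(γ + 1)|)
            + (1 + R) * (J * (D * t 1 ^ α)) := by gcongr
        _ ≤ _ := by
            have : 0 ≤ D * t 1 ^ α := by positivity
            linarith
    · refine (ih M t V hG hup hV hf j hj1 hj hjM).trans ?_
      refine mul_le_mul_of_nonneg_right (le_add_of_nonneg_right (by positivity)) (by positivity)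

/-- Dyadic sums of powers. -/
lemma exists_dyadic_sum_le (γ : ℝ) : ∃ G : ℝ, 0 < G ∧ ∀ (m : ℕ) (x : ℝ), (2 : ℝ) ^ m ≤ x →
    ∑ k ∈ Finset.range (m + 1), ((2 : ℝ) ^ k) ^ (-γ)
      ≤ G * (if 0 < γ then 1 else if γ = 0 then 1 + Real.log x else x ^ (-γ)) := by
  have hpow : ∀ k : ℕ, ((2 : ℝ) ^ k) ^ (-γ) = ((2 : ℝ) ^ (-γ)) ^ k := fun k => by
    rw [← rpow_natCast, ← rpow_natCast, ← rpow_mul (by norm_num), ← rpow_mul (by norm_num), mul_comm]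
  set q := (2 : ℝ) ^ (-γ) with hq
  have hq0 : 0 < q := by positivity
  rcases lt_trichotomy γ 0 with hγ | hγ | hγ
  · have hq1 : 1 < q := one_lt_rpow (by norm_num) (by linarith)
    refine ⟨q / (q - 1), div_pos hq0 (by linarith), fun m x hx => ?_⟩
    rw [if_neg hγ.not_gt, if_neg hγ.ne]
    simp_rw [hpow]
    rw [geom_sum_eq hq1.ne', div_mul_eq_mul_div]
    have h2 : q ^ m ≤ x ^ (-γ) := by
      rw [← hpow]; exact rpow_le_rpow (by positivity) hx (by linarith)
    refine div_le_div_of_nonneg_right ?_ (by linarith)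
    rw [pow_succ]
    have := mul_le_mul_of_nonneg_left h2 hq0.le
    linarith
  · have hl : 0 < Real.log 2 := Real.log_pos (by norm_num)
    refine ⟨1 / Real.log 2, by positivity, fun m x hx => ?_⟩
    subst hγ
    simp only [lt_irrefl, if_false, if_true, neg_zero, rpow_zero, Finset.sum_const,
      Finset.card_range, nsmul_eq_mul, mul_one]
    have h1 : m * Real.log 2 ≤ Real.log x := by
      rw [← Real.log_pow]; exact Real.log_le_log (by positivity) hx
    have h2 : Real.log 2 ≤ 1 := by linarith [Real.log_two_lt_d9]
    rw [one_div, ← div_eq_inv_mul, le_div_iff₀ hl]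
    push_cast
    linarith
  · have hq1 : q < 1 := rpow_lt_one_of_one_lt_of_neg (by norm_num) (by linarith)
    refine ⟨(1 - q)⁻¹, inv_pos.2 (by linarith), fun m x _ => ?_⟩
    rw [if_pos hγ, mul_one]
    simp_rw [hpow]
    rw [← tsum_geometric_of_lt_one hq0.le hq1]
    exact (summable_geometric_of_lt_one hq0.le hq1).sum_le_tsum _ fun k _ => by positivity

end Assembly

section Final

variable {α r γ c C R : ℝ} {t V : ℕ → ℝ} {M : ℕ}

lemma dyadic_row_ge {k : ℕ} {τ x b K D g : ℝ} (hα0 : 0 < α) (hα1 : α < 1) (γ : ℝ) (hτ : 0 < τ)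
    (hK : 1 ≤ K) (hb : 0 < b) (hbx : b ≤ x) (h1 : (2 : ℝ) ^ k ≤ x / τ)
    (h2 : x / τ ≤ 2 ^ (k + 1)) (hg : 0 ≤ g) (hD : 24 * K * g * 2 ^ |γ + 1| ≤ D) :
    g * (τ / x) ^ (γ + 1) ≤ D * τ * ((2 : ℝ) ^ k) ^ (-γ)
      * (1 / 4 * ((K * τ * 2 ^ k) ^ α * b ^ (-α) / (b + K * τ * 2 ^ k))) := by
  have hz : (0 : ℝ) < 2 ^ k := by positivity
  set z := (2 : ℝ) ^ k with hzdef
  have hx : 0 < x := hb.trans_le hbx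
  have hK0 : 0 < K := by linarith
  set P := K * τ * z with hP
  have hP0 : 0 < P := by positivity
  have hbP : b ≤ 2 * P := by
    rw [div_le_iff₀ hτ, pow_succ] at h2
    have : τ * z ≤ K * (τ * z) := le_mul_of_one_le_left (by positivity) hK
    rw [hP]; linarith
  have hlow : 1 / (6 * P) ≤ P ^ α * b ^ (-α) / (b + P) := by
    have e1 : (1 / 2 : ℝ) ≤ P ^ α * b ^ (-α) := by
      rw [rpow_neg hb.le, ← div_eq_mul_inv, ← div_rpow hP0.le hb.le]
      calc (1 / 2 : ℝ) = (1 / 2) ^ (1 : ℝ) := (rpow_one _).symm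
        _ ≤ (1 / 2) ^ α := rpow_le_rpow_of_exponent_ge (by norm_num) (by norm_num) hα1.le
        _ ≤ (P / b) ^ α := by
            refine rpow_le_rpow (by norm_num) ?_ hα0.le
            rw [div_le_div_iff₀ (by norm_num) hb]; linarith
    rw [div_le_div_iff₀ (by positivity) (by positivity)]
    have := mul_le_mul_of_nonneg_right e1 (by positivity : 0 ≤ 6 * P)
    linarith
  have hpow : (τ / x) ^ (γ + 1) ≤ 2 ^ |γ + 1| * z ^ (-(γ + 1)) := by
    have e : (τ / x) ^ (γ + 1) = (x / τ / z) ^ (-(γ + 1)) * z ^ (-(γ + 1)) := by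
      rw [← mul_rpow (by positivity) hz.le, div_mul_cancel₀ _ hz.ne', rpow_neg (by positivity),
        ← inv_rpow (by positivity), inv_div]
    rw [e, ← abs_neg (γ + 1)]
    refine mul_le_mul_of_nonneg_right (rpow_le_of_mem_Icc ?_ ?_) (by positivity)
    · rwa [one_le_div hz]
    · rw [div_le_iff₀ hz]; rwa [pow_succ, mul_comm] at h2
  have hD0 : 0 ≤ D := le_trans (by positivity) hD
  calc g * (τ / x) ^ (γ + 1) ≤ g * (2 ^ |γ + 1| * z ^ (-(γ + 1))) := by gcongr
    _ = 24 * K * g * 2 ^ |γ + 1| * (z ^ (-(γ + 1)) / (24 * K)) := by field_simp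
    _ ≤ D * (z ^ (-(γ + 1)) / (24 * K)) := by gcongr
    _ = D * τ * z ^ (-γ) * (1 / 4 * (1 / (6 * P))) := by
        rw [neg_add, ← sub_eq_add_neg, rpow_sub_one hz.ne', hP]
        field_simp
        ring
    _ ≤ _ := by gcongr

/-- The functional of the discrete comparison principle is positive on shifted powers. -/
lemma Graded.functional_ge {P : ℝ} {n : ℕ} (h : Graded r c C R t n) (hα0 : 0 < α) (hα1 : α < 1)
    (hr1 : 1 ≤ r) (hr2 : r ≤ (3 - α) / α) (hc : 0 < c) (hR : 1 ≤ R) (hn : 2 ≤ n)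
    (hP : 11 * R * t 1 ≤ P) (hb : 11 * R * t 1 ≤ tStar α t (n + 1))
    (hPK : 2 * errConst α r c C R * t 1 ^ α ≤ P ^ α) :
    1 / 4 * (P ^ α * tStar α t (n + 1) ^ (-α) / (tStar α t (n + 1) + P))
      ≤ coef α (tStar α t (n + 1)) t n 0 * bar α P (t 0)
        + Real.Gamma (1 - α) * deltaAlik α t (fun k => bar α P (t k)) (n + 1)
        - 2 * wNext α (tStar α t (n + 1)) t 0 * bar α P (t 2) := by
  have h1 : 0 < t 1 := h.pos (i := 0) (by omega)
  have hRτ : t 1 ≤ R * t 1 := le_mul_of_one_le_left h1.le hR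
  have b1 := h.barrier_ge hα0 hα1 hr1 hr2 hc hR (by linarith) hPK
  have b2 := h.wNext_zero_mul_bar_le hα0 hα1 hR hn hP hb
  linarith

/-- Superposition of shifted powers over dyadic scales. -/
noncomputable def dyadicBar (α γ K τ : ℝ) (m : ℕ) (s : ℝ) : ℝ :=
  ∑ k ∈ Finset.range (m + 1), ((2 : ℝ) ^ k) ^ (-γ) * bar α (K * τ * 2 ^ k) s

lemma dyadicBar_le (hα1 : α < 1) {K τ s : ℝ} (hK : 0 ≤ K) (hτ : 0 ≤ τ) (hs : 0 < s) (m : ℕ) :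
    dyadicBar α γ K τ m s
      ≤ s ^ (α - 1) * ∑ k ∈ Finset.range (m + 1), ((2 : ℝ) ^ k) ^ (-γ) := by
  rw [Finset.mul_sum]
  refine Finset.sum_le_sum fun k _ => ?_
  rw [mul_comm]
  refine mul_le_mul_of_nonneg_right ?_ (by positivity)
  exact rpow_le_rpow_of_nonpos hs (le_add_of_nonneg_right (by positivity)) (by linarith)

lemma bar_le_dyadicBar {K τ s : ℝ} (hK : 0 ≤ K) (hτ : 0 ≤ τ) (hs : 0 ≤ s) (m : ℕ) :
    bar α (K * τ) s ≤ dyadicBar α γ K τ m s := by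
  have h := Finset.single_le_sum
    (f := fun k : ℕ => ((2 : ℝ) ^ k) ^ (-γ) * bar α (K * τ * 2 ^ k) s)
    (fun k _ => mul_nonneg (by positivity) (rpow_nonneg (by positivity) _))
    (Finset.mem_range.2 (Nat.succ_pos m))
  simpa [dyadicBar] using h

/-- Comparison with the dyadic barrier. -/
lemma abs_le_dyadicBar {K D D0 : ℝ} {J N m : ℕ} (hα0 : 0 < α) (hα1 : α < 1) (hr1 : 1 ≤ r)
    (hr2 : r ≤ (3 - α) / α) (hc : 0 < c) (hC : 0 ≤ C) (hR : 1 ≤ R) (hK : 11 * R ≤ K)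
    (hKe : 2 * errConst α r c C R ≤ K ^ α) (hJ : 2 ≤ J) (hJR : 22 * R ≤ c * J)
    (hDg : 24 * K * Real.Gamma (1 - α) * 2 ^ |γ + 1| ≤ D)
    (hDi : D0 * (C * (J : ℝ) ^ r + K) ^ (1 - α) ≤ D)
    (hM : AlikhanovCond M t) (hG : ∀ n, n + 1 ≤ M → Graded r c C R t n)
    (hsize : ∀ j : ℕ, 1 ≤ j → j ≤ M →
      c * (t 1 * (j : ℝ) ^ r) ≤ t j ∧ t j ≤ C * (t 1 * (j : ℝ) ^ r))
    (hV : V 0 = 0)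
    (hf : ∀ j : ℕ, 1 ≤ j → j ≤ M → |deltaAlik α t V j| ≤ (t 1 / t j) ^ (γ + 1))
    (hinit : ∀ j : ℕ, 1 ≤ j → j ≤ J → j ≤ M → |V j| ≤ D0 * t 1 ^ α)
    (hNM : N ≤ M) (hm : t N / t 1 < 2 ^ (m + 1)) (j : ℕ) (hj1 : 1 ≤ j) (hjN : j ≤ N) :
    |V j| ≤ D * t 1 * dyadicBar α γ K (t 1) m (t j) := by
  have h1 : 0 < t 1 := (hG 0 (by omega)).pos (i := 0) le_rfl
  have hΓ := Real.Gamma_pos_of_pos (by linarith : 0 < 1 - α)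
  have hK0 : 0 < K := by linarith
  have hD : 0 ≤ D := le_trans (by positivity) hDg
  induction j using Nat.strong_induction_on with
  | _ j ih =>
    obtain ⟨n, rfl⟩ : ∃ n, j = n + 1 := ⟨j - 1, by omega⟩
    have G := hG n (by omega)
    have htj := G.pos (i := n) le_rfl
    rcases Nat.lt_or_ge J (n + 1) with hjJ | hjJ
    · have hb := lt_tStar hα1 G.step
      have hb2 := tStar_succ α t n
      have htn := G.nonneg (i := n) (by omega)
      set b := tStar α t (n + 1) with hbdef
      have hb0 : 0 < b := htn.trans_lt hb
      have hby : b ≤ t (n + 1) := by rw [hb2]; nlinarith [G.step n le_rfl]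
      have hbh : t (n + 1) / 2 ≤ b := by rw [hb2]; nlinarith [G.step n le_rfl]
      have hb11 : 11 * R * t 1 ≤ b := by
        have q1 := (hsize (n + 1) (by omega) (by omega)).1
        have q2 : (J : ℝ) ≤ ((n + 1 : ℕ) : ℝ) ^ r := by
          calc (J : ℝ) ≤ ((n + 1 : ℕ) : ℝ) := by exact_mod_cast hjJ.le
            _ = ((n + 1 : ℕ) : ℝ) ^ (1 : ℝ) := (rpow_one _).symm
            _ ≤ _ := rpow_le_rpow_of_exponent_le (by exact_mod_cast (by omega : 1 ≤ n + 1)) hr1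
        have q3 : c * (t 1 * J) ≤ c * (t 1 * ((n + 1 : ℕ) : ℝ) ^ r) := by gcongr
        have q4 := mul_le_mul_of_nonneg_left hJR h1.le
        linarith
      have hle1 : t 1 ≤ t (n + 1) := le_of_step G.step (by omega) le_rfl
      have hleN : t (n + 1) ≤ t N :=
        le_of_step (hG (N - 1) (by omega)).step hjN (by omega)
      obtain ⟨k, hk1, hk2⟩ := exists_nat_pow_near
        (by rwa [one_le_div h1] : 1 ≤ t (n + 1) / t 1) (one_lt_two : (1 : ℝ) < 2)
      have hkm : k < m + 1 := by
        have : (2 : ℝ) ^ k < 2 ^ (m + 1) :=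
          (hk1.trans (div_le_div_of_nonneg_right hleN h1.le)).trans_lt hm
        exact (pow_lt_pow_iff_right₀ (one_lt_two : (1 : ℝ) < 2)).1 this
      set w : ℕ → ℝ := fun k => D * t 1 * ((2 : ℝ) ^ k) ^ (-γ) with hw
      have hw0 : ∀ k, 0 ≤ w k := fun k => by positivity
      set B : ℕ → ℕ → ℝ := fun k j => bar α (K * t 1 * 2 ^ k) (t j) with hB
      have hWeq : ∀ j, D * t 1 * dyadicBar α γ K (t 1) m (t j)
          = ∑ k ∈ Finset.range (m + 1), w k * B k j := fun j => by
        unfold dyadicBar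
        rw [Finset.mul_sum]
        exact Finset.sum_congr rfl fun k _ => (mul_assoc _ _ _).symm
      rw [hWeq]
      refine abs_succ_le_of_supersolution hα0 hα1 hM (by omega) (by omega) G.step hV
        (W := fun j => ∑ k ∈ Finset.range (m + 1), w k * B k j)
        (fun k hk => ?_) ?_
      · rw [← hWeq]
        exact ih (k + 1) (by omega) (by omega) (by omega)
      · rw [supersolution_sum hα1 G.step]
        have hrow : ∀ k, 1 / 4 * ((K * t 1 * 2 ^ k) ^ α * b ^ (-α) / (b + K * t 1 * 2 ^ k))
            ≤ coef α b t n 0 * B k 0 + Real.Gamma (1 - α) * deltaAlik α t (B k) (n + 1)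
              - 2 * wNext α b t 0 * B k 2 := by
          intro k
          have hz : (1 : ℝ) ≤ 2 ^ k := one_le_pow₀ (by norm_num)
          have hle : K * t 1 ≤ K * t 1 * 2 ^ k := le_mul_of_one_le_right (by positivity) hz
          refine G.functional_ge hα0 hα1 hr1 hr2 hc hR (by omega)
            ((mul_le_mul_of_nonneg_right hK h1.le).trans hle) hb11 ?_
          calc 2 * errConst α r c C R * t 1 ^ α ≤ K ^ α * t 1 ^ α := by gcongr
            _ = (K * t 1) ^ α := (mul_rpow hK0.le h1.le).symm
            _ ≤ _ := rpow_le_rpow (by positivity) hle hα0.le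
        calc Real.Gamma (1 - α) * |deltaAlik α t V (n + 1)|
            ≤ Real.Gamma (1 - α) * (t 1 / t (n + 1)) ^ (γ + 1) := by
              gcongr; exact hf (n + 1) (by omega) (by omega)
          _ ≤ w k * (1 / 4 * ((K * t 1 * 2 ^ k) ^ α * b ^ (-α) / (b + K * t 1 * 2 ^ k))) :=
              dyadic_row_ge hα0 hα1 γ h1 (by linarith) hb0 hby hk1 hk2.le hΓ.le hDg
          _ ≤ w k * (coef α b t n 0 * B k 0 + Real.Gamma (1 - α) * deltaAlik α t (B k) (n + 1)
              - 2 * wNext α b t 0 * B k 2) := mul_le_mul_of_nonneg_left (hrow k) (hw0 k)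
          _ ≤ _ := Finset.single_le_sum (f := fun k => w k * (coef α b t n 0 * B k 0
              + Real.Gamma (1 - α) * deltaAlik α t (B k) (n + 1) - 2 * wNext α b t 0 * B k 2))
              (fun k _ => mul_nonneg (hw0 k) (le_trans (by positivity) (hrow k)))
              (Finset.mem_range.2 hkm)
    · refine (hinit (n + 1) (by omega) hjJ (by omega)).trans ?_
      have hle : t (n + 1) ≤ C * (t 1 * (J : ℝ) ^ r) := by
        refine (hsize (n + 1) (by omega) (by omega)).2.trans ?_
        gcongr
      set L := C * (J : ℝ) ^ r + K with hL
      have hL0 : 0 < L := by positivity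
      have hbar : L ^ (α - 1) * t 1 ^ (α - 1) ≤ bar α (K * t 1) (t (n + 1)) := by
        rw [← mul_rpow hL0.le h1.le]
        refine rpow_le_rpow_of_nonpos (by positivity) ?_ (by linarith)
        rw [hL]; linarith
      have hcancel : L ^ (1 - α) * L ^ (α - 1) = 1 := by
        rw [← rpow_add hL0]; simp
      calc D0 * t 1 ^ α = D0 * L ^ (1 - α) * t 1 * (L ^ (α - 1) * t 1 ^ (α - 1)) := by
            rw [show t 1 ^ α = t 1 ^ (α - 1) * t 1 by
              rw [← rpow_add_one h1.ne']; congr 1; ring]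
            linear_combination (-(D0 * t 1 ^ (α - 1) * t 1)) * hcancel
        _ ≤ D * t 1 * bar α (K * t 1) (t (n + 1)) := by gcongr
        _ ≤ _ := by
            gcongr
            exact bar_le_dyadicBar hK0.le h1.le htj.le m

end Final

end Alikhanov

/-- Stability of the Alikhanov discrete fractional-derivative operator on
quasi-graded meshes with `1 ≤ r ≤ (3-α)/α` satisfying the Alikhanov mesh
condition (Theorem 4.2(i)). -/
theorem stmt16 (α r γ T c0 C0 : ℝ)
    (hα0 : 0 < α) (hα1 : α < 1)
    (hr1 : 1 ≤ r) (hr2 : r ≤ (3 - α) / α)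
    (hT : 0 < T) (hc0 : 0 < c0) (hcC : c0 ≤ C0) :
    ∃ C : ℝ, 0 < C ∧
      ∀ (M : ℕ) (t : ℕ → ℝ), IsMesh T M t → QuasiGraded r c0 C0 M t →
        AlikhanovCond M t →
        ∀ V : ℕ → ℝ, V 0 = 0 →
          (∀ j : ℕ, 1 ≤ j → j ≤ M → |deltaAlik α t V j| ≤ (t 1 / t j) ^ (γ + 1)) →
          ∀ j : ℕ, 1 ≤ j → j ≤ M → |V j| ≤ C * Vcal α γ (t 1) (t j) := by
  have hC0 : 0 < C0 := hc0.trans_le hcC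
  set R := C0 / c0 * 2 ^ r with hRdef
  have hR : 1 ≤ R := by
    have h1 : 1 ≤ C0 / c0 := by rwa [one_le_div hc0]
    have h2 : (1 : ℝ) ≤ 2 ^ r := one_le_rpow (by norm_num) (by linarith)
    exact one_le_mul_of_one_le_of_one_le h1 h2
  set e := |2 * Alikhanov.errConst α r c0 C0 R| with he
  set K := 11 * R + e ^ (1 / α) with hKdef
  have hK : 11 * R ≤ K := le_add_of_nonneg_right (by positivity)
  have hK0 : 0 < K := by linarith
  have hKe : 2 * Alikhanov.errConst α r c0 C0 R ≤ K ^ α := by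
    calc 2 * Alikhanov.errConst α r c0 C0 R ≤ e := le_abs_self _
      _ = (e ^ (1 / α)) ^ α := by
          rw [← rpow_mul (abs_nonneg _), one_div_mul_cancel hα0.ne', rpow_one]
      _ ≤ K ^ α := rpow_le_rpow (by positivity) (le_add_of_nonneg_left (by positivity)) hα0.le
  set J := ⌈22 * R / c0⌉₊ + 2 with hJdef
  have hJR : 22 * R ≤ c0 * J := by
    have := Nat.le_ceil (22 * R / c0)
    rw [div_le_iff₀ hc0] at this
    rw [hJdef]
    push_cast
    linarith
  obtain ⟨D0, hD0, hinit⟩ := Alikhanov.exists_initial_bound (r := r) (c := c0) hα0 hα1 γ hC0.le hR J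
  obtain ⟨G, hG0, hG⟩ := Alikhanov.exists_dyadic_sum_le γ
  have hΓ := Real.Gamma_pos_of_pos (by linarith : 0 < 1 - α)
  set D1 := 24 * K * Real.Gamma (1 - α) * 2 ^ |γ + 1| with hD1
  set D2 := D0 * (C0 * (J : ℝ) ^ r + K) ^ (1 - α) with hD2
  have hD1p : 0 < D1 := by positivity
  have hD2p : 0 ≤ D2 := by positivity
  refine ⟨(D1 + D2) * G, by positivity, fun M t hm hq hM V hV hf N hN1 hNM => ?_⟩
  have hGr := fun n (hn : n + 1 ≤ M) => Alikhanov.quasiGraded_graded hr1 hc0 hcC hm hq hn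
  have h1 : 0 < t 1 := (hGr 0 (by omega)).pos (i := 0) le_rfl
  have hle : t 1 ≤ t N := Alikhanov.le_of_step (hGr (N - 1) (by omega)).step hN1 (by omega)
  have htN : 0 < t N := h1.trans_le hle
  obtain ⟨m, hm1, hm2⟩ := exists_nat_pow_near
    (by rwa [one_le_div h1] : 1 ≤ t N / t 1) (one_lt_two : (1 : ℝ) < 2)
  have key := Alikhanov.abs_le_dyadicBar (D := D1 + D2) hα0 hα1 hr1 hr2 hc0 hC0.le hR hK hKe
    (by omega) hJR (by linarith) (by linarith) hM hGr hq.2.1 hV hf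
    (hinit M t V hGr (fun j h h' => (hq.2.1 j h h').2) hV hf) hNM hm2 N hN1 le_rfl
  have hbar := Alikhanov.dyadicBar_le (γ := γ) hα1 hK0.le h1.le htN m
  have hsum := hG m _ hm1
  have hvcal : Vcal α γ (t 1) (t N) = t 1 * (t N ^ (α - 1) *
      (if 0 < γ then 1 else if γ = 0 then 1 + Real.log (t N / t 1) else (t N / t 1) ^ (-γ))) := by
    unfold Vcal
    split_ifs
    · ring
    · ring
    · rw [rpow_neg (by positivity), ← inv_rpow (by positivity), inv_div]; ring
  rw [hvcal]
  calc |V N| ≤ _ := key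
    _ ≤ (D1 + D2) * t 1 * (t N ^ (α - 1) * (G * (if 0 < γ then 1 else if γ = 0 then
        1 + Real.log (t N / t 1) else (t N / t 1) ^ (-γ)))) := by
        refine mul_le_mul_of_nonneg_left (hbar.trans ?_) (by positivity)
        exact mul_le_mul_of_nonneg_left hsum (by positivity)
    _ = _ := by ring
end

section
/- Let α ∈ (0,1) and let r satisfy 1 ≤ r ≤ (3−α)/α. Let the temporal mesh be quasi-graded with parameter r and constants c_0 ≤ C_0, and satisfy the Alikhanov mesh condition. Then there exist constants c, C > 0, depending only on α, r, T, c_0, C_0, and a real sequence B^0,...,B^M such that B^0 = 0, 0 ≤ B^j ≤ C t_j^{α−1} for all j = 1,...,M, and δ_t^{α,*} B^j ≥ c τ^α t_j^{−α−1} for all j = 1,...,M. -/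
open Real MeasureTheory Set

/-- Derivative of the quadratic Lagrange interpolant. -/
noncomputable def lagQuadDeriv (x0 x1 x2 y0 y1 y2 s : ℝ) : ℝ :=
  y0 * ((s - x2) + (s - x1)) / ((x0 - x1) * (x0 - x2)) +
  y1 * ((s - x2) + (s - x0)) / ((x1 - x0) * (x1 - x2)) +
  y2 * ((s - x1) + (s - x0)) / ((x2 - x0) * (x2 - x1))

/-- Second derivative of the quadratic Lagrange interpolant. -/
noncomputable def lagQuadDeriv2 (x0 x1 x2 y0 y1 y2 : ℝ) : ℝ :=
  y0 * 2 / ((x0 - x1) * (x0 - x2)) + y1 * 2 / ((x1 - x0) * (x1 - x2)) +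
  y2 * 2 / ((x2 - x0) * (x2 - x1))

lemma hasDerivAt_mul_sub (u v s : ℝ) :
    HasDerivAt (fun x => (x - u) * (x - v)) ((s - v) + (s - u)) s := by
  exact (((hasDerivAt_id s).sub_const u).mul ((hasDerivAt_id s).sub_const v)).congr_deriv
    (by simp)

lemma hasDerivAt_lagQuad (x0 x1 x2 y0 y1 y2 s : ℝ) :
    HasDerivAt (lagQuad x0 x1 x2 y0 y1 y2) (lagQuadDeriv x0 x1 x2 y0 y1 y2 s) s := by
  unfold lagQuad lagQuadDeriv
  exact ((((hasDerivAt_mul_sub x1 x2 s).const_mul y0).div_const _).add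
    (((hasDerivAt_mul_sub x0 x2 s).const_mul y1).div_const _)).add
    (((hasDerivAt_mul_sub x0 x1 s).const_mul y2).div_const _)

lemma hasDerivAt_lagQuadDeriv (x0 x1 x2 y0 y1 y2 s : ℝ) :
    HasDerivAt (lagQuadDeriv x0 x1 x2 y0 y1 y2) (lagQuadDeriv2 x0 x1 x2 y0 y1 y2) s := by
  have key : ∀ u v : ℝ, HasDerivAt (fun x : ℝ => (x - v) + (x - u)) 2 s := fun u v => by
    have := ((hasDerivAt_id s).sub_const v).add ((hasDerivAt_id s).sub_const u)
    norm_num at this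
    exact this
  unfold lagQuadDeriv lagQuadDeriv2
  exact ((((key x1 x2).const_mul y0).div_const _).add
    (((key x0 x2).const_mul y1).div_const _)).add (((key x0 x1).const_mul y2).div_const _)

lemma lagQuad_left {x0 x1 x2 : ℝ} (y0 y1 y2 : ℝ) (h01 : x0 < x1) (h12 : x1 < x2) :
    lagQuad x0 x1 x2 y0 y1 y2 x0 = y0 := by
  have h1 : x0 - x1 ≠ 0 := by linarith
  have h2 : x0 - x2 ≠ 0 := by linarith
  unfold lagQuad
  field_simp
  ring

lemma lagQuad_mid {x0 x1 x2 : ℝ} (y0 y1 y2 : ℝ) (h01 : x0 < x1) (h12 : x1 < x2) :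
    lagQuad x0 x1 x2 y0 y1 y2 x1 = y1 := by
  have h1 : x1 - x0 ≠ 0 := by linarith
  have h2 : x1 - x2 ≠ 0 := by linarith
  unfold lagQuad
  field_simp
  ring

lemma lagQuad_right {x0 x1 x2 : ℝ} (y0 y1 y2 : ℝ) (h01 : x0 < x1) (h12 : x1 < x2) :
    lagQuad x0 x1 x2 y0 y1 y2 x2 = y2 := by
  have h1 : x2 - x0 ≠ 0 := by linarith
  have h2 : x2 - x1 ≠ 0 := by linarith
  unfold lagQuad
  field_simp
  ring

/-- Iterated Rolle theorem: a function with four zeros has a zero of its third derivative. -/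
lemma exists_third_deriv_eq_zero {g g1 g2 g3 : ℝ → ℝ} {a b c d : ℝ} (hab : a < b) (hbc : b < c)
    (hcd : c < d) (ha : g a = 0) (hb : g b = 0) (hc : g c = 0) (hd : g d = 0)
    (h1 : ∀ x ∈ Icc a d, HasDerivAt g (g1 x) x)
    (h2 : ∀ x ∈ Icc a d, HasDerivAt g1 (g2 x) x)
    (h3 : ∀ x ∈ Icc a d, HasDerivAt g2 (g3 x) x) :
    ∃ z ∈ Icc a d, g3 z = 0 := by
  have rolle : ∀ (u u1 : ℝ → ℝ) (p q : ℝ), a ≤ p → p < q → q ≤ d → u p = u q →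
      (∀ x ∈ Icc a d, HasDerivAt u (u1 x) x) → ∃ z ∈ Ioo p q, u1 z = 0 := by
    intro u u1 p q hap hpq hqd he hu
    refine exists_hasDerivAt_eq_zero hpq (fun x hx => ?_) he
      (fun x hx => hu x ⟨hap.trans hx.1.le, hx.2.le.trans hqd⟩)
    exact (hu x ⟨hap.trans hx.1, hx.2.trans hqd⟩).continuousAt.continuousWithinAt
  obtain ⟨p, hp, hp0⟩ := rolle g g1 a b le_rfl hab (by linarith) (by rw [ha, hb]) h1
  obtain ⟨q, hq, hq0⟩ := rolle g g1 b c hab.le hbc (by linarith) (by rw [hb, hc]) h1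
  obtain ⟨w, hw, hw0⟩ := rolle g g1 c d (by linarith) hcd le_rfl (by rw [hc, hd]) h1
  obtain ⟨hp1, hp2⟩ := hp
  obtain ⟨hq1, hq2⟩ := hq
  obtain ⟨hw1, hw2⟩ := hw
  obtain ⟨v, hv, hv0⟩ := rolle g1 g2 p q (by linarith) (by linarith) (by linarith)
    (by rw [hp0, hq0]) h2
  obtain ⟨y, hy, hy0⟩ := rolle g1 g2 q w (by linarith) (by linarith) (by linarith)
    (by rw [hq0, hw0]) h2
  obtain ⟨hv1, hv2⟩ := hv
  obtain ⟨hy1, hy2⟩ := hy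
  obtain ⟨z, hz, hz0⟩ := rolle g2 g3 v y (by linarith) (by linarith) (by linarith)
    (by rw [hv0, hy0]) h3
  exact ⟨z, ⟨by linarith [hz.1], by linarith [hz.2]⟩, hz0⟩

/-- Error bound for quadratic Lagrange interpolation on the first subinterval. -/
lemma abs_lagQuad_sub_le {f f1 f2 f3 : ℝ → ℝ} {x0 x1 x2 K s : ℝ} (h01 : x0 < x1) (h12 : x1 < x2)
    (h1 : ∀ x ∈ Icc x0 x2, HasDerivAt f (f1 x) x)
    (h2 : ∀ x ∈ Icc x0 x2, HasDerivAt f1 (f2 x) x)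
    (h3 : ∀ x ∈ Icc x0 x2, HasDerivAt f2 (f3 x) x)
    (hK : ∀ x ∈ Icc x0 x2, |f3 x| ≤ K) (hs : s ∈ Icc x0 x1) :
    |lagQuad x0 x1 x2 (f x0) (f x1) (f x2) s - f s| ≤
      K / 6 * ((s - x0) * (x1 - s) * (x2 - s)) := by
  have hK0 : 0 ≤ K := (abs_nonneg _).trans (hK x0 ⟨le_rfl, (h01.trans h12).le⟩)
  obtain rfl | hs0 := hs.1.eq_or_lt
  · simp [lagQuad_left _ _ _ h01 h12]
  obtain rfl | hs1 := hs.2.eq_or_lt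
  · simp [lagQuad_mid _ _ _ h01 h12]
  have hs2 : s < x2 := hs1.trans h12
  have hw : 0 < (s - x0) * (x1 - s) * (x2 - s) :=
    mul_pos (mul_pos (by linarith) (by linarith)) (by linarith)
  set Q := lagQuad x0 x1 x2 (f x0) (f x1) (f x2) with hQ
  set l := (f s - Q s) / ((s - x0) * (x1 - s) * (x2 - s)) with hl
  have hls : l * ((s - x0) * (x1 - s) * (x2 - s)) = f s - Q s := by
    rw [hl, div_mul_cancel₀ _ hw.ne']
  have hw1 : ∀ x, HasDerivAt (fun x => (x - x0) * (x - x1) * (x - x2))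
      (((x - x1) + (x - x0)) * (x - x2) + (x - x0) * (x - x1)) x := fun x => by
    exact ((hasDerivAt_mul_sub x0 x1 x).mul ((hasDerivAt_id x).sub_const x2)).congr_deriv
      (by simp)
  have hw2 : ∀ x, HasDerivAt (fun x => ((x - x1) + (x - x0)) * (x - x2) + (x - x0) * (x - x1))
      (6 * x - 2 * (x0 + x1 + x2)) x := fun x => by
    have := (((((hasDerivAt_id x).sub_const x1).add ((hasDerivAt_id x).sub_const x0)).mul
      ((hasDerivAt_id x).sub_const x2))).add (hasDerivAt_mul_sub x0 x1 x)
    refine this.congr_deriv ?_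
    simp
    ring
  have hw3 : ∀ x, HasDerivAt (fun x : ℝ => 6 * x - 2 * (x0 + x1 + x2)) 6 x := fun x => by
    simpa using ((hasDerivAt_id x).const_mul 6).sub_const (2 * (x0 + x1 + x2))
  obtain ⟨z, hz, hz0⟩ := exists_third_deriv_eq_zero
    (g := fun x => f x - Q x - l * ((x - x0) * (x - x1) * (x - x2)))
    (g1 := fun x => f1 x - lagQuadDeriv x0 x1 x2 (f x0) (f x1) (f x2) x -
      l * (((x - x1) + (x - x0)) * (x - x2) + (x - x0) * (x - x1)))
    (g2 := fun x => f2 x - lagQuadDeriv2 x0 x1 x2 (f x0) (f x1) (f x2) -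
      l * (6 * x - 2 * (x0 + x1 + x2)))
    (g3 := fun x => f3 x - l * 6)
    hs0 hs1 h12
    (by simp [hQ, lagQuad_left _ _ _ h01 h12])
    (by linear_combination -hls)
    (by simp [hQ, lagQuad_mid _ _ _ h01 h12])
    (by simp [hQ, lagQuad_right _ _ _ h01 h12])
    (fun x hx => ((h1 x hx).sub (hasDerivAt_lagQuad _ _ _ _ _ _ x)).sub ((hw1 x).const_mul l))
    (fun x hx => ((h2 x hx).sub (hasDerivAt_lagQuadDeriv _ _ _ _ _ _ x)).sub
      ((hw2 x).const_mul l))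
    (fun x hx => ((h3 x hx).sub_const _).sub ((hw3 x).const_mul l))
  have hl6 : l = f3 z / 6 := by linarith
  rw [abs_sub_comm, ← hls, abs_mul, abs_of_pos hw, hl6, abs_div, abs_of_pos (by norm_num : (0:ℝ) < 6)]
  have := hK z hz
  gcongr

/-- The difference quotient differs from the first-order expansion of the derivative about the
midpoint by a second-order quantity. -/
lemma abs_slope_sub_deriv_le {f f1 f2 f3 : ℝ → ℝ} {a b K s : ℝ} (hab : a < b)
    (h1 : ∀ x ∈ Icc a b, HasDerivAt f (f1 x) x)
    (h2 : ∀ x ∈ Icc a b, HasDerivAt f1 (f2 x) x)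
    (h3 : ∀ x ∈ Icc a b, HasDerivAt f2 (f3 x) x)
    (hK : ∀ x ∈ Icc a b, |f3 x| ≤ K) (hs : s ∈ Icc a b) :
    |(f b - f a) / (b - a) - f1 s + f2 ((a + b) / 2) * (s - (a + b) / 2)| ≤ K * (b - a) ^ 2 := by
  have hK0 : 0 ≤ K := (abs_nonneg _).trans (hK a ⟨le_rfl, hab.le⟩)
  set m := (a + b) / 2 with hm
  have hmI : m ∈ Icc a b := ⟨by linarith, by linarith⟩
  have hdist : ∀ x ∈ Icc a b, ∀ y ∈ Icc a b, |y - x| ≤ b - a := fun x hx y hy => by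
    rw [abs_le]; constructor <;> linarith [hx.1, hx.2, hy.1, hy.2]
  have hf2 : ∀ x ∈ Icc a b, |f2 x - f2 m| ≤ K * (b - a) := fun x hx => by
    refine ((convex_Icc a b).norm_image_sub_le_of_norm_hasDerivWithin_le
      (fun y hy => (h3 y hy).hasDerivWithinAt) hK hmI hx).trans ?_
    exact mul_le_mul_of_nonneg_left (hdist m hmI x hx) hK0
  have hg1 : ∀ x, HasDerivAt (fun x => f2 m * (x - m)) (f2 m) x := fun x => by
    simpa using ((hasDerivAt_id x).sub_const m).const_mul (f2 m)
  have hg0 : ∀ x, HasDerivAt (fun x => f2 m / 2 * ((x - m) * (x - m))) (f2 m * (x - m)) x :=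
    fun x => ((hasDerivAt_mul_sub m m x).const_mul (f2 m / 2)).congr_deriv (by ring)
  obtain ⟨c, hc, hceq⟩ := exists_hasDerivAt_eq_slope
    (fun x => f x - f2 m / 2 * ((x - m) * (x - m))) (fun x => f1 x - f2 m * (x - m)) hab
    (fun x hx => ((h1 x hx).sub (hg0 x)).continuousAt.continuousWithinAt)
    (fun x hx => (h1 x ⟨hx.1.le, hx.2.le⟩).sub (hg0 x))
  have hslope : (f b - f a) / (b - a) = f1 c - f2 m * (c - m) := by
    rw [hceq]
    congr 1
    rw [hm]
    ring
  have hcI : c ∈ Icc a b := ⟨hc.1.le, hc.2.le⟩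
  have := (convex_Icc a b).norm_image_sub_le_of_norm_hasDerivWithin_le
    (f := fun x => f1 x - f2 m * (x - m))
    (fun y hy => ((h2 y hy).sub (hg1 y)).hasDerivWithinAt) hf2 hs hcI
  rw [Real.norm_eq_abs, Real.norm_eq_abs] at this
  rw [hslope]
  calc |f1 c - f2 m * (c - m) - f1 s + f2 m * (s - m)|
      = |f1 c - f2 m * (c - m) - (f1 s - f2 m * (s - m))| := by ring_nf
    _ ≤ K * (b - a) * |c - s| := this
    _ ≤ K * (b - a) * (b - a) := by
        have := hdist s hs c hcI
        have : 0 ≤ b - a := by linarith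
        gcongr
    _ = K * (b - a) ^ 2 := by ring

lemma intervalIntegrable_kernel {α : ℝ} (hα1 : α < 1) (z a b : ℝ) :
    IntervalIntegrable (fun s => (z - s) ^ (-α)) volume a b := by
  have := (intervalIntegral.intervalIntegrable_rpow' (a := z - a) (b := z - b)
    (by linarith : -1 < -α)).comp_sub_left z
  simpa using this

lemma integral_kernel {α : ℝ} (hα1 : α < 1) (a z : ℝ) :
    ∫ s in a..z, (z - s) ^ (-α) = (z - a) ^ (1 - α) / (1 - α) := by
  rw [intervalIntegral.integral_comp_sub_left (fun x => x ^ (-α)) z,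
    integral_rpow (Or.inl (by linarith)), sub_self, Real.zero_rpow (by linarith)]
  ring_nf

/-- The kernel is orthogonal to the centred linear function on the truncated last interval. -/
lemma integral_kernel_mul_sub_midpoint {α a b z : ℝ} (hα0 : 0 < α) (hα1 : α < 1) (hab : a < b)
    (hz : z = b - α / 2 * (b - a)) :
    ∫ s in a..z, (z - s) ^ (-α) * (s - (a + b) / 2) = 0 := by
  have haz : 0 < z - a := by rw [hz]; nlinarith
  have h1 : ∀ s ∈ uIcc a z, (z - s) ^ (-α) * (s - (a + b) / 2) =
      (z - (a + b) / 2) * (z - s) ^ (-α) - (z - s) ^ (1 - α) := by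
    intro s hs
    rw [uIcc_of_le (by linarith)] at hs
    have : (z - s) ^ (1 - α) = (z - s) ^ (-α) * (z - s) := by
      obtain h | h := (sub_nonneg.2 hs.2).eq_or_lt
      · rw [← h, Real.zero_rpow (by linarith), mul_zero]
      · rw [← Real.rpow_add_one h.ne']
        ring_nf
    rw [this]
    ring
  have h_int : IntervalIntegrable (fun s => (z - s) ^ (1 - α)) volume a z := by
    have := intervalIntegrable_kernel (α := α - 1) (by linarith) z a z
    simpa using this
  have h2 : ∫ s in a..z, (z - s) ^ (1 - α) = (z - a) ^ (2 - α) / (2 - α) := by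
    have := integral_kernel (α := α - 1) (by linarith) a z
    rwa [show -(α - 1) = 1 - α by ring, show 1 - (α - 1) = 2 - α by ring] at this
  rw [intervalIntegral.integral_congr h1, intervalIntegral.integral_sub
    ((intervalIntegrable_kernel hα1 z a z).const_mul _) h_int,
    intervalIntegral.integral_const_mul, integral_kernel hα1, h2]
  have h3 : (z - a) ^ (2 - α) = (z - a) ^ (1 - α) * (z - a) := by
    rw [← Real.rpow_add_one haz.ne']
    ring_nf
  have h4 : 1 - α ≠ 0 := by linarith
  have h5 : 2 - α ≠ 0 := by linarith
  rw [h3]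
  field_simp
  rw [hz]
  ring

lemma hasDerivAt_kernel {α z s : ℝ} (hs : s < z) :
    HasDerivAt (fun s => (z - s) ^ (-α)) (α * (z - s) ^ (-α - 1)) s := by
  have h := ((hasDerivAt_id s).const_sub z).rpow_const (p := -α) (Or.inl (sub_pos.2 hs).ne')
  refine h.congr_deriv ?_
  simp

lemma continuousOn_kernel_deriv {α z q : ℝ} (p : ℝ) (hq : q < z) :
    ContinuousOn (fun s => (z - s) ^ (-α - 1)) (Icc p q) := by
  refine ContinuousOn.rpow_const (by fun_prop) fun s hs => Or.inl ?_
  linarith [hs.2]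

lemma integral_kernel_deriv_le {α p q z : ℝ} (hpq : p ≤ q) (hq : q < z) :
    α * ∫ s in p..q, (z - s) ^ (-α - 1) ≤ (z - q) ^ (-α) := by
  have h := intervalIntegral.integral_eq_sub_of_hasDerivAt_of_le (a := p) (b := q)
    (f := fun s => (z - s) ^ (-α)) (f' := fun s => α * (z - s) ^ (-α - 1)) hpq
    (fun s hs => (hasDerivAt_kernel (lt_of_le_of_lt hs.2 hq)).continuousAt.continuousWithinAt)
    (fun s hs => hasDerivAt_kernel (hs.2.trans hq))
    (((continuousOn_kernel_deriv p hq).const_mul α).intervalIntegrable_of_Icc hpq)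
  rw [intervalIntegral.integral_const_mul] at h
  rw [h]
  have : 0 ≤ (z - p) ^ (-α) := Real.rpow_nonneg (by linarith) _
  linarith

/-- Integration by parts against the kernel for a function vanishing at both endpoints. -/
lemma integral_kernel_mul_deriv {α p q z : ℝ} {e e1 : ℝ → ℝ} (hpq : p ≤ q) (hq : q < z)
    (he : ∀ x ∈ Icc p q, HasDerivAt e (e1 x) x) (he1 : ContinuousOn e1 (Icc p q))
    (hp0 : e p = 0) (hq0 : e q = 0) :
    ∫ s in p..q, (z - s) ^ (-α) * e1 s = -(α * ∫ s in p..q, (z - s) ^ (-α - 1) * e s) := by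
  rw [intervalIntegral.integral_mul_deriv_eq_deriv_mul (u := fun s => (z - s) ^ (-α))
    (u' := fun s => α * (z - s) ^ (-α - 1)) (v := e)
    (fun s hs => hasDerivAt_kernel (lt_of_le_of_lt (by rw [uIcc_of_le hpq] at hs; exact hs.2) hq))
    (by rwa [uIcc_of_le hpq])
    (((continuousOn_kernel_deriv p hq).const_mul α).intervalIntegrable_of_Icc hpq)
    (he1.intervalIntegrable_of_Icc hpq), hp0, hq0, ← intervalIntegral.integral_const_mul]
  simp [mul_assoc]

/-- Truncation error of the linear interpolant on the last interval. -/
lemma abs_integral_slope_sub_deriv_le {f f1 f2 f3 : ℝ → ℝ} {α a b z K : ℝ} (hα0 : 0 < α)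
    (hα1 : α < 1) (hab : a < b) (hz : z = b - α / 2 * (b - a))
    (h1 : ∀ x ∈ Icc a b, HasDerivAt f (f1 x) x)
    (h2 : ∀ x ∈ Icc a b, HasDerivAt f1 (f2 x) x)
    (h3 : ∀ x ∈ Icc a b, HasDerivAt f2 (f3 x) x)
    (hK : ∀ x ∈ Icc a b, |f3 x| ≤ K) :
    |(∫ s in a..z, (z - s) ^ (-α) * ((f b - f a) / (b - a))) -
      ∫ s in a..z, (z - s) ^ (-α) * f1 s| ≤ K * (b - a) ^ (3 - α) / (1 - α) := by
  have hK0 : 0 ≤ K := (abs_nonneg _).trans (hK a ⟨le_rfl, hab.le⟩)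
  have haz : a < z := by rw [hz]; nlinarith
  have hzb : z ≤ b := by rw [hz]; nlinarith
  have hk := intervalIntegrable_kernel hα1 z a z
  have hf1 : ContinuousOn f1 (uIcc a z) := fun x hx => by
    rw [uIcc_of_le haz.le] at hx
    exact (h2 x ⟨hx.1, hx.2.trans hzb⟩).continuousAt.continuousWithinAt
  set m := (a + b) / 2 with hm
  have hI1 : IntervalIntegrable (fun s => (z - s) ^ (-α) * ((f b - f a) / (b - a)))
    volume a z := hk.mul_const _
  have hI2 : IntervalIntegrable (fun s => (z - s) ^ (-α) * f1 s) volume a z :=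
    hk.mul_continuousOn hf1
  have hI3 : IntervalIntegrable (fun s => f2 m * ((z - s) ^ (-α) * (s - m))) volume a z :=
    (hk.mul_continuousOn (by fun_prop)).const_mul _
  have hsplit : (∫ s in a..z, (z - s) ^ (-α) * ((f b - f a) / (b - a))) -
      ∫ s in a..z, (z - s) ^ (-α) * f1 s =
      ∫ s in a..z, (z - s) ^ (-α) * ((f b - f a) / (b - a) - f1 s + f2 m * (s - m)) := by
    have h0 : ∫ s in a..z, f2 m * ((z - s) ^ (-α) * (s - m)) = 0 := by
      rw [intervalIntegral.integral_const_mul,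
        integral_kernel_mul_sub_midpoint hα0 hα1 hab hz, mul_zero]
    rw [← intervalIntegral.integral_sub hI1 hI2, ← add_zero (∫ s in a..z, _), ← h0,
      ← intervalIntegral.integral_add (hI1.sub hI2) hI3]
    congr 1
    ext s
    ring
  rw [hsplit]
  have hbound : ∀ᵐ s, s ∈ Ioc a z →
      ‖(z - s) ^ (-α) * ((f b - f a) / (b - a) - f1 s + f2 m * (s - m))‖ ≤
        (z - s) ^ (-α) * (K * (b - a) ^ 2) := by
    refine Filter.Eventually.of_forall fun s hs => ?_
    have hz0 : 0 ≤ (z - s) ^ (-α) := Real.rpow_nonneg (by linarith [hs.2]) _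
    rw [Real.norm_eq_abs, abs_mul, abs_of_nonneg hz0]
    exact mul_le_mul_of_nonneg_left
      (abs_slope_sub_deriv_le hab h1 h2 h3 hK ⟨hs.1.le, hs.2.trans hzb⟩) hz0
  refine (intervalIntegral.norm_integral_le_of_norm_le haz.le hbound (hk.mul_const _)).trans ?_
  have hba : 0 < b - a := by linarith
  have hpow : (b - a) ^ (3 - α) = (b - a) ^ (1 - α) * (b - a) ^ 2 := by
    rw [← Real.rpow_natCast (b - a) 2, ← Real.rpow_add hba]
    norm_num
    ring_nf
  have hle : (z - a) ^ (1 - α) ≤ (b - a) ^ (1 - α) :=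
    Real.rpow_le_rpow (by linarith) (by linarith) (by linarith)
  rw [intervalIntegral.integral_mul_const, integral_kernel hα1, hpow]
  have h1α : 0 < 1 - α := by linarith
  calc (z - a) ^ (1 - α) / (1 - α) * (K * (b - a) ^ 2)
      ≤ (b - a) ^ (1 - α) / (1 - α) * (K * (b - a) ^ 2) := by gcongr
    _ = _ := by ring

/-- Truncation error of the Alikhanov operator: `Φ` majorizes the interpolation error weighted by
the derivative of the kernel, and `K` bounds the third derivative on the last interval. -/
lemma abs_deltaAlik_sub_le {α K : ℝ} {t : ℕ → ℝ} {n : ℕ} {f f1 f2 f3 Φ : ℝ → ℝ}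
    (hα0 : 0 < α) (hα1 : α < 1) (ht : ∀ j ≤ n, t j < t (j + 1))
    (h1 : ∀ x ∈ Icc (t 0) (t (n + 1)), HasDerivAt f (f1 x) x)
    (h2 : ∀ x ∈ Icc (t 0) (t (n + 1)), HasDerivAt f1 (f2 x) x)
    (h3 : ∀ x ∈ Icc (t 0) (t (n + 1)), HasDerivAt f2 (f3 x) x)
    (hK : ∀ x ∈ Icc (t n) (t (n + 1)), |f3 x| ≤ K)
    (hΦc : ContinuousOn Φ (Icc (t 0) (t n)))
    (hΦ : ∀ j < n, ∀ s ∈ Icc (t j) (t (j + 1)),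
      (tStar α t (n + 1) - s) ^ (-α - 1) *
        |lagQuad (t j) (t (j + 1)) (t (j + 2)) (f (t j)) (f (t (j + 1))) (f (t (j + 2))) s - f s|
        ≤ Φ s) :
    |Real.Gamma (1 - α) * deltaAlik α t (fun j => f (t j)) (n + 1) -
      ∫ s in (t 0)..(tStar α t (n + 1)), (tStar α t (n + 1) - s) ^ (-α) * f1 s| ≤
      α * (∫ s in (t 0)..(t n), Φ s) + K * (t (n + 1) - t n) ^ (3 - α) / (1 - α) := by
  have hmono : ∀ j k, j ≤ k → k ≤ n + 1 → t j ≤ t k := by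
    intro j k hjk
    induction k, hjk using Nat.le_induction with
    | base => exact fun _ => le_rfl
    | succ k _ ih => exact fun hk => (ih (by omega)).trans (ht k (by omega)).le
  have hlast := ht n le_rfl
  set z := tStar α t (n + 1) with hz
  have hz' : z = t (n + 1) - α / 2 * (t (n + 1) - t n) := rfl
  have hnz : t n < z := by rw [hz']; nlinarith
  have hzn : z ≤ t (n + 1) := by rw [hz']; nlinarith
  have hf1c : ContinuousOn f1 (Icc (t 0) (t (n + 1))) := fun x hx =>
    (h2 x hx).continuousAt.continuousWithinAt
  have hI : ∀ a b, t 0 ≤ a → a ≤ b → b ≤ t (n + 1) →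
      IntervalIntegrable (fun s => (z - s) ^ (-α) * f1 s) volume a b := fun a b ha hab hb =>
    (intervalIntegrable_kernel hα1 z a b).mul_continuousOn
      (hf1c.mono (by rw [uIcc_of_le hab]; exact Icc_subset_Icc ha hb))
  have hpiece : ∀ k ≤ n,
      |(∑ j ∈ Finset.Icc 1 k, ∫ s in (t (j - 1))..(t j), (z - s) ^ (-α) * deriv (fun x =>
          lagQuad (t (j - 1)) (t j) (t (j + 1)) (f (t (j - 1))) (f (t j)) (f (t (j + 1))) x) s) -
        ∫ s in (t 0)..(t k), (z - s) ^ (-α) * f1 s| ≤ α * ∫ s in (t 0)..(t k), Φ s := by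
    intro k
    induction k with
    | zero => simp
    | succ k ih =>
      intro hk
      have ih := ih (by omega)
      have hk1 := ht k (by omega)
      have hk2 := ht (k + 1) (by omega)
      have h0k := hmono 0 k (by omega) (by omega)
      have hkn : t (k + 2) ≤ t (n + 1) := hmono (k + 2) (n + 1) (by omega) le_rfl
      have hkn' : t (k + 1) ≤ t n := hmono (k + 1) n (by omega) (by omega)
      have hΦI : ∀ a b, t 0 ≤ a → a ≤ b → b ≤ t n → IntervalIntegrable Φ volume a b :=
        fun a b ha hab hb =>
          (hΦc.mono (Icc_subset_Icc ha hb)).intervalIntegrable_of_Icc hab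
      set Q := lagQuad (t k) (t (k + 1)) (t (k + 2)) (f (t k)) (f (t (k + 1))) (f (t (k + 2)))
        with hQ
      set Q1 := lagQuadDeriv (t k) (t (k + 1)) (t (k + 2)) (f (t k)) (f (t (k + 1)))
        (f (t (k + 2))) with hQ1
      have hQd : ∀ x, HasDerivAt Q (Q1 x) x := fun x => hasDerivAt_lagQuad _ _ _ _ _ _ x
      have hQ1c : Continuous Q1 := continuous_iff_continuousAt.2 fun x =>
        (hasDerivAt_lagQuadDeriv _ _ _ _ _ _ x).continuousAt
      have hsub : Icc (t k) (t (k + 1)) ⊆ Icc (t 0) (t (n + 1)) :=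
        Icc_subset_Icc h0k (by linarith)
      have hnew : |(∫ s in (t k)..(t (k + 1)), (z - s) ^ (-α) * deriv (fun x => Q x) s) -
          ∫ s in (t k)..(t (k + 1)), (z - s) ^ (-α) * f1 s| ≤
          α * ∫ s in (t k)..(t (k + 1)), Φ s := by
        have hd : (fun s => (z - s) ^ (-α) * deriv (fun x => Q x) s) =
            fun s => (z - s) ^ (-α) * Q1 s := by
          ext s
          rw [(hQd s).deriv]
        rw [hd, ← intervalIntegral.integral_sub
          ((intervalIntegrable_kernel hα1 z _ _).mul_continuousOn hQ1c.continuousOn)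
          (hI _ _ h0k hk1.le (by linarith))]
        simp_rw [← mul_sub]
        rw [integral_kernel_mul_deriv (e := fun s => Q s - f s) hk1.le (by linarith)
          (fun x hx => (hQd x).sub (h1 x (hsub hx)))
          (hQ1c.continuousOn.sub (hf1c.mono hsub))
          (by simp [hQ, lagQuad_left _ _ _ hk1 hk2]) (by simp [hQ, lagQuad_mid _ _ _ hk1 hk2]),
          abs_neg, abs_mul, abs_of_pos hα0]
        refine mul_le_mul_of_nonneg_left ?_ hα0.le
        have hb : ∀ᵐ s, s ∈ Ioc (t k) (t (k + 1)) →
            ‖(z - s) ^ (-α - 1) * (Q s - f s)‖ ≤ Φ s := by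
          refine Filter.Eventually.of_forall fun s hs => ?_
          rw [Real.norm_eq_abs, abs_mul,
            abs_of_nonneg (Real.rpow_nonneg (by linarith [hs.2]) _)]
          exact hΦ k (by omega) s ⟨hs.1.le, hs.2⟩
        exact intervalIntegral.norm_integral_le_of_norm_le hk1.le hb
          (hΦI _ _ h0k hk1.le hkn')
      rw [Finset.sum_Icc_succ_top (by omega),
        ← intervalIntegral.integral_add_adjacent_intervals (hI _ _ le_rfl h0k (by linarith))
          (hI _ _ h0k hk1.le (by linarith)),
        ← intervalIntegral.integral_add_adjacent_intervals (hΦI _ _ le_rfl h0k (by linarith))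
          (hΦI _ _ h0k hk1.le hkn'), mul_add, add_sub_add_comm]
      exact (abs_add_le _ _).trans (add_le_add ih hnew)
  have hL := abs_integral_slope_sub_deriv_le hα0 hα1 hlast hz'
    (fun x hx => h1 x ⟨(hmono 0 n (by omega) (by omega)).trans hx.1, hx.2⟩)
    (fun x hx => h2 x ⟨(hmono 0 n (by omega) (by omega)).trans hx.1, hx.2⟩)
    (fun x hx => h3 x ⟨(hmono 0 n (by omega) (by omega)).trans hx.1, hx.2⟩) hK
  have hΓ : Real.Gamma (1 - α) ≠ 0 := (Real.Gamma_pos_of_pos (by linarith)).ne'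
  have h0n : t 0 ≤ t n := hmono 0 n (by omega) (by omega)
  rw [deltaAlik, ← mul_assoc, mul_one_div_cancel hΓ, one_mul,
    ← intervalIntegral.integral_add_adjacent_intervals (hI _ _ le_rfl h0n hlast.le)
      (hI _ _ h0n hnz.le hzn), add_sub_add_comm]
  exact (abs_add_le _ _).trans (add_le_add (hpiece n le_rfl) hL)

/-- The barrier function. -/
noncomputable def barrier (α a s : ℝ) : ℝ := s * (s + a) ^ (α - 2)

/-- First derivative of the barrier function. -/
noncomputable def barrierDeriv (α a s : ℝ) : ℝ := (a - (1 - α) * s) * (s + a) ^ (α - 3)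

/-- Second derivative of the barrier function. -/
noncomputable def barrierDeriv2 (α a s : ℝ) : ℝ :=
  ((1 - α) * (2 - α) * s - (4 - 2 * α) * a) * (s + a) ^ (α - 4)

/-- Third derivative of the barrier function. -/
noncomputable def barrierDeriv3 (α a s : ℝ) : ℝ :=
  ((1 - α) * (2 - α) * (α - 3) * s + (2 - α) * (9 - 3 * α) * a) * (s + a) ^ (α - 5)

lemma hasDerivAt_linear_mul_rpow {a s : ℝ} (u v p : ℝ) (hs : 0 < s + a) :
    HasDerivAt (fun x => (u * x + v) * (x + a) ^ p)
      ((u * (s + a) + p * (u * s + v)) * (s + a) ^ (p - 1)) s := by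
  have h1 : HasDerivAt (fun x => u * x + v) u s := by
    simpa using ((hasDerivAt_id s).const_mul u).add_const v
  have h2 := ((hasDerivAt_id s).add_const a).rpow_const (p := p) (Or.inl hs.ne')
  refine (h1.mul h2).congr_deriv ?_
  have : (s + a) ^ p = (s + a) ^ (p - 1) * (s + a) := by
    rw [← Real.rpow_add_one hs.ne']
    ring_nf
  simp only [id, this]
  ring

lemma hasDerivAt_barrier {α a s : ℝ} (hs : 0 < s + a) :
    HasDerivAt (barrier α a) (barrierDeriv α a s) s := by
  have h := hasDerivAt_linear_mul_rpow 1 0 (α - 2) hs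
  simp only [one_mul, add_zero] at h
  refine h.congr_deriv ?_
  rw [barrierDeriv, show α - 2 - 1 = α - 3 by ring]
  ring

lemma hasDerivAt_barrierDeriv {α a s : ℝ} (hs : 0 < s + a) :
    HasDerivAt (barrierDeriv α a) (barrierDeriv2 α a s) s := by
  have h := hasDerivAt_linear_mul_rpow (-(1 - α)) a (α - 3) hs
  have he : barrierDeriv α a = fun x => (-(1 - α) * x + a) * (x + a) ^ (α - 3) := by
    ext x
    rw [barrierDeriv]
    ring
  rw [he]
  refine h.congr_deriv ?_
  rw [barrierDeriv2, show α - 3 - 1 = α - 4 by ring]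
  ring

lemma hasDerivAt_barrierDeriv2 {α a s : ℝ} (hs : 0 < s + a) :
    HasDerivAt (barrierDeriv2 α a) (barrierDeriv3 α a s) s := by
  have h := hasDerivAt_linear_mul_rpow ((1 - α) * (2 - α)) (-(4 - 2 * α) * a) (α - 4) hs
  have he : barrierDeriv2 α a =
      fun x => ((1 - α) * (2 - α) * x + -(4 - 2 * α) * a) * (x + a) ^ (α - 4) := by
    ext x
    rw [barrierDeriv2]
    ring
  rw [he]
  refine h.congr_deriv ?_
  rw [barrierDeriv3, show α - 4 - 1 = α - 5 by ring]
  ring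

lemma abs_barrierDeriv3_le {α a s : ℝ} (hα0 : 0 < α) (hα1 : α < 1) (ha : 0 < a) (hs : 0 ≤ s) :
    |barrierDeriv3 α a s| ≤ 18 * (s + a) ^ (α - 4) := by
  have hsa : 0 < s + a := by linarith
  have hp : (s + a) ^ (α - 4) = (s + a) * (s + a) ^ (α - 5) := by
    rw [mul_comm, ← Real.rpow_add_one hsa.ne']
    ring_nf
  rw [barrierDeriv3, abs_mul, abs_of_nonneg (Real.rpow_nonneg hsa.le _), hp, ← mul_assoc]
  refine mul_le_mul_of_nonneg_right ?_ (Real.rpow_nonneg hsa.le _)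
  have h1 : 0 ≤ (1 - α) * (2 - α) * (3 - α) := by
    apply mul_nonneg (mul_nonneg _ _) <;> linarith
  have h2 : (1 - α) * (2 - α) * (3 - α) ≤ 6 := by nlinarith [mul_pos hα0 (sub_pos.2 hα1)]
  have h3 : 0 ≤ (2 - α) * (9 - 3 * α) := by apply mul_nonneg <;> linarith
  have h4 : (2 - α) * (9 - 3 * α) ≤ 18 := by nlinarith
  rw [abs_le]
  constructor <;>
    nlinarith [mul_nonneg h1 hs, mul_nonneg h3 ha.le, mul_le_mul_of_nonneg_right h2 hs,
      mul_le_mul_of_nonneg_right h4 ha.le]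

/-- Exact Caputo-type integral of the barrier function. -/
lemma integral_kernel_mul_barrierDeriv {α a z : ℝ} (hα0 : 0 < α) (hα1 : α < 1) (ha : 0 < a)
    (hz : 0 < z) :
    ∫ s in (0:ℝ)..z, (z - s) ^ (-α) * barrierDeriv α a s =
      a ^ α * z ^ (1 - α) / (z + a) ^ 2 / (1 - α) := by
  have hza : 0 < z + a := by linarith
  have h1α : 1 - α ≠ 0 := by linarith
  have hpos : ∀ s ∈ Icc 0 z, 0 < s + a := fun s hs => by linarith [hs.1]
  have hu : ∀ s ∈ Ioo 0 z, HasDerivAt (fun s => (z - s) / (s + a)) (-(z + a) / (s + a) ^ 2) s := by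
    intro s hs
    have h := ((hasDerivAt_id s).const_sub z).div ((hasDerivAt_id s).add_const a)
      (hpos s ⟨hs.1.le, hs.2.le⟩).ne'
    refine h.congr_deriv ?_
    simp only [id]
    ring
  set G : ℝ → ℝ := fun s => -((((a - (1 - α) * z) / (1 - α) * ((z - s) / (s + a)) ^ (1 - α) +
    a * ((z - s) / (s + a)) ^ (2 - α))) / (z + a) ^ 2) with hG
  have hcu : ContinuousOn (fun s => (z - s) / (s + a)) (Icc 0 z) :=
    ContinuousOn.div (by fun_prop) (by fun_prop) fun s hs => (hpos s hs).ne'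
  have hGc : ContinuousOn G (Icc 0 z) := by
    have h1 := hcu.rpow_const (p := 1 - α) fun s _ => Or.inr (by linarith)
    have h2 := hcu.rpow_const (p := 2 - α) fun s _ => Or.inr (by linarith)
    exact (((h1.const_mul _).add (h2.const_mul _)).div_const _).neg
  have hGd : ∀ s ∈ Ioo 0 z, HasDerivAt G ((z - s) ^ (-α) * barrierDeriv α a s) s := by
    intro s hs
    have hsa := hpos s ⟨hs.1.le, hs.2.le⟩
    have hzs : 0 < z - s := by linarith [hs.2]
    have hu0 : 0 < (z - s) / (s + a) := div_pos hzs hsa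
    have h1 := (hu s hs).rpow_const (p := 1 - α) (Or.inl hu0.ne')
    have h2 := (hu s hs).rpow_const (p := 2 - α) (Or.inl hu0.ne')
    refine ((((h1.const_mul _).add (h2.const_mul _)).div_const _).neg).congr_deriv ?_
    have e1 : ((z - s) / (s + a)) ^ (1 - α - 1) = (z - s) ^ (-α) * (s + a) ^ α := by
      rw [show 1 - α - 1 = -α by ring, Real.div_rpow hzs.le hsa.le, Real.rpow_neg hsa.le α,
        div_inv_eq_mul]
    have e2 : ((z - s) / (s + a)) ^ (2 - α - 1) =
        (z - s) ^ (-α) * (s + a) ^ α * ((z - s) / (s + a)) := by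
      rw [← e1, ← Real.rpow_add_one hu0.ne']
      ring_nf
    have e3 : (s + a) ^ (α - 3) = (s + a) ^ α / (s + a) ^ 3 := by
      rw [← Real.rpow_natCast, ← Real.rpow_sub hsa]
      norm_num
    rw [e1, e2, barrierDeriv, e3]
    field_simp
    ring
  have h_int : IntervalIntegrable (fun s => (z - s) ^ (-α) * barrierDeriv α a s) volume 0 z := by
    refine (intervalIntegrable_kernel hα1 z 0 z).mul_continuousOn fun s hs => ?_
    rw [uIcc_of_le hz.le] at hs
    exact (hasDerivAt_barrierDeriv (hpos s hs)).continuousAt.continuousWithinAt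
  rw [intervalIntegral.integral_eq_sub_of_hasDerivAt_of_le hz.le hGc hGd h_int, hG]
  have e1 : (z / a) ^ (2 - α) = (z / a) ^ (1 - α) * (z / a) := by
    rw [← Real.rpow_add_one (div_pos hz ha).ne']
    ring_nf
  have e2 : (z / a) ^ (1 - α) = z ^ (1 - α) * a ^ α / a := by
    rw [Real.div_rpow hz.le ha.le, Real.rpow_sub ha, Real.rpow_one]
    field_simp
  simp only [sub_self, zero_div, sub_zero, zero_add, Real.zero_rpow h1α,
    Real.zero_rpow (show 2 - α ≠ 0 by linarith), mul_zero, add_zero, neg_zero, zero_sub, neg_neg]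
  rw [e1, e2]
  field_simp
  ring

lemma rpow_sub_four_le {α κ x y : ℝ} (hα0 : 0 < α) (hα1 : α < 1) (hκ : 1 ≤ κ) (hx : 0 < x)
    (hy : 0 < y) (h : y ≤ κ * x) : x ^ (α - 4) ≤ κ ^ 4 * y ^ (α - 4) := by
  have hκ0 : 0 < κ := by linarith
  have h1 : (κ * x) ^ (α - 4) ≤ y ^ (α - 4) := Real.rpow_le_rpow_of_nonpos hy h (by linarith)
  have h2 : κ ^ (4 - α) ≤ κ ^ 4 := by
    rw [← Real.rpow_natCast]
    exact Real.rpow_le_rpow_of_exponent_le hκ (by norm_num; linarith)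
  have h3 : x ^ (α - 4) = κ ^ (4 - α) * (κ * x) ^ (α - 4) := by
    rw [Real.mul_rpow hκ0.le hx.le, ← mul_assoc, ← Real.rpow_add hκ0]
    simp
  rw [h3]
  gcongr

lemma abs_lagQuad_barrier_sub_le {α a κ D s x0 x1 x2 : ℝ} (hα0 : 0 < α) (hα1 : α < 1)
    (ha : 0 < a) (hx0 : 0 ≤ x0) (h01 : x0 < x1) (h12 : x1 < x2) (hs : s ∈ Icc x0 x1)
    (hκ : 1 ≤ κ) (hgrow : x2 + a ≤ κ * (x0 + a)) (hD1 : x1 - x0 ≤ D) (hD2 : x2 - x1 ≤ D) :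
    |lagQuad x0 x1 x2 (barrier α a x0) (barrier α a x1) (barrier α a x2) s - barrier α a s| ≤
      6 * κ ^ 4 * (s + a) ^ (α - 4) * D ^ 3 := by
  obtain ⟨hs0, hs1⟩ := hs
  have hx0a : 0 < x0 + a := by linarith
  have hpos : ∀ x ∈ Icc x0 x2, 0 < x + a := fun x hx => by linarith [hx.1]
  have hK : ∀ x ∈ Icc x0 x2, |barrierDeriv3 α a x| ≤ 18 * (κ ^ 4 * (s + a) ^ (α - 4)) :=
    fun x hx => (abs_barrierDeriv3_le hα0 hα1 ha (hx0.trans hx.1)).trans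
      (mul_le_mul_of_nonneg_left
        ((Real.rpow_le_rpow_of_nonpos hx0a (by linarith [hx.1]) (by linarith)).trans
          (rpow_sub_four_le hα0 hα1 hκ hx0a (by linarith) (by linarith))) (by norm_num))
  refine (abs_lagQuad_sub_le h01 h12 (fun x hx => hasDerivAt_barrier (hpos x hx))
    (fun x hx => hasDerivAt_barrierDeriv (hpos x hx))
    (fun x hx => hasDerivAt_barrierDeriv2 (hpos x hx)) hK ⟨hs0, hs1⟩).trans ?_
  have hR : 0 ≤ κ ^ 4 * (s + a) ^ (α - 4) :=
    mul_nonneg (by positivity) (Real.rpow_nonneg (by linarith) _)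
  have hw : (s - x0) * (x1 - s) * (x2 - s) ≤ D * D * (2 * D) := by
    have h1 : 0 ≤ s - x0 := by linarith
    have h2 : 0 ≤ x1 - s := by linarith
    have h3 : 0 ≤ x2 - s := by linarith
    have h4 : 0 ≤ D := by linarith
    gcongr <;> linarith
  calc 18 * (κ ^ 4 * (s + a) ^ (α - 4)) / 6 * ((s - x0) * (x1 - s) * (x2 - s))
      ≤ 18 * (κ ^ 4 * (s + a) ^ (α - 4)) / 6 * (D * D * (2 * D)) := by gcongr
    _ = _ := by ring

lemma integral_add_rpow_le {a p X : ℝ} (ha : 0 < a) (hp : 0 < p) (hX : 0 ≤ X) :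
    ∫ s in (0:ℝ)..X, (s + a) ^ (-p - 1) ≤ a ^ (-p) / p := by
  rw [intervalIntegral.integral_comp_add_right (fun x => x ^ (-p - 1)) a,
    integral_rpow (Or.inr ⟨by linarith, fun h => by
      rw [uIcc_of_le (by linarith)] at h
      linarith [h.1]⟩)]
  have h : 0 ≤ (X + a) ^ (-p) := Real.rpow_nonneg (by linarith) _
  rw [show -p - 1 + 1 = -p by ring, zero_add, div_neg, ← neg_div, neg_sub]
  gcongr
  linarith

/-- On a quasi-graded mesh, shifted mesh points at distance at most two are comparable. -/
lemma add_le_mul_add_of_quasiGraded {r c0 C0 a : ℝ} {M : ℕ} {t : ℕ → ℝ} (hr : 1 ≤ r)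
    (hc0 : 0 < c0) (hcC : c0 ≤ C0) (h0 : t 0 = 0) (h1 : 0 < t 1) (hq : QuasiGraded r c0 C0 M t)
    (ha : t 1 ≤ a) {j k : ℕ} (hjM : j ≤ M) (hkM : k ≤ M) (hk : k ≤ j + 2) :
    t k + a ≤ (C0 / c0 * 3 ^ r + C0 * 3 ^ r + 1) * (t j + a) := by
  have hC0 : 0 < C0 := hc0.trans_le hcC
  have h3 : (0:ℝ) < 3 ^ r := Real.rpow_pos_of_pos (by norm_num) r
  have hr0 : 0 ≤ r := by linarith
  have hb := hq.2.1
  have htj : 0 ≤ t j := by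
    obtain rfl | hj := j.eq_zero_or_pos
    · exact h0.ge
    · exact le_trans (by positivity) (hb j hj hjM).1
  have ha0 : 0 < a := h1.trans_le ha
  have htk : t k ≤ C0 / c0 * 3 ^ r * t j + C0 * 3 ^ r * a := by
    obtain rfl | hk0 := k.eq_zero_or_pos
    · rw [h0]
      positivity
    obtain rfl | hj := j.eq_zero_or_pos
    · have hk3 : (k : ℝ) ≤ 3 := by exact_mod_cast (by omega : k ≤ 3)
      calc t k ≤ C0 * (t 1 * (k : ℝ) ^ r) := (hb k hk0 hkM).2
        _ ≤ C0 * (a * 3 ^ r) := by gcongr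
        _ = C0 / c0 * 3 ^ r * t 0 + C0 * 3 ^ r * a := by rw [h0]; ring
    · have hk3 : (k : ℝ) ≤ 3 * j := by exact_mod_cast (by omega : k ≤ 3 * j)
      calc t k ≤ C0 * (t 1 * (k : ℝ) ^ r) := (hb k hk0 hkM).2
        _ ≤ C0 * (t 1 * (3 * j : ℝ) ^ r) := by gcongr
        _ = C0 / c0 * 3 ^ r * (c0 * (t 1 * (j : ℝ) ^ r)) := by
          rw [Real.mul_rpow (by norm_num) (by positivity)]
          field_simp
        _ ≤ C0 / c0 * 3 ^ r * t j := by
          gcongr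
          exact (hb j hj hjM).1
        _ ≤ C0 / c0 * 3 ^ r * t j + C0 * 3 ^ r * a := by
          have : 0 ≤ C0 * 3 ^ r * a := by positivity
          linarith
  have h5 : 0 ≤ C0 / c0 * 3 ^ r * a := by positivity
  have h6 : 0 ≤ C0 * 3 ^ r * t j := by positivity
  nlinarith

/-- Bound for the weighted interpolation error that covers points close to the evaluation time
(first term) and points far from it (second term). -/
lemma kernel_mul_interp_error_le {α θ τ a κ C X T z s e : ℝ} (hα0 : 0 < α) (hα1 : α < 1)
    (hθ0 : 0 ≤ θ) (hθ1 : θ ≤ 1) (hτ : 0 < τ) (ha : 0 < a) (hκ : 1 ≤ κ) (hC : 0 < C)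
    (hX : 0 < X) (hXT : X ≤ T) (hXs : X ≤ κ * (s + a)) (hs : 0 ≤ s) (hsz : s < z)
    (hz : T / 2 ≤ z)
    (he : e ≤ 6 * κ ^ 4 * (s + a) ^ (α - 4) * (C * (τ ^ θ * X ^ (1 - θ))) ^ 3) :
    (z - s) ^ (-α - 1) * e ≤
      1536 * κ ^ 4 * C ^ 3 * ((τ ^ θ * T ^ (1 - θ)) ^ 3 * (T + a) ^ (α - 4)) *
        (z - s) ^ (-α - 1) +
      384 * κ ^ 7 * C ^ 3 * ((τ ^ θ) ^ 3 * (T ^ (1 - α) / (T + a) ^ 2)) *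
        (s + a) ^ (-(3 * θ - α) - 1) := by
  have hT : 0 < T := hX.trans_le hXT
  have hTa : 0 < T + a := by linarith
  have hsa : 0 < s + a := by linarith
  have hzs : 0 < z - s := by linarith
  have hP : 0 < τ ^ θ := Real.rpow_pos_of_pos hτ θ
  have hW : 0 < (z - s) ^ (-α - 1) := Real.rpow_pos_of_pos hzs _
  have hSa : 0 < (s + a) ^ (α - 4) := Real.rpow_pos_of_pos hsa _
  have hSb : 0 < (s + a) ^ (-(3 * θ - α) - 1) := Real.rpow_pos_of_pos hsa _
  have hTp : 0 < T ^ (1 - θ) := Real.rpow_pos_of_pos hT _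
  have hTq : 0 < T ^ (1 - α) := Real.rpow_pos_of_pos hT _
  have hTr : 0 < (T + a) ^ (α - 4) := Real.rpow_pos_of_pos hTa _
  have hXp : 0 < X ^ (1 - θ) := Real.rpow_pos_of_pos hX _
  rcases le_or_gt (T + a) (4 * (s + a)) with hnear | hfar
  · have h1 : (s + a) ^ (α - 4) ≤ 4 ^ 4 * (T + a) ^ (α - 4) :=
      rpow_sub_four_le hα0 hα1 (by norm_num) hsa hTa hnear
    have h2 : X ^ (1 - θ) ≤ T ^ (1 - θ) := Real.rpow_le_rpow hX.le hXT (by linarith)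
    have h3 : e ≤ 1536 * κ ^ 4 * C ^ 3 * ((τ ^ θ * T ^ (1 - θ)) ^ 3 * (T + a) ^ (α - 4)) :=
      calc e ≤ 6 * κ ^ 4 * (s + a) ^ (α - 4) * (C * (τ ^ θ * X ^ (1 - θ))) ^ 3 := he
        _ ≤ 6 * κ ^ 4 * (4 ^ 4 * (T + a) ^ (α - 4)) * (C * (τ ^ θ * T ^ (1 - θ))) ^ 3 := by
          gcongr
        _ = _ := by ring
    have h4 : 0 ≤ 384 * κ ^ 7 * C ^ 3 * ((τ ^ θ) ^ 3 * (T ^ (1 - α) / (T + a) ^ 2)) *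
        (s + a) ^ (-(3 * θ - α) - 1) := by positivity
    have h5 := mul_le_mul_of_nonneg_left h3 hW.le
    linarith
  · have h1 : X ^ (1 - θ) ≤ κ * (s + a) ^ (1 - θ) :=
      calc X ^ (1 - θ) ≤ (κ * (s + a)) ^ (1 - θ) := Real.rpow_le_rpow hX.le hXs (by linarith)
        _ = κ ^ (1 - θ) * (s + a) ^ (1 - θ) := Real.mul_rpow (by linarith) hsa.le
        _ ≤ κ * (s + a) ^ (1 - θ) := by
          refine mul_le_mul_of_nonneg_right ?_ (Real.rpow_nonneg hsa.le _)
          exact (Real.rpow_le_rpow_of_exponent_le hκ (by linarith)).trans_eq (Real.rpow_one κ)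
    have h2 : (s + a) ^ (α - 4) * ((s + a) ^ (1 - θ)) ^ 3 = (s + a) ^ (-(3 * θ - α) - 1) := by
      rw [← Real.rpow_natCast, ← Real.rpow_mul hsa.le, ← Real.rpow_add hsa]
      norm_num
      ring_nf
    have h3 : e ≤ 6 * κ ^ 7 * C ^ 3 * (τ ^ θ) ^ 3 * (s + a) ^ (-(3 * θ - α) - 1) :=
      calc e ≤ 6 * κ ^ 4 * (s + a) ^ (α - 4) * (C * (τ ^ θ * X ^ (1 - θ))) ^ 3 := he
        _ ≤ 6 * κ ^ 4 * (s + a) ^ (α - 4) * (C * (τ ^ θ * (κ * (s + a) ^ (1 - θ)))) ^ 3 := by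
          gcongr
        _ = 6 * κ ^ 7 * C ^ 3 * (τ ^ θ) ^ 3 * ((s + a) ^ (α - 4) * ((s + a) ^ (1 - θ)) ^ 3) := by
          ring
        _ = _ := by rw [h2]
    have h4 : (z - s) ^ (-α - 1) ≤ 64 * (T ^ (1 - α) / (T + a) ^ 2) := by
      have h5 : (z - s) ^ (-α - 1) ≤ (T / 4) ^ (-α - 1) :=
        Real.rpow_le_rpow_of_nonpos (by linarith) (by linarith) (by linarith)
      have h6 : (T / 4) ^ (-α - 1) = 4 ^ (1 + α) * (T ^ (1 - α) / T ^ 2) := by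
        rw [Real.div_rpow hT.le (by norm_num), ← Real.rpow_natCast T 2, ← Real.rpow_sub hT,
          show -α - 1 = -(1 + α) by ring, Real.rpow_neg (by norm_num : (0:ℝ) ≤ 4), div_inv_eq_mul,
          Nat.cast_ofNat, show 1 - α - 2 = -(1 + α) by ring, mul_comm]
      have h7 : (4:ℝ) ^ (1 + α) ≤ 16 := by
        calc (4:ℝ) ^ (1 + α) ≤ 4 ^ (2:ℝ) :=
              Real.rpow_le_rpow_of_exponent_le (by norm_num) (by linarith)
          _ = 16 := by norm_num
      have h8 : T ^ (1 - α) / T ^ 2 ≤ 4 * (T ^ (1 - α) / (T + a) ^ 2) := by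
        rw [← mul_div_assoc, div_le_div_iff₀ (by positivity) (by positivity)]
        have : (T + a) ^ 2 ≤ 4 * T ^ 2 := by nlinarith
        nlinarith
      calc (z - s) ^ (-α - 1) ≤ 4 ^ (1 + α) * (T ^ (1 - α) / T ^ 2) := h5.trans_eq h6
        _ ≤ 16 * (4 * (T ^ (1 - α) / (T + a) ^ 2)) := by gcongr
        _ = _ := by ring
    have h5 : (z - s) ^ (-α - 1) * e ≤ 64 * (T ^ (1 - α) / (T + a) ^ 2) *
        (6 * κ ^ 7 * C ^ 3 * (τ ^ θ) ^ 3 * (s + a) ^ (-(3 * θ - α) - 1)) := by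
      refine (mul_le_mul_of_nonneg_left h3 hW.le).trans ?_
      gcongr
    have h6 : 0 ≤ 1536 * κ ^ 4 * C ^ 3 * ((τ ^ θ * T ^ (1 - θ)) ^ 3 * (T + a) ^ (α - 4)) *
        (z - s) ^ (-α - 1) := by positivity
    linarith

lemma rpow_mul_rpow_le {α θ τ T a : ℝ} (hα1 : α < 1) (hθ : α ≤ θ * (3 - α)) (hτ : 0 < τ)
    (hτT : τ ≤ T) (ha : 0 < a) :
    (τ ^ θ * T ^ (1 - θ)) ^ (3 - α) * (T + a) ^ (α - 4) ≤
      τ ^ α * (T ^ (1 - α) / (T + a) ^ 2) := by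
  have hT : 0 < T := hτ.trans_le hτT
  have hTa : 0 < T + a := by linarith
  have h1 : (τ ^ θ * T ^ (1 - θ)) ^ (3 - α) =
      (τ ^ α * T ^ (1 - α)) * (τ ^ (θ * (3 - α) - α) * T ^ (2 - θ * (3 - α))) := by
    have e1 : (τ ^ θ) ^ (3 - α) = τ ^ α * τ ^ (θ * (3 - α) - α) := by
      rw [← Real.rpow_mul hτ.le, ← Real.rpow_add hτ]
      ring_nf
    have e2 : (T ^ (1 - θ)) ^ (3 - α) = T ^ (1 - α) * T ^ (2 - θ * (3 - α)) := by
      rw [← Real.rpow_mul hT.le, ← Real.rpow_add hT]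
      ring_nf
    rw [Real.mul_rpow (Real.rpow_nonneg hτ.le _) (Real.rpow_nonneg hT.le _), e1, e2]
    ring
  have h2 : τ ^ (θ * (3 - α) - α) * T ^ (2 - θ * (3 - α)) ≤ (T + a) ^ (2 - α) :=
    calc τ ^ (θ * (3 - α) - α) * T ^ (2 - θ * (3 - α))
        ≤ T ^ (θ * (3 - α) - α) * T ^ (2 - θ * (3 - α)) := by
          have := Real.rpow_le_rpow hτ.le hτT (sub_nonneg.2 hθ)
          gcongr
      _ = T ^ (2 - α) := by
          rw [← Real.rpow_add hT]
          ring_nf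
      _ ≤ (T + a) ^ (2 - α) := Real.rpow_le_rpow hT.le (by linarith) (by linarith)
  have h3 : (T + a) ^ (2 - α) * (T + a) ^ (α - 4) = 1 / (T + a) ^ 2 := by
    rw [← Real.rpow_add hTa, show 2 - α + (α - 4) = -(2:ℝ) by ring, Real.rpow_neg hTa.le,
      one_div]
    norm_num
  calc (τ ^ θ * T ^ (1 - θ)) ^ (3 - α) * (T + a) ^ (α - 4)
      ≤ (τ ^ α * T ^ (1 - α)) * (T + a) ^ (2 - α) * (T + a) ^ (α - 4) := by
        rw [h1]
        gcongr
    _ = τ ^ α * (T ^ (1 - α) / (T + a) ^ 2) := by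
        rw [mul_assoc, h3]
        ring

/-- Truncation error of the Alikhanov operator applied to the barrier function. -/
lemma abs_deltaAlik_barrier_sub_le {α r c0 C0 : ℝ} (hα0 : 0 < α) (hα1 : α < 1)
    (hr1 : 1 ≤ r) (hr2 : r ≤ (3 - α) / α) (hc0 : 0 < c0) (hcC : c0 ≤ C0) :
    ∃ A : ℝ, 0 < A ∧ ∀ (M n : ℕ) (t : ℕ → ℝ) (a : ℝ), n + 1 ≤ M → t 0 = 0 →
      (∀ j, j < M → t j < t (j + 1)) → QuasiGraded r c0 C0 M t → t 1 ≤ a →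
      |Real.Gamma (1 - α) * deltaAlik α t (fun j => barrier α a (t j)) (n + 1) -
        ∫ s in (0:ℝ)..(tStar α t (n + 1)),
          (tStar α t (n + 1) - s) ^ (-α) * barrierDeriv α a s| ≤
      A * (t 1 ^ α * (t (n + 1) ^ (1 - α) / (t (n + 1) + a) ^ 2)) := by
  have hr0 : 0 < r := by linarith
  have hC0 : 0 < C0 := hc0.trans_le hcC
  set θ := 1 / r with hθ
  have hθ0 : 0 < θ := by positivity
  have hθ1 : θ ≤ 1 := by rw [hθ, div_le_one hr0]; exact hr1
  have hθα : α ≤ θ * (3 - α) := by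
    rw [le_div_iff₀ hα0] at hr2
    rw [hθ, one_div_mul_eq_div, le_div_iff₀ hr0]
    linarith
  have hp : 0 < 3 * θ - α := by nlinarith [mul_pos hθ0 hα0]
  set κ := C0 / c0 * 3 ^ r + C0 * 3 ^ r + 1 with hκ
  have hκ1 : 1 ≤ κ := by
    have : 0 ≤ C0 / c0 * 3 ^ r + C0 * 3 ^ r := by positivity
    linarith
  have hκ0 : 0 < κ := by linarith
  have h1α : 0 < 1 - α := by linarith
  refine ⟨1536 * κ ^ 4 * C0 ^ 3 * (c0 / 2) ^ (-α) + α * (384 * κ ^ 7 * C0 ^ 3 / (3 * θ - α)) +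
    18 * κ ^ 4 * C0 ^ (3 - α) / (1 - α), by positivity, ?_⟩
  intro M n t a hn h0 hmesh hq ha
  have ht1 : 0 < t 1 := by simpa [h0] using hmesh 0 (by omega)
  have ha0 : 0 < a := ht1.trans_le ha
  have hmono : ∀ j k, j ≤ k → k ≤ M → t j ≤ t k := by
    intro j k hjk
    induction k, hjk using Nat.le_induction with
    | base => exact fun _ => le_rfl
    | succ k _ ih => exact fun hk => (ih (by omega)).trans (hmesh k (by omega)).le
  have hnn : ∀ j ≤ M, 0 ≤ t j := fun j hj => h0 ▸ hmono 0 j (by omega) hj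
  have hgrow : ∀ j k, j ≤ M → k ≤ M → k ≤ j + 2 → t k + a ≤ κ * (t j + a) := fun j k hj hk hjk =>
    add_le_mul_add_of_quasiGraded hr1 hc0 hcC h0 ht1 hq ha hj hk hjk
  have hstep : ∀ j, j + 1 ≤ M → t (j + 1) - t j ≤ C0 * (t 1 ^ θ * t (j + 1) ^ (1 - θ)) :=
    fun j hj => (hq.2.2 (j + 1) (by omega) hj).2
  have hlast := hmesh n (by omega)
  set τ := t 1 with hτ
  set X := t (n + 1) with hX
  set z := tStar α t (n + 1) with hz
  have hz' : z = X - α / 2 * (X - t n) := rfl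
  have htn : 0 ≤ t n := hnn n (by omega)
  have hτX : τ ≤ X := hmono 1 (n + 1) (by omega) hn
  have hX0 : 0 < X := ht1.trans_le hτX
  have hXa : 0 < X + a := by linarith
  have hnz : (X - t n) / 2 ≤ z - t n := by rw [hz']; nlinarith
  have hXz : X / 2 ≤ z := by rw [hz']; nlinarith
  set H := τ ^ θ * X ^ (1 - θ) with hH
  have hH0 : 0 < H := by positivity
  have hHlow : c0 * H ≤ X - t n := (hq.2.2 (n + 1) (by omega) hn).1
  have hpos : ∀ x ∈ Icc (t 0) (t (n + 1)), 0 < x + a := fun x hx => by linarith [hx.1]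
  set E := 1536 * κ ^ 4 * C0 ^ 3 * (H ^ 3 * (X + a) ^ (α - 4)) with hE
  set F := 384 * κ ^ 7 * C0 ^ 3 * ((τ ^ θ) ^ 3 * (X ^ (1 - α) / (X + a) ^ 2)) with hF
  have hE0 : 0 ≤ E := by positivity
  have hF0 : 0 ≤ F := by positivity
  have hc1 : ContinuousOn (fun s => E * (z - s) ^ (-α - 1)) (Icc 0 (t n)) :=
    (continuousOn_kernel_deriv 0 (by linarith)).const_mul E
  have hc2 : ContinuousOn (fun s => F * (s + a) ^ (-(3 * θ - α) - 1)) (Icc 0 (t n)) :=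
    (ContinuousOn.rpow_const (by fun_prop) fun s hs =>
      Or.inl (by linarith [hs.1])).const_mul F
  have key := abs_deltaAlik_sub_le (n := n) (t := t) (f := barrier α a)
    (K := 18 * (κ ^ 4 * (X + a) ^ (α - 4)))
    (Φ := fun s => E * (z - s) ^ (-α - 1) + F * (s + a) ^ (-(3 * θ - α) - 1)) hα0 hα1
    (fun j hj => hmesh j (by omega))
    (fun x hx => hasDerivAt_barrier (hpos x hx))
    (fun x hx => hasDerivAt_barrierDeriv (hpos x hx))
    (fun x hx => hasDerivAt_barrierDeriv2 (hpos x hx))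
    (fun x hx => by
      refine (abs_barrierDeriv3_le hα0 hα1 ha0 (htn.trans hx.1)).trans
        (mul_le_mul_of_nonneg_left ?_ (by norm_num))
      refine rpow_sub_four_le hα0 hα1 hκ1 (by linarith [hx.1]) hXa ?_
      refine (hgrow n (n + 1) (by omega) hn (by omega)).trans ?_
      have := hx.1
      gcongr)
    (by rw [h0]; exact hc1.add hc2)
    (fun j hj s hs => by
      have htj : 0 ≤ t j := hnn j (by omega)
      have hj1 := hmesh j (by omega)
      have hj2 := hmesh (j + 1) (by omega)
      have hjn : t (j + 1) ≤ t n := hmono (j + 1) n (by omega) (by omega)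
      have hgj := hgrow j (j + 2) (by omega) (by omega) le_rfl
      have hps : (t (j + 1)) ^ (1 - θ) ≤ (t (j + 2)) ^ (1 - θ) :=
        Real.rpow_le_rpow (by linarith) hj2.le (by linarith)
      refine kernel_mul_interp_error_le (X := t (j + 2)) hα0 hα1 hθ0.le hθ1 ht1 ha0 hκ1 hC0
        (by linarith) (hmono _ _ (by omega) hn) ?_ (htj.trans hs.1) (by linarith [hs.2]) hXz
        (abs_lagQuad_barrier_sub_le hα0 hα1 ha0 htj hj1 hj2 hs hκ1 hgj ?_
          (hstep (j + 1) (by omega)))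
      · have := mul_le_mul_of_nonneg_left (add_le_add_left hs.1 a) hκ0.le
        linarith
      · refine (hstep j (by omega)).trans ?_
        gcongr)
  rw [h0] at key
  refine key.trans ?_
  rw [intervalIntegral.integral_add (hc1.intervalIntegrable_of_Icc htn)
    (hc2.intervalIntegrable_of_Icc htn), intervalIntegral.integral_const_mul,
    intervalIntegral.integral_const_mul]
  set Y := τ ^ α * (X ^ (1 - α) / (X + a) ^ 2) with hY
  have hHY : H ^ (3 - α) * (X + a) ^ (α - 4) ≤ Y := rpow_mul_rpow_le hα1 hθα ht1 hτX ha0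
  have hnear : E * (α * ∫ s in (0:ℝ)..(t n), (z - s) ^ (-α - 1)) ≤
      1536 * κ ^ 4 * C0 ^ 3 * (c0 / 2) ^ (-α) * Y := by
    have h1 : (z - t n) ^ (-α) ≤ (c0 / 2) ^ (-α) * H ^ (-α) := by
      rw [← Real.mul_rpow (by positivity) hH0.le]
      exact Real.rpow_le_rpow_of_nonpos (by positivity) (by linarith) (by linarith)
    have h2 : H ^ 3 * H ^ (-α) = H ^ (3 - α) := by
      rw [← Real.rpow_natCast, ← Real.rpow_add hH0]
      norm_num
      ring_nf
    calc E * (α * ∫ s in (0:ℝ)..(t n), (z - s) ^ (-α - 1))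
        ≤ E * ((c0 / 2) ^ (-α) * H ^ (-α)) := by
          exact mul_le_mul_of_nonneg_left
            ((integral_kernel_deriv_le htn (by linarith)).trans h1) hE0
      _ = 1536 * κ ^ 4 * C0 ^ 3 * (c0 / 2) ^ (-α) * ((H ^ 3 * H ^ (-α)) * (X + a) ^ (α - 4)) := by
          rw [hE]
          ring
      _ ≤ _ := by
          rw [h2]
          gcongr
  have hfar : F * ∫ s in (0:ℝ)..(t n), (s + a) ^ (-(3 * θ - α) - 1) ≤
      384 * κ ^ 7 * C0 ^ 3 / (3 * θ - α) * Y := by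
    have h1 : (τ ^ θ) ^ 3 * a ^ (-(3 * θ - α)) ≤ τ ^ α := by
      have e1 : (τ ^ θ) ^ 3 = τ ^ α * τ ^ (3 * θ - α) := by
        rw [← Real.rpow_natCast, ← Real.rpow_mul ht1.le, ← Real.rpow_add ht1]
        norm_num
        ring_nf
      have e2 : τ ^ (3 * θ - α) ≤ a ^ (3 * θ - α) := Real.rpow_le_rpow ht1.le ha hp.le
      have e3 : 0 < a ^ (3 * θ - α) := Real.rpow_pos_of_pos ha0 _
      rw [e1, Real.rpow_neg ha0.le, ← div_eq_mul_inv, div_le_iff₀ e3]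
      gcongr
    calc F * ∫ s in (0:ℝ)..(t n), (s + a) ^ (-(3 * θ - α) - 1)
        ≤ F * (a ^ (-(3 * θ - α)) / (3 * θ - α)) := by
          gcongr
          exact integral_add_rpow_le ha0 hp htn
      _ = 384 * κ ^ 7 * C0 ^ 3 / (3 * θ - α) *
          (((τ ^ θ) ^ 3 * a ^ (-(3 * θ - α))) * (X ^ (1 - α) / (X + a) ^ 2)) := by
          rw [hF]
          ring
      _ ≤ _ := by
          rw [hY]
          gcongr
  have hend : 18 * (κ ^ 4 * (X + a) ^ (α - 4)) * (X - t n) ^ (3 - α) / (1 - α) ≤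
      18 * κ ^ 4 * C0 ^ (3 - α) / (1 - α) * Y := by
    have h1 : (X - t n) ^ (3 - α) ≤ C0 ^ (3 - α) * H ^ (3 - α) := by
      rw [← Real.mul_rpow hC0.le hH0.le]
      exact Real.rpow_le_rpow (by linarith) (hstep n hn) (by linarith)
    calc 18 * (κ ^ 4 * (X + a) ^ (α - 4)) * (X - t n) ^ (3 - α) / (1 - α)
        ≤ 18 * (κ ^ 4 * (X + a) ^ (α - 4)) * (C0 ^ (3 - α) * H ^ (3 - α)) / (1 - α) := by gcongr
      _ = 18 * κ ^ 4 * C0 ^ (3 - α) / (1 - α) * (H ^ (3 - α) * (X + a) ^ (α - 4)) := by ring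
      _ ≤ _ := by gcongr
  have hfar' := mul_le_mul_of_nonneg_left hfar hα0.le
  linarith

/-- Existence of a discrete barrier function for the Alikhanov operator on
quasi-graded meshes with `1 ≤ r ≤ (3-α)/α` satisfying the Alikhanov mesh
condition (Lemma 4.3). -/
theorem stmt17 (α r T c0 C0 : ℝ)
    (hα0 : 0 < α) (hα1 : α < 1)
    (hr1 : 1 ≤ r) (hr2 : r ≤ (3 - α) / α)
    (hT : 0 < T) (hc0 : 0 < c0) (hcC : c0 ≤ C0) :
    ∃ c C : ℝ, 0 < c ∧ 0 < C ∧
      ∀ (M : ℕ) (t : ℕ → ℝ), IsMesh T M t → QuasiGraded r c0 C0 M t →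
        AlikhanovCond M t →
        ∃ B : ℕ → ℝ, B 0 = 0 ∧
          (∀ j : ℕ, 1 ≤ j → j ≤ M → 0 ≤ B j ∧ B j ≤ C * (t j) ^ (α - 1)) ∧
          (∀ j : ℕ, 1 ≤ j → j ≤ M →
            c * ((t 1) ^ α * (t j) ^ (-α - 1)) ≤ deltaAlik α t B j) := by
  obtain ⟨A, hA, hAbound⟩ := abs_deltaAlik_barrier_sub_le hα0 hα1 hr1 hr2 hc0 hcC
  set L : ℝ := max 1 ((4 * A) ^ (1 / α)) with hL
  have hL1 : 1 ≤ L := le_max_left _ _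
  have hL0 : 0 < L := by linarith
  have hLα : 4 * A ≤ L ^ α :=
    calc 4 * A = ((4 * A) ^ (1 / α)) ^ α := by
          rw [← Real.rpow_mul (by positivity), one_div_mul_cancel hα0.ne', Real.rpow_one]
      _ ≤ L ^ α := Real.rpow_le_rpow (by positivity) (le_max_right _ _) hα0.le
  have hΓ : 0 < Real.Gamma (1 - α) := Real.Gamma_pos_of_pos (by linarith)
  have h1α : 0 < 1 - α := by linarith
  refine ⟨A / (1 + L) ^ 2 / Real.Gamma (1 - α), 1, by positivity, one_pos, ?_⟩
  intro M t hmesh hq _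
  obtain ⟨hM, h0, hlt, -⟩ := hmesh
  have ht1 : 0 < t 1 := by simpa [h0] using hlt 0 (by omega)
  have hle : ∀ j, 1 ≤ j → j ≤ M → t 1 ≤ t j := by
    intro j hj
    induction j, hj using Nat.le_induction with
    | base => exact fun _ => le_rfl
    | succ k _ ih => exact fun hk => (ih (by omega)).trans (hlt k (by omega)).le
  have ha : t 1 ≤ L * t 1 := le_mul_of_one_le_left ht1.le hL1
  have ha0 : 0 < L * t 1 := by positivity
  refine ⟨fun j => barrier α (L * t 1) (t j), by simp [barrier, h0], ?_, ?_⟩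
  · intro j hj hjM
    have htj : 0 < t j := ht1.trans_le (hle j hj hjM)
    refine ⟨by simp only [barrier]; positivity, ?_⟩
    calc t j * (t j + L * t 1) ^ (α - 2) ≤ t j * t j ^ (α - 2) := by
          refine mul_le_mul_of_nonneg_left ?_ htj.le
          exact Real.rpow_le_rpow_of_nonpos htj (by linarith) (by linarith)
      _ = 1 * t j ^ (α - 1) := by
          rw [mul_comm, ← Real.rpow_add_one htj.ne', one_mul]
          ring_nf
  · intro j hj hjM
    obtain ⟨n, rfl⟩ : ∃ n, j = n + 1 := ⟨j - 1, by omega⟩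
    have hτX := hle (n + 1) hj hjM
    have htn : 0 ≤ t n := by
      obtain rfl | hn := n.eq_zero_or_pos
      · exact h0.ge
      · exact ht1.le.trans (hle n hn (by omega))
    have hlast := hlt n (by omega)
    have herr := hAbound M n t (L * t 1) hjM h0 hlt hq ha
    set a := L * t 1 with hadef
    set X := t (n + 1) with hX
    set z := tStar α t (n + 1) with hz
    have hz' : z = X - α / 2 * (X - t n) := rfl
    have hX0 : 0 < X := ht1.trans_le hτX
    have hXz : X / 2 ≤ z := by rw [hz']; nlinarith
    have hzX : z ≤ X := by rw [hz']; nlinarith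
    have hz0 : 0 < z := by linarith
    rw [integral_kernel_mul_barrierDeriv hα0 hα1 ha0 hz0] at herr
    set W := X ^ (1 - α) / (X + a) ^ 2 with hW
    have hW0 : 0 < W := by positivity
    have haα : 4 * A * t 1 ^ α ≤ a ^ α := by
      rw [hadef, Real.mul_rpow hL0.le ht1.le]
      gcongr
    have hexact : a ^ α * W / 2 ≤ a ^ α * z ^ (1 - α) / (z + a) ^ 2 / (1 - α) := by
      have h1 : X ^ (1 - α) / 2 ≤ z ^ (1 - α) := by
        have h2 : (X / 2) ^ (1 - α) ≤ z ^ (1 - α) :=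
          Real.rpow_le_rpow (by positivity) hXz h1α.le
        rw [Real.div_rpow hX0.le (by norm_num)] at h2
        have h3 : (2:ℝ) ^ (1 - α) ≤ 2 :=
          (Real.rpow_le_rpow_of_exponent_le (by norm_num) (by linarith)).trans_eq
            (Real.rpow_one 2)
        refine le_trans ?_ h2
        gcongr
      have h4 : 0 ≤ a ^ α * z ^ (1 - α) / (z + a) ^ 2 := by positivity
      calc a ^ α * W / 2 = a ^ α * (X ^ (1 - α) / 2) / (X + a) ^ 2 := by rw [hW]; ring
        _ ≤ a ^ α * z ^ (1 - α) / (z + a) ^ 2 := by gcongr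
        _ ≤ _ := le_div_self h4 h1α (by linarith)
    have hlow : A * (t 1 ^ α * W) ≤
        Real.Gamma (1 - α) * deltaAlik α t (fun j => barrier α a (t j)) (n + 1) := by
      have h1 := (abs_le.1 herr).1
      have h2 := mul_le_mul_of_nonneg_right haα hW0.le
      linarith
    have hfinal : t 1 ^ α * X ^ (-α - 1) / (1 + L) ^ 2 ≤ t 1 ^ α * W := by
      have h1 : X ^ (-α - 1) = X ^ (1 - α) / X ^ 2 := by
        rw [← Real.rpow_natCast X 2, ← Real.rpow_sub hX0]
        norm_num
        ring_nf
      have h2 : X + a ≤ X * (1 + L) := by nlinarith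
      calc t 1 ^ α * X ^ (-α - 1) / (1 + L) ^ 2
          = t 1 ^ α * (X ^ (1 - α) / (X * (1 + L)) ^ 2) := by
            rw [h1]
            field_simp
        _ ≤ t 1 ^ α * W := by
            rw [hW]
            gcongr
    rw [div_mul_eq_mul_div, div_le_iff₀ hΓ]
    calc A / (1 + L) ^ 2 * (t 1 ^ α * X ^ (-α - 1))
        = A * (t 1 ^ α * X ^ (-α - 1) / (1 + L) ^ 2) := by ring
      _ ≤ A * (t 1 ^ α * W) := by gcongr
      _ ≤ _ := hlow
      _ = _ := mul_comm _ _
end
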